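/- arXiv:1211.3620 — 2 statements merged into one kernel-verified Lean document; each statement's English description precedes it below -/
import Mathlib

section
/- Let J be a real analytic almost complex structure on a neighborhood U of the origin of ℝ^{2n} with J(0) = J₀. Then there exists r > 0 such that for every sequence (x_k)_{k∈ℕ} of vectors of ℝ^{2n} with ∑_{k=0}^∞ ((k+1)/k!)·‖x_k‖ ≤ r, there exists a real analytic J-holomorphic map γ : 𝔻 → U, defined on the open unit disc 𝔻 ⊂ ℂ, such that ∂^kγ/∂x^k(0) = x_k for every k ∈ ℕ. -/
noncomputable section

open Metric

/-- `ℝ^{2n}` identified with `ℂ^n`. -/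
abbrev Ecx (n : ℕ) := EuclideanSpace ℂ (Fin n)

/-- The standard complex structure `J₀` (multiplication by `i`), as a real-linear map. -/
def J0 (n : ℕ) : Ecx n →L[ℝ] Ecx n := Complex.I • ContinuousLinearMap.id ℝ (Ecx n)

variable {F : Type*} [NormedAddCommGroup F] [NormedSpace ℝ F]

/-- `J`-holomorphy of `γ` on a set `D ⊆ ℂ`: `dγ(ζ) ∘ J_st = J(γ ζ) ∘ dγ(ζ)`. -/
def JHolOn (J : F → F →L[ℝ] F) (D : Set ℂ) (γ : ℂ → F) : Prop :=
  ∀ ζ ∈ D, ∀ v : ℂ, fderiv ℝ γ ζ (Complex.I * v) = J (γ ζ) (fderiv ℝ γ ζ v)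

open Filter Topology

section FunctionalCalculus

variable {ι B : Type*} [Fintype ι] [NormedRing B] [NormedAlgebra ℝ B]

/-- Extension of scalars, from `ℝ` to a real Banach algebra, of a formal power series in finitely
many real variables. -/
def algebraSeries (B : Type*) [NormedRing B] [NormedAlgebra ℝ B]
    (p : FormalMultilinearSeries ℝ (ι → ℝ) ℝ) : FormalMultilinearSeries ℝ (ι → B) B :=
  open Classical in
  fun m => ∑ s : Fin m → ι, p m (fun i => Pi.single (s i) 1) •
    (ContinuousMultilinearMap.mkPiAlgebraFin ℝ m B).compContinuousLinearMap
      (fun i => ContinuousLinearMap.proj (R := ℝ) (φ := fun _ : ι => B) (s i))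

lemma norm_algebraSeries_le (p : FormalMultilinearSeries ℝ (ι → ℝ) ℝ) (m : ℕ) :
    ‖algebraSeries B p m‖ ≤ max 1 ‖(1 : B)‖ * (Fintype.card ι : ℝ) ^ m * ‖p m‖ := by
  classical
  refine ContinuousMultilinearMap.opNorm_le_bound (by positivity) fun v => ?_
  have key : ∀ s : Fin m → ι, ‖p m (fun i => Pi.single (s i) 1) •
      ContinuousMultilinearMap.mkPiAlgebraFin ℝ m B (fun i => v i (s i))‖
      ≤ ‖p m‖ * (max 1 ‖(1 : B)‖ * ∏ i, ‖v i‖) := by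
    intro s
    rw [norm_smul]
    refine mul_le_mul ?_ ?_ (norm_nonneg _) (by positivity)
    · refine ((p m).le_opNorm _).trans (mul_le_of_le_one_right (norm_nonneg _) ?_)
      refine Finset.prod_le_one (fun _ _ => norm_nonneg _) fun i _ => ?_
      refine (pi_norm_le_iff_of_nonneg zero_le_one).2 fun j => ?_
      by_cases h : j = s i
      · subst h; simp
      · simp [h]
    · refine (ContinuousMultilinearMap.le_opNorm _ _).trans ?_
      gcongr with i
      · exact ContinuousMultilinearMap.norm_mkPiAlgebraFin_le
      · exact norm_le_pi_norm (v i) (s i)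
  simp only [algebraSeries, _root_.sum_apply, _root_.smul_apply,
    ContinuousMultilinearMap.compContinuousLinearMap_apply, ContinuousLinearMap.proj_apply]
  refine (norm_sum_le_of_le _ fun s _ => key s).trans (le_of_eq ?_)
  simp
  ring

lemma radius_algebraSeries_pos (p : FormalMultilinearSeries ℝ (ι → ℝ) ℝ) (hp : 0 < p.radius) :
    0 < (algebraSeries B p).radius := by
  obtain ⟨C, r, hC, hr, h⟩ := p.le_mul_pow_of_radius_pos hp
  set N : ℝ := Fintype.card ι + 1 with hN
  have hNpos : 0 < N := by positivity
  have hpos : 0 < (N * r)⁻¹ := by positivity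
  refine lt_of_lt_of_le ?_ ((algebraSeries B p).le_radius_of_bound
    (r := ⟨(N * r)⁻¹, hpos.le⟩) (max 1 ‖(1 : B)‖ * C) fun m => ?_)
  · exact ENNReal.coe_pos.2 hpos
  · have h1 := norm_algebraSeries_le (B := B) p m
    have h2 : ((Fintype.card ι : ℝ)) ^ m ≤ N ^ m := by gcongr; simp [hN]
    calc ‖algebraSeries B p m‖ * ((N * r)⁻¹) ^ m
        ≤ (max 1 ‖(1 : B)‖ * N ^ m * (C * r ^ m)) * ((N * r)⁻¹) ^ m := by
          gcongr
          exact h1.trans (by gcongr; exact h m)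
      _ = max 1 ‖(1 : B)‖ * C := by
          rw [inv_pow, mul_pow]
          field_simp

lemma map_algebraSeries (p : FormalMultilinearSeries ℝ (ι → ℝ) ℝ) (χ : B →L[ℝ] ℝ)
    (h1 : χ 1 = 1) (hmul : ∀ a b, χ (a * b) = χ a * χ b) (m : ℕ) (f : ι → B) :
    χ (algebraSeries B p m (fun _ => f)) = p m (fun _ i => χ (f i)) := by
  classical
  let χ' : B →* ℝ := ⟨⟨χ, h1⟩, hmul⟩
  have hχ' : ∀ b, χ b = χ' b := fun _ => rfl
  have hf : (fun i => χ (f i)) = ∑ j, χ (f j) • (Pi.single j 1 : ι → ℝ) := by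
    ext i
    simp [Finset.sum_apply, Pi.single_apply]
  rw [hf, ContinuousMultilinearMap.map_sum]
  simp only [ContinuousMultilinearMap.map_smul_univ]
  simp only [algebraSeries, _root_.sum_apply, map_sum,
    _root_.smul_apply, map_smul, smul_eq_mul,
    ContinuousMultilinearMap.compContinuousLinearMap_apply,
    ContinuousMultilinearMap.mkPiAlgebraFin_apply, ContinuousLinearMap.proj_apply]
  refine Finset.sum_congr rfl fun s _ => ?_
  rw [mul_comm, hχ', map_list_prod, List.map_ofFn, List.prod_ofFn]
  rfl

/-- A real analytic function near the origin of `ℝ^ι` acts on small tuples of elements of a real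
Banach algebra, compatibly with contractive characters. -/
theorem exists_algebra_extension [CompleteSpace B] {φ : (ι → ℝ) → ℝ} (hφ : AnalyticAt ℝ φ 0) :
    ∃ Φ : (ι → B) → B, AnalyticAt ℝ Φ 0 ∧ Φ 0 = φ 0 • (1 : B) ∧
      (HasFDerivAt φ (0 : (ι → ℝ) →L[ℝ] ℝ) 0 → HasFDerivAt Φ (0 : (ι → B) →L[ℝ] B) 0) ∧
      ∀ᶠ f in 𝓝 (0 : ι → B), ∀ χ : B →L[ℝ] ℝ, ‖χ‖ ≤ 1 → χ 1 = 1 →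
        (∀ a b, χ (a * b) = χ a * χ b) → χ (Φ f) = φ fun i => χ (f i) := by
  classical
  obtain ⟨p, R, hp⟩ := hφ
  have hpos := radius_algebraSeries_pos (B := B) p (hp.r_pos.trans_le hp.r_le)
  have hq := (algebraSeries B p).hasFPowerSeriesOnBall hpos
  refine ⟨(algebraSeries B p).sum, hq.analyticAt, ?_, fun h0 => ?_, ?_⟩
  · rw [← hq.coeff_zero (fun _ => 0), ← hp.coeff_zero (fun _ => 0)]
    simp only [algebraSeries, _root_.sum_apply,
      _root_.smul_apply]
    simp
    congr 2
    exact Subsingleton.elim _ _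
  · have h1 : continuousMultilinearCurryFin1 ℝ (ι → ℝ) ℝ (p 1) = 0 :=
      hp.hasFPowerSeriesAt.hasFDerivAt.unique h0
    have h1' : p 1 = 0 := by simpa using h1
    have h2 : algebraSeries B p 1 = 0 := by
      ext; simp [algebraSeries, h1']
    simpa [h2] using hq.hasFPowerSeriesAt.hasFDerivAt
  · have e1 : ∀ᶠ f in 𝓝 (0 : ι → B), f ∈ Metric.eball (0 : ι → B) (algebraSeries B p).radius :=
      Metric.eball_mem_nhds _ hpos
    have e2 : ∀ᶠ f in 𝓝 (0 : ι → B), f ∈ Metric.eball (0 : ι → B) R :=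
      Metric.eball_mem_nhds _ hp.r_pos
    filter_upwards [e1, e2] with f hf1 hf2 χ hχ hχ1 hχm
    have s1 := (hq.hasSum hf1).mapL χ
    have hmem : (fun i => χ (f i)) ∈ Metric.eball (0 : ι → ℝ) R := by
      rw [Metric.mem_eball, edist_zero_right] at hf2 ⊢
      refine lt_of_le_of_lt ?_ hf2
      rw [← ofReal_norm, ← ofReal_norm]
      refine ENNReal.ofReal_le_ofReal ((pi_norm_le_iff_of_nonneg (norm_nonneg _)).2 fun i => ?_)
      exact (χ.le_of_opNorm_le hχ _).trans (by simpa using norm_le_pi_norm f i)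
    have s2 := hp.hasSum hmem
    simp only [map_algebraSeries p χ hχ1 hχm, zero_add] at s1 s2
    exact s1.unique s2

end FunctionalCalculus

section Uniqueness

lemma analyticAt_clm_apply {E G : Type*} [NormedAddCommGroup E] [NormedSpace ℝ E]
    [NormedAddCommGroup G] [NormedSpace ℝ G] {M : E → F →L[ℝ] G} {u : E → F} {x : E}
    (hM : AnalyticAt ℝ M x) (hu : AnalyticAt ℝ u x) : AnalyticAt ℝ (fun y => M y (u y)) x :=
  AnalyticAt.comp (g := fun p : (F →L[ℝ] G) × F => p.1 p.2) (f := fun y => (M y, u y))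
    ((ContinuousLinearMap.id ℝ (F →L[ℝ] G)).analyticAt_bilinear (M x, u x)) (hM.prod hu)

/-- All derivatives of `u` of order less than `k` in the direction `i` vanish on the real diameter
of the unit disc. -/
def VanishesToOrder : ℕ → (ℂ → F) → Prop
  | 0, _ => True
  | k + 1, u => (∀ ζ ∈ ball (0 : ℂ) 1, ζ.im = 0 → u ζ = 0) ∧
      VanishesToOrder k (fun ζ => fderiv ℝ u ζ Complex.I)

namespace VanishesToOrder

variable {u v : ℂ → F} {k : ℕ}

lemma congr (huv : Set.EqOn u v (ball 0 1)) (hu : VanishesToOrder k u) : VanishesToOrder k v := by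
  induction k generalizing u v with
  | zero => trivial
  | succ k ih =>
    refine ⟨fun ζ hζ h0 => (huv hζ).symm.trans (hu.1 ζ hζ h0), ih (fun ζ hζ => ?_) hu.2⟩
    have : u =ᶠ[𝓝 ζ] v := huv.eventuallyEq_of_mem (isOpen_ball.mem_nhds hζ)
    simp only [this.fderiv_eq]

lemma of_succ (hu : VanishesToOrder (k + 1) u) : VanishesToOrder k u := by
  induction k generalizing u with
  | zero => trivial
  | succ k ih => exact ⟨hu.1, ih hu.2⟩

lemma analytic_fderiv_apply [CompleteSpace F] (hu : AnalyticOnNhd ℝ u (ball 0 1)) (w : ℂ) :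
    AnalyticOnNhd ℝ (fun ζ => fderiv ℝ u ζ w) (ball 0 1) :=
  fun ζ hζ => ((ContinuousLinearMap.apply ℝ F w).analyticAt _).comp (hu.fderiv ζ hζ)

lemma add (hua : AnalyticOnNhd ℝ u (ball 0 1)) (hva : AnalyticOnNhd ℝ v (ball 0 1))
    [CompleteSpace F] (hu : VanishesToOrder k u) (hv : VanishesToOrder k v) :
    VanishesToOrder k (fun ζ => u ζ + v ζ) := by
  induction k generalizing u v with
  | zero => trivial
  | succ k ih =>
    refine ⟨fun ζ hζ h0 => by simp [hu.1 ζ hζ h0, hv.1 ζ hζ h0], ?_⟩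
    refine congr (fun ζ hζ => ?_) (ih (analytic_fderiv_apply hua _)
      (analytic_fderiv_apply hva _) hu.2 hv.2)
    rw [fderiv_fun_add (hua ζ hζ).differentiableAt (hva ζ hζ).differentiableAt]
    rfl

lemma clm_apply {G : Type*} [NormedAddCommGroup G] [NormedSpace ℝ G] [CompleteSpace F]
    [CompleteSpace G] {M : ℂ → F →L[ℝ] G} (hM : AnalyticOnNhd ℝ M (ball 0 1))
    (hua : AnalyticOnNhd ℝ u (ball 0 1)) (hu : VanishesToOrder k u) :
    VanishesToOrder k (fun ζ => M ζ (u ζ)) := by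
  induction k generalizing u M with
  | zero => trivial
  | succ k ih =>
    refine ⟨fun ζ hζ h0 => by simp [hu.1 ζ hζ h0], ?_⟩
    have hM' := analytic_fderiv_apply hM Complex.I
    have hu' := analytic_fderiv_apply hua Complex.I
    refine congr (fun ζ hζ => ?_) (.add (fun ζ hζ => analyticAt_clm_apply (hM' ζ hζ) (hua ζ hζ))
      (fun ζ hζ => analyticAt_clm_apply (hM ζ hζ) (hu' ζ hζ)) (ih hM' hua hu.of_succ) (ih hM hu' hu.2))
    rw [fderiv_clm_apply (hM ζ hζ).differentiableAt (hua ζ hζ).differentiableAt]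
    simp [add_comm]

lemma fderiv_one [CompleteSpace F] (hua : AnalyticOnNhd ℝ u (ball 0 1))
    (hu : VanishesToOrder k u) : VanishesToOrder k (fun ζ => fderiv ℝ u ζ 1) := by
  induction k generalizing u with
  | zero => trivial
  | succ k ih =>
    refine ⟨fun ζ hζ h0 => ?_, ?_⟩
    · have h1 : HasDerivAt (fun t : ℝ => ζ + (t : ℂ)) 1 0 := by
        simpa using (Complex.ofRealCLM.hasDerivAt (x := (0 : ℝ))).const_add ζ
      have h2 : HasDerivAt (fun t : ℝ => u (ζ + (t : ℂ))) (fderiv ℝ u ζ 1) 0 :=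
        HasFDerivAt.comp_hasDerivAt_of_eq (0 : ℝ) (hua ζ hζ).differentiableAt.hasFDerivAt h1
          (by simp)
      have h3 : (fun t : ℝ => u (ζ + (t : ℂ))) =ᶠ[𝓝 0] fun _ => 0 := by
        have hc : Tendsto (fun t : ℝ => ζ + (t : ℂ)) (𝓝 0) (𝓝 ζ) := by
          simpa using h1.continuousAt.tendsto
        filter_upwards [hc (isOpen_ball.mem_nhds hζ)] with t ht
        exact hu.1 _ ht (by simp [h0])
      exact h2.unique ((hasDerivAt_const (0 : ℝ) (0 : F)).congr_of_eventuallyEq h3)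
    · refine congr (fun ζ hζ => ?_) (ih (analytic_fderiv_apply hua _) hu.2)
      have hd := (hua.fderiv ζ hζ).differentiableAt
      have hs : IsSymmSndFDerivAt ℝ u ζ :=
        ContDiffAt.isSymmSndFDerivAt_of_omega (hua ζ hζ).contDiffAt
      rw [fderiv_clm_apply hd (differentiableAt_const _),
        fderiv_clm_apply hd (differentiableAt_const _)]
      simpa using hs 1 Complex.I

lemma iteratedDeriv_eq_zero [CompleteSpace F] (hua : AnalyticOnNhd ℝ u (ball 0 1))
    (hu : VanishesToOrder (k + 1) u) {x : ℝ} (hx : (x : ℂ) ∈ ball (0 : ℂ) 1) :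
    iteratedDeriv k (fun t : ℝ => u (x + t * Complex.I)) 0 = 0 := by
  induction k generalizing u with
  | zero => simpa using hu.1 x hx (by simp)
  | succ k ih =>
    rw [iteratedDeriv_succ']
    have hev : deriv (fun t : ℝ => u (x + t * Complex.I)) =ᶠ[𝓝 0]
        fun t : ℝ => fderiv ℝ u (x + t * Complex.I) Complex.I := by
      have hc : Tendsto (fun t : ℝ => (x : ℂ) + t * Complex.I) (𝓝 0) (𝓝 x) := by
        have : Continuous fun t : ℝ => (x : ℂ) + t * Complex.I := by fun_prop
        simpa using this.tendsto 0
      filter_upwards [hc (isOpen_ball.mem_nhds hx)] with t ht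
      have h1 : HasDerivAt (fun t : ℝ => (x : ℂ) + t * Complex.I) Complex.I t := by
        simpa using ((Complex.ofRealCLM.hasDerivAt (x := t)).mul_const Complex.I).const_add (x : ℂ)
      exact (HasFDerivAt.comp_hasDerivAt t (hua _ ht).differentiableAt.hasFDerivAt h1).deriv
    rw [hev.iteratedDeriv_eq]
    exact ih (analytic_fderiv_apply hua _) hu.2

lemma eq_zero [CompleteSpace F] (hua : AnalyticOnNhd ℝ u (ball 0 1))
    (hu : ∀ k, VanishesToOrder k u) {ζ : ℂ} (hζ : ζ ∈ ball (0 : ℂ) 1) : u ζ = 0 := by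
  set f : ℝ → F := fun t => u (ζ.re + t * Complex.I) with hf
  let g : ℝ →ᵃ[ℝ] ℂ :=
    (LinearMap.toSpanSingleton ℝ ℂ Complex.I).toAffineMap + AffineMap.const ℝ ℝ (ζ.re : ℂ)
  have hg : ∀ t : ℝ, g t = ζ.re + t * Complex.I := fun t => by simp [g, add_comm]
  have hconv : Convex ℝ (g ⁻¹' ball 0 1) := (convex_ball (0 : ℂ) 1).affine_preimage g
  have hx : (ζ.re : ℂ) ∈ ball (0 : ℂ) 1 := by
    rw [mem_ball_zero_iff] at hζ ⊢
    exact lt_of_le_of_lt (by simpa using Complex.abs_re_le_norm ζ) hζ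
  have hfa : AnalyticOnNhd ℝ f (g ⁻¹' ball 0 1) := by
    intro t ht
    have ht' : (ζ.re : ℂ) + t * Complex.I ∈ ball (0 : ℂ) 1 := by simpa [hg] using ht
    have h1 : AnalyticAt ℝ (fun t : ℝ => (ζ.re : ℂ) + t * Complex.I) t :=
      analyticAt_const.add ((Complex.ofRealCLM.analyticAt t).mul analyticAt_const)
    exact AnalyticAt.comp (hua _ ht') h1
  have h0 : (0 : ℝ) ∈ g ⁻¹' ball 0 1 := by
    change g 0 ∈ ball (0 : ℂ) 1
    rw [hg]; simpa using hx
  have htop : analyticOrderAt f 0 = ⊤ := by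
    refine ENat.eq_top_iff_forall_ge.2 fun n => ?_
    rw [natCast_le_analyticOrderAt_iff_iteratedDeriv_eq_zero (hfa 0 h0)]
    exact fun i _ => iteratedDeriv_eq_zero hua (hu (i + 1)) hx
  have hz := hfa.eqOn_zero_of_preconnected_of_eventuallyEq_zero hconv.isPreconnected h0
    (analyticOrderAt_eq_top.1 htop)
  have : ζ.im ∈ g ⁻¹' ball 0 1 := by
    change g ζ.im ∈ ball (0 : ℂ) 1
    rw [hg, Complex.re_add_im]; exact hζ
  have h2 := hz this
  simpa [hf, Complex.re_add_im] using h2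

end VanishesToOrder

/-- Uniqueness for the Cauchy problem of a linear first order analytic system on the disc. -/
theorem eq_zero_of_cauchy [CompleteSpace F] {u : ℂ → F} {M N : ℂ → F →L[ℝ] F}
    (hu : AnalyticOnNhd ℝ u (ball 0 1)) (hM : AnalyticOnNhd ℝ M (ball 0 1))
    (hN : AnalyticOnNhd ℝ N (ball 0 1))
    (hpde : ∀ ζ ∈ ball (0 : ℂ) 1,
      fderiv ℝ u ζ Complex.I = M ζ (fderiv ℝ u ζ 1) + N ζ (u ζ))
    (h0 : ∀ ζ ∈ ball (0 : ℂ) 1, ζ.im = 0 → u ζ = 0) {ζ : ℂ} (hζ : ζ ∈ ball (0 : ℂ) 1) :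
    u ζ = 0 := by
  refine VanishesToOrder.eq_zero hu (fun k => ?_) hζ
  induction k with
  | zero => trivial
  | succ k ih =>
    have hux := VanishesToOrder.analytic_fderiv_apply hu 1
    exact ⟨h0, .congr (fun ζ hζ => (hpde ζ hζ).symm)
      (.add (fun ζ hζ => analyticAt_clm_apply (hM ζ hζ) (hux ζ hζ))
        (fun ζ hζ => analyticAt_clm_apply (hN ζ hζ) (hu ζ hζ)) (.clm_apply hM hux (ih.fderiv_one hu))
        (.clm_apply hN hu ih))⟩

end Uniqueness

section BidiscAlgebra

/-- Absolutely summable double power series `∑ a_{jk} z^j w^k` with complex coefficients. -/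
def BidiscAlgebra : Type := lp (fun _ : ℕ × ℕ => ℂ) 1

namespace BidiscAlgebra

instance : NormedAddCommGroup BidiscAlgebra :=
  inferInstanceAs (NormedAddCommGroup (lp (fun _ : ℕ × ℕ => ℂ) 1))

instance : NormedSpace ℂ BidiscAlgebra :=
  inferInstanceAs (NormedSpace ℂ (lp (fun _ : ℕ × ℕ => ℂ) 1))

instance : CompleteSpace BidiscAlgebra :=
  inferInstanceAs (CompleteSpace (lp (fun _ : ℕ × ℕ => ℂ) 1))

/-- The coefficient of a double power series. -/
def coeff (i : ℕ × ℕ) : BidiscAlgebra →L[ℂ] ℂ := lp.evalCLM ℂ (fun _ : ℕ × ℕ => ℂ) 1 i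

/-- The monomial `z^j w^k`. -/
def mono (i : ℕ × ℕ) : BidiscAlgebra := lp.single (E := fun _ : ℕ × ℕ => ℂ) 1 i (1 : ℂ)

lemma norm_mono (i : ℕ × ℕ) : ‖mono i‖ = 1 :=
  (lp.norm_single (E := fun _ : ℕ × ℕ => ℂ) one_pos i 1).trans norm_one

lemma hasSum_coeff_norm (a : BidiscAlgebra) : HasSum (fun i => ‖coeff i a‖) ‖a‖ := by
  have h := lp.hasSum_norm (E := fun _ : ℕ × ℕ => ℂ) (p := 1) (by simp) a
  simp only [ENNReal.toReal_one, Real.rpow_one] at h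
  exact h

lemma hasSum_mono (a : BidiscAlgebra) : HasSum (fun i => coeff i a • mono i) a := by
  have h := lp.hasSum_single (E := fun _ : ℕ × ℕ => ℂ) (p := 1) (by simp) a
  have h' : (fun i => coeff i a • mono i) =
      fun i => lp.single (E := fun _ : ℕ × ℕ => ℂ) 1 i (coeff i a) := by
    ext1 i
    refine (lp.single_smul (E := fun _ : ℕ × ℕ => ℂ) 1 i (coeff i a) (1 : ℂ)).symm.trans ?_
    rw [smul_eq_mul, mul_one]
  rw [h']
  exact h

lemma coeff_mono (i j : ℕ × ℕ) : coeff i (mono j) = if i = j then 1 else 0 := by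
  have : coeff i (mono j) = lp.single (E := fun _ : ℕ × ℕ => ℂ) 1 j (1 : ℂ) i := rfl
  rw [this, lp.single_apply, Pi.single_apply]

variable {E : Type*} [NormedAddCommGroup E]

lemma ext_real [NormedSpace ℝ E] {f g : BidiscAlgebra →L[ℝ] E}
    (h : ∀ (c : ℂ) i, f (c • mono i) = g (c • mono i)) : f = g := by
  ext a
  have hf := (hasSum_mono a).mapL f
  simp only [h] at hf
  exact hf.unique ((hasSum_mono a).mapL g)

variable [NormedSpace ℂ E]

lemma ext_mono {f g : BidiscAlgebra →L[ℂ] E} (h : ∀ i, f (mono i) = g (mono i)) : f = g := by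
  ext a
  have hf := (hasSum_mono a).mapL f
  simp only [map_smul, h] at hf
  simpa using hf.unique (by simpa using (hasSum_mono a).mapL g)

lemma ext_mono₂ {f g : BidiscAlgebra →L[ℂ] BidiscAlgebra →L[ℂ] E}
    (h : ∀ i j, f (mono i) (mono j) = g (mono i) (mono j)) : f = g :=
  ext_mono fun i => ext_mono fun j => h i j

variable [CompleteSpace E]

lemma summable_coeff_smul {v : ℕ × ℕ → E} (hv : ∀ i, ‖v i‖ ≤ 1) (a : BidiscAlgebra) :
    Summable fun i => coeff i a • v i :=
  .of_norm_bounded (hasSum_coeff_norm a).summable fun i => by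
    rw [norm_smul]; exact mul_le_of_le_one_right (norm_nonneg _) (hv i)

/-- The bounded linear map with prescribed values, in the unit ball, on the monomials. -/
def lift (v : ℕ × ℕ → E) (hv : ∀ i, ‖v i‖ ≤ 1) : BidiscAlgebra →L[ℂ] E :=
  LinearMap.mkContinuous
    { toFun := fun a => ∑' i, coeff i a • v i
      map_add' := fun a b => by
        simp only [map_add, add_smul]
        exact (summable_coeff_smul hv a).tsum_add (summable_coeff_smul hv b)
      map_smul' := fun c a => by
        simp only [map_smul, smul_eq_mul, mul_smul, RingHom.id_apply]
        exact (summable_coeff_smul hv a).tsum_const_smul c } 1 fun a => by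
    rw [one_mul]
    refine tsum_of_norm_bounded (hasSum_coeff_norm a) fun i => ?_
    rw [norm_smul]; exact mul_le_of_le_one_right (norm_nonneg _) (hv i)

lemma norm_lift_le (v : ℕ × ℕ → E) (hv : ∀ i, ‖v i‖ ≤ 1) : ‖lift v hv‖ ≤ 1 :=
  LinearMap.mkContinuous_norm_le _ zero_le_one _

@[simp]
lemma lift_mono (v : ℕ × ℕ → E) (hv : ∀ i, ‖v i‖ ≤ 1) (i : ℕ × ℕ) : lift v hv (mono i) = v i := by
  change ∑' j, coeff j (mono i) • v j = v i
  rw [tsum_eq_single i fun j hj => by simp [coeff_mono, hj]]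
  simp [coeff_mono]

/-- Multiplication of double power series. -/
def mulL : BidiscAlgebra →L[ℂ] BidiscAlgebra →L[ℂ] BidiscAlgebra :=
  lift (fun i => lift (fun j => mono (i + j)) fun _ => (norm_mono _).le) fun _ => norm_lift_le _ _

lemma mulL_mono (i j : ℕ × ℕ) : mulL (mono i) (mono j) = mono (i + j) := by simp [mulL]

lemma norm_mulL_le (a b : BidiscAlgebra) : ‖mulL a b‖ ≤ ‖a‖ * ‖b‖ := by
  simpa using mulL.le_of_opNorm₂_le_of_le (norm_lift_le _ _) le_rfl le_rfl (x := a) (y := b)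

instance : Mul BidiscAlgebra := ⟨fun a b => mulL a b⟩

instance : One BidiscAlgebra := ⟨mono 0⟩

lemma mul_def (a b : BidiscAlgebra) : a * b = mulL a b := rfl

lemma one_def : (1 : BidiscAlgebra) = mono 0 := rfl

lemma mul_assoc' (a b c : BidiscAlgebra) : a * b * c = a * (b * c) := by
  simp only [mul_def]
  have h : ∀ k, (ContinuousLinearMap.compL ℂ _ _ _ (mulL.flip (mono k))).comp mulL =
      ((ContinuousLinearMap.compL ℂ _ _ _).flip (mulL.flip (mono k))).comp mulL := fun k =>
    ext_mono₂ fun i j => by simp [mulL_mono, add_assoc]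
  have h' : mulL (mulL a b) = (mulL a).comp (mulL b) := ext_mono fun k => by
    simpa using congrArg (fun T => T a b) (h k)
  simpa using congrArg (fun T => T c) h'

instance : NormedRing BidiscAlgebra where
  __ := (inferInstance : NormedAddCommGroup BidiscAlgebra)
  __ := (inferInstance : Mul BidiscAlgebra)
  __ := (inferInstance : One BidiscAlgebra)
  left_distrib a b c := map_add (mulL a) b c
  right_distrib a b c := by simp [mul_def]
  zero_mul a := by simp [mul_def]
  mul_zero a := by simp [mul_def]
  mul_assoc := mul_assoc'
  one_mul a := congrArg (fun T => T a) (ext_mono (f := mulL (mono 0)) (g := .id ℂ _) fun i => by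
    simp [mulL_mono])
  mul_one a := congrArg (fun T => T a) (ext_mono (f := mulL.flip (mono 0)) (g := .id ℂ _)
    fun i => by simp [mulL_mono])
  norm_mul_le := norm_mulL_le

instance : NormedAlgebra ℝ BidiscAlgebra where
  __ := Algebra.ofModule (R := ℝ) (A := BidiscAlgebra)
    (fun r a b => by
      change mulL (r • a) b = r • mulL a b
      rw [ContinuousLinearMap.map_smul_of_tower]; rfl)
    (fun r a b => by
      change mulL a (r • b) = r • mulL a b
      rw [ContinuousLinearMap.map_smul_of_tower])
  norm_smul_le r a := norm_smul_le r a

lemma coeff_star_summable (a : BidiscAlgebra) :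
    Summable fun i => starRingEnd ℂ (coeff i a) • mono i.swap :=
  .of_norm_bounded (hasSum_coeff_norm a).summable fun i => by
    rw [norm_smul, norm_mono, mul_one, RCLike.norm_conj]

/-- The conjugation `a(z, w) ↦ conj (a(conj w, conj z))`. -/
def conjL : BidiscAlgebra →L[ℝ] BidiscAlgebra :=
  LinearMap.mkContinuous
    { toFun := fun a => ∑' i, starRingEnd ℂ (coeff i a) • mono i.swap
      map_add' := fun a b => by
        simp only [map_add, add_smul]
        exact (coeff_star_summable a).tsum_add (coeff_star_summable b)
      map_smul' := fun c a => by
        have : ∀ i, starRingEnd ℂ (coeff i (c • a)) • mono i.swap =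
            c • starRingEnd ℂ (coeff i a) • mono i.swap := fun i => by
          rw [ContinuousLinearMap.map_smul_of_tower, Complex.real_smul, map_mul,
            Complex.conj_ofReal, mul_smul, Complex.coe_smul]
        simp only [this, RingHom.id_apply]
        exact (coeff_star_summable a).tsum_const_smul c } 1 fun a => by
    rw [one_mul]
    refine tsum_of_norm_bounded (hasSum_coeff_norm a) fun i => ?_
    rw [norm_smul, norm_mono, mul_one, RCLike.norm_conj]

lemma conjL_smul (c : ℂ) (a : BidiscAlgebra) : conjL (c • a) = starRingEnd ℂ c • conjL a := by
  change ∑' i, starRingEnd ℂ (coeff i (c • a)) • mono i.swap = starRingEnd ℂ c • ∑' i, _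
  rw [← (coeff_star_summable a).tsum_const_smul]
  simp [mul_smul]

lemma conjL_mono (i : ℕ × ℕ) : conjL (mono i) = mono i.swap := by
  change ∑' j, starRingEnd ℂ (coeff j (mono i)) • mono j.swap = mono i.swap
  rw [tsum_eq_single i fun j hj => by simp [coeff_mono, hj]]
  simp [coeff_mono]

lemma conjL_mul (a b : BidiscAlgebra) : conjL (a * b) = conjL a * conjL b := by
  have h : ∀ (c : ℂ) i, conjL ∘L (mulL (c • mono i)).restrictScalars ℝ =
      (mulL (conjL (c • mono i))).restrictScalars ℝ ∘L conjL := fun c i =>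
    ext_real fun d j => by simp [conjL_smul, conjL_mono, mulL_mono]
  simp only [mul_def]
  have h' : conjL ∘L (mulL.flip b).restrictScalars ℝ =
      (mulL.flip (conjL b)).restrictScalars ℝ ∘L conjL :=
    ext_real fun c i => by simpa using congrArg (fun T => T b) (h c i)
  simpa using congrArg (fun T => T a) h'

lemma conjL_one : conjL 1 = 1 := conjL_mono 0

/-- The double power series which are real valued on the antidiagonal `w = conj z`. -/
def realPart : Subalgebra ℝ BidiscAlgebra where
  carrier := {a | conjL a = a}
  mul_mem' {a b} ha hb := by
    simp only [Set.mem_ofPred_eq] at ha hb ⊢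
    rw [conjL_mul, ha, hb]
  add_mem' {a b} ha hb := by
    simp only [Set.mem_ofPred_eq] at ha hb ⊢
    rw [map_add, ha, hb]
  algebraMap_mem' r := by
    simp [Algebra.algebraMap_eq_smul_one, conjL_one]

lemma mem_realPart {a : BidiscAlgebra} : a ∈ realPart ↔ conjL a = a := Iff.rfl

instance : CompleteSpace realPart :=
  (isClosed_eq conjL.continuous continuous_id : IsClosed {a | conjL a = a}).completeSpace_coe

/-- Restriction of an operator commuting with the conjugation. -/
def restrictReal (T : BidiscAlgebra →L[ℂ] BidiscAlgebra)
    (hT : ∀ i, conjL (T (mono i)) = T (mono i.swap)) : realPart →L[ℝ] realPart :=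
  LinearMap.mkContinuous
    { toFun := fun b => ⟨T b, by
        have h : conjL ∘L T.restrictScalars ℝ = T.restrictScalars ℝ ∘L conjL :=
          ext_real fun c i => by simp [conjL_smul, conjL_mono, hT]
        have := congrArg (fun S => S (b : BidiscAlgebra)) h
        simpa [mem_realPart, mem_realPart.1 b.2] using this⟩
      map_add' := fun a b => Subtype.ext (map_add T (a : BidiscAlgebra) b)
      map_smul' := fun c a => Subtype.ext (T.map_smul_of_tower c (a : BidiscAlgebra)) } ‖T‖
    fun b => T.le_opNorm (b : BidiscAlgebra)

lemma coe_restrictReal (T : BidiscAlgebra →L[ℂ] BidiscAlgebra)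
    (hT : ∀ i, conjL (T (mono i)) = T (mono i.swap)) (b : realPart) :
    (restrictReal T hT b : BidiscAlgebra) = T b := rfl

/-- The backward shift in the first variable. -/
def shiftZ : BidiscAlgebra →L[ℂ] BidiscAlgebra :=
  lift (fun i => if i.1 = 0 then 0 else mono (i.1 - 1, i.2)) fun i => by
    split_ifs <;> simp [norm_mono]

/-- The backward shift in the second variable. -/
def shiftW : BidiscAlgebra →L[ℂ] BidiscAlgebra :=
  lift (fun i => if i.2 = 0 then 0 else mono (i.1, i.2 - 1)) fun i => by
    split_ifs <;> simp [norm_mono]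

lemma norm_shiftZ_le : ‖shiftZ‖ ≤ 1 := norm_lift_le _ _

lemma norm_shiftW_le : ‖shiftW‖ ≤ 1 := norm_lift_le _ _

/-- Evaluation of a double power series at `(ζ, conj ζ)`, written with resolvents. -/
def ev (ζ : ℂ) : BidiscAlgebra →L[ℂ] ℂ :=
  coeff 0 ∘L (Ring.inverse (1 - ζ • shiftZ) * Ring.inverse (1 - starRingEnd ℂ ζ • shiftW))

lemma isUnit_one_sub_smul {ζ : ℂ} (hζ : ζ ∈ ball (0 : ℂ) 1)
    {T : BidiscAlgebra →L[ℂ] BidiscAlgebra} (hT : ‖T‖ ≤ 1) : IsUnit (1 - ζ • T) := by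
  have h : ‖ζ • T‖ < 1 := by
    rw [norm_smul]
    exact (mul_le_of_le_one_right (norm_nonneg _) hT).trans_lt (by simpa using hζ)
  exact isUnit_one_sub_of_norm_lt_one h

lemma conj_mem_ball {ζ : ℂ} (hζ : ζ ∈ ball (0 : ℂ) 1) : starRingEnd ℂ ζ ∈ ball (0 : ℂ) 1 := by
  simpa using hζ

lemma ev_eq_lift {ζ : ℂ} (hζ : ζ ∈ ball (0 : ℂ) 1) :
    ev ζ = lift (fun i => ζ ^ i.1 * starRingEnd ℂ ζ ^ i.2) (fun i => by
      have h : ‖ζ‖ ≤ 1 := by simpa using (mem_ball_zero_iff.1 hζ).le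
      rw [norm_mul, norm_pow, norm_pow, RCLike.norm_conj]
      exact mul_le_one₀ (pow_le_one₀ (norm_nonneg _) h) (by positivity)
        (pow_le_one₀ (norm_nonneg _) h)) := by
  set L : BidiscAlgebra →L[ℂ] ℂ := lift _ _ with hL
  have h : L ∘L ((1 - starRingEnd ℂ ζ • shiftW) * (1 - ζ • shiftZ)) = coeff 0 := by
    refine ext_mono fun ⟨j, k⟩ => ?_
    rcases j with - | j <;> rcases k with - | k <;>
      simp [hL, shiftZ, shiftW, coeff_mono, Prod.ext_iff] <;> ring
  have hZ := Ring.mul_inverse_cancel _ (isUnit_one_sub_smul hζ norm_shiftZ_le)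
  have hW := Ring.mul_inverse_cancel _
    (isUnit_one_sub_smul (conj_mem_ball hζ) norm_shiftW_le)
  rw [ev, ← h, ContinuousLinearMap.comp_assoc, ← ContinuousLinearMap.mul_def, mul_assoc,
    ← mul_assoc (1 - ζ • shiftZ), hZ, one_mul, hW]
  rfl

lemma ev_mono {ζ : ℂ} (hζ : ζ ∈ ball (0 : ℂ) 1) (i : ℕ × ℕ) :
    ev ζ (mono i) = ζ ^ i.1 * starRingEnd ℂ ζ ^ i.2 := by
  rw [ev_eq_lift hζ, lift_mono]

lemma norm_ev_le {ζ : ℂ} (hζ : ζ ∈ ball (0 : ℂ) 1) : ‖ev ζ‖ ≤ 1 := by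
  rw [ev_eq_lift hζ]
  exact norm_lift_le _ _

lemma ev_mul {ζ : ℂ} (hζ : ζ ∈ ball (0 : ℂ) 1) (a b : BidiscAlgebra) :
    ev ζ (a * b) = ev ζ a * ev ζ b := by
  have h : ∀ i, ev ζ ∘L mulL (mono i) = ev ζ (mono i) • ev ζ := fun i => ext_mono fun j => by
    simp [mulL_mono, ev_mono hζ]; ring
  rw [mul_def]
  have h' : ev ζ ∘L mulL.flip b = ev ζ b • ev ζ := ext_mono fun i => by
    simpa [mul_comm] using congrArg (fun T => T b) (h i)
  simpa [mul_comm] using congrArg (fun T => T a) h'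

lemma ev_conjL {ζ : ℂ} (hζ : ζ ∈ ball (0 : ℂ) 1) (a : BidiscAlgebra) :
    ev ζ (conjL a) = starRingEnd ℂ (ev ζ a) := by
  have h : (ev ζ).restrictScalars ℝ ∘L conjL =
      (Complex.conjCLE : ℂ →L[ℝ] ℂ) ∘L (ev ζ).restrictScalars ℝ := ext_real fun c i => by
    simp [conjL_smul, conjL_mono, ev_mono hζ, mul_comm]
  simpa using congrArg (fun T => T a) h

lemma analyticOnNhd_ev : AnalyticOnNhd ℝ ev (ball 0 1) := by
  intro ζ hζ
  have key : ∀ {η : ℂ → ℂ} {T : BidiscAlgebra →L[ℂ] BidiscAlgebra}, AnalyticAt ℝ η ζ →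
      IsUnit (1 - η ζ • T) → AnalyticAt ℝ (fun ζ => Ring.inverse (1 - η ζ • T)) ζ := by
    intro η T hη hu
    obtain ⟨u, hu⟩ := hu
    have h1 : AnalyticAt ℝ (Ring.inverse : (BidiscAlgebra →L[ℂ] BidiscAlgebra) → _)
        (1 - η ζ • T) := by
      rw [← hu]; exact analyticAt_inverse u
    have h2 : AnalyticAt ℝ (fun ζ => 1 - η ζ • T) ζ := by
      refine analyticAt_const.sub ?_
      exact AnalyticAt.comp (g := fun c : ℂ => c • T)
        (((ContinuousLinearMap.toSpanSingleton ℂ T).restrictScalars ℝ).analyticAt _) hη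
    exact AnalyticAt.comp (g := Ring.inverse) (f := fun ζ => 1 - η ζ • T) h1 h2
  have hZ := key (η := id) (T := shiftZ) analyticAt_id (isUnit_one_sub_smul hζ norm_shiftZ_le)
  have hW := key (T := shiftW) (Complex.conjCLE.toContinuousLinearMap.analyticAt ζ)
    (isUnit_one_sub_smul (conj_mem_ball hζ) norm_shiftW_le)
  exact AnalyticAt.comp (g := fun T : BidiscAlgebra →L[ℂ] BidiscAlgebra => coeff 0 ∘L T)
    (((ContinuousLinearMap.compL ℂ BidiscAlgebra BidiscAlgebra ℂ (coeff 0)).restrictScalars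
      ℝ).analyticAt _) (hZ.mul hW)

lemma fderiv_ev_mono {ζ : ℂ} (hζ : ζ ∈ ball (0 : ℂ) 1) (v : ℂ) (i : ℕ × ℕ) :
    fderiv ℝ ev ζ v (mono i) = i.1 * ζ ^ (i.1 - 1) * v * starRingEnd ℂ ζ ^ i.2 +
      ζ ^ i.1 * (i.2 * starRingEnd ℂ ζ ^ (i.2 - 1) * starRingEnd ℂ v) := by
  have h1 : HasFDerivAt (fun ζ => ev ζ (mono i))
      (((ContinuousLinearMap.apply ℂ ℂ (mono i)).restrictScalars ℝ) ∘L fderiv ℝ ev ζ) ζ :=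
    ((ContinuousLinearMap.apply ℂ ℂ (mono i)).restrictScalars ℝ).hasFDerivAt.comp ζ
      (analyticOnNhd_ev ζ hζ).differentiableAt.hasFDerivAt
  have h2 := (((hasFDerivAt_id (𝕜 := ℝ) ζ).pow i.1).mul
    ((Complex.conjCLE.toContinuousLinearMap.hasFDerivAt (x := ζ)).pow i.2))
  have h3 : (fun ζ => ev ζ (mono i)) =ᶠ[𝓝 ζ] _ :=
    Set.EqOn.eventuallyEq_of_mem (fun ζ hζ => ev_mono hζ i) (isOpen_ball.mem_nhds hζ)
  have := congrArg (fun T => T v) (h1.unique (h2.congr_of_eventuallyEq h3))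
  simp at this
  rw [this]; ring

/-- The weighted shift `mono i ↦ c i • mono (φ i)`. -/
def wshift (c : ℕ × ℕ → ℂ) (φ : ℕ × ℕ → ℕ × ℕ) (hc : ∀ i, ‖c i‖ ≤ 1) :
    BidiscAlgebra →L[ℂ] BidiscAlgebra :=
  lift (fun i => c i • mono (φ i)) fun i => by rw [norm_smul, norm_mono, mul_one]; exact hc i

@[simp]
lemma wshift_mono (c : ℕ × ℕ → ℂ) (φ : ℕ × ℕ → ℕ × ℕ) (hc : ∀ i, ‖c i‖ ≤ 1) (i : ℕ × ℕ) :
    wshift c φ hc (mono i) = c i • mono (φ i) :=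
  lift_mono _ _ i

/-- The complex number `1 / (j + 1)`. -/
def recip (j : ℕ) : ℂ := ((j : ℂ) + 1)⁻¹

lemma recip_mul (j : ℕ) : recip j * (j + 1) = 1 := inv_mul_cancel₀ (Nat.cast_add_one_ne_zero j)

@[simp]
lemma conj_recip (j : ℕ) : starRingEnd ℂ (recip j) = recip j := by simp [recip]

lemma norm_recip_le (j : ℕ) : ‖recip j‖ ≤ 1 := by
  rw [recip, norm_inv, ← Nat.cast_succ, Complex.norm_natCast]
  exact inv_le_one_of_one_le₀ (by simp)

lemma norm_recip_mul_recip_le (j k : ℕ) : ‖recip j * recip k‖ ≤ 1 := by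
  rw [norm_mul]
  exact mul_le_one₀ (norm_recip_le j) (norm_nonneg _) (norm_recip_le k)

/-- `a ↦ Re a(z, z)`, on real functions. -/
def diagReC : BidiscAlgebra →L[ℂ] BidiscAlgebra :=
  (2⁻¹ : ℂ) • (wshift 1 (fun i => (i.1 + i.2, 0)) (by simp) +
    wshift 1 (fun i => (0, i.1 + i.2)) (by simp))

/-- `a ↦ Im a(z, z)`, on real functions. -/
def diagImC : BidiscAlgebra →L[ℂ] BidiscAlgebra :=
  (-Complex.I * 2⁻¹) • (wshift 1 (fun i => (i.1 + i.2, 0)) (by simp) -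
    wshift 1 (fun i => (0, i.1 + i.2)) (by simp))

/-- `a ↦ Re ∫₀^z a(t, t) dt`, on real functions. -/
def primReC : BidiscAlgebra →L[ℂ] BidiscAlgebra :=
  (2⁻¹ : ℂ) • (wshift (fun i => recip (i.1 + i.2)) (fun i => (i.1 + i.2 + 1, 0))
      (fun _ => norm_recip_le _) +
    wshift (fun i => recip (i.1 + i.2)) (fun i => (0, i.1 + i.2 + 1)) fun _ => norm_recip_le _)

/-- `a ↦ Im ∫₀^z a(t, t) dt`, on real functions. -/
def primImC : BidiscAlgebra →L[ℂ] BidiscAlgebra :=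
  (-Complex.I * 2⁻¹) • (wshift (fun i => recip (i.1 + i.2)) (fun i => (i.1 + i.2 + 1, 0))
      (fun _ => norm_recip_le _) -
    wshift (fun i => recip (i.1 + i.2)) (fun i => (0, i.1 + i.2 + 1)) fun _ => norm_recip_le _)

/-- The solution operator of the Cauchy problem `Δu = a`, `u = ∂u/∂y = 0` on the real axis. -/
def cauchyC : BidiscAlgebra →L[ℂ] BidiscAlgebra :=
  (4⁻¹ : ℂ) • (wshift (fun i => recip i.1 * recip i.2) (fun i => (i.1 + 1, i.2 + 1))
      (fun _ => norm_recip_mul_recip_le _ _) -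
    wshift (fun i => recip i.2 * recip (i.1 + i.2 + 1)) (fun i => (i.1 + i.2 + 2, 0))
      (fun _ => norm_recip_mul_recip_le _ _) -
    wshift (fun i => recip i.1 * recip (i.1 + i.2 + 1)) (fun i => (0, i.1 + i.2 + 2))
      (fun _ => norm_recip_mul_recip_le _ _))

/-- The derivative of `cauchyC` with respect to the first variable. -/
def cauchyZ : BidiscAlgebra →L[ℂ] BidiscAlgebra :=
  (4⁻¹ : ℂ) • (wshift (fun i => recip i.2) (fun i => (i.1, i.2 + 1)) (fun _ => norm_recip_le _) -
    wshift (fun i => recip i.2) (fun i => (i.1 + i.2 + 1, 0)) (fun _ => norm_recip_le _))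

/-- The derivative of `cauchyC` with respect to the second variable. -/
def cauchyW : BidiscAlgebra →L[ℂ] BidiscAlgebra :=
  (4⁻¹ : ℂ) • (wshift (fun i => recip i.1) (fun i => (i.1 + 1, i.2)) (fun _ => norm_recip_le _) -
    wshift (fun i => recip i.1) (fun i => (0, i.1 + i.2 + 1)) (fun _ => norm_recip_le _))

/-- Real evaluation functionals. -/
def evR (ζ : ℂ) : realPart →L[ℝ] ℝ :=
  Complex.reCLM ∘L (ev ζ).restrictScalars ℝ ∘L (Subalgebra.toSubmodule realPart).subtypeL

lemma evR_apply (ζ : ℂ) (b : realPart) : evR ζ b = (ev ζ (b : BidiscAlgebra)).re := rfl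

section evR

variable {ζ : ℂ} (hζ : ζ ∈ ball (0 : ℂ) 1)
include hζ

lemma ofReal_evR (b : realPart) : (evR ζ b : ℂ) = ev ζ (b : BidiscAlgebra) := by
  have := ev_conjL hζ (b : BidiscAlgebra)
  rw [mem_realPart.1 b.2] at this
  exact Complex.conj_eq_iff_re.1 this.symm

lemma norm_evR_le : ‖evR ζ‖ ≤ 1 :=
  ContinuousLinearMap.opNorm_le_bound _ zero_le_one fun _ =>
    (Complex.abs_re_le_norm _).trans ((ev ζ).le_of_opNorm_le (norm_ev_le hζ) _)

lemma evR_one : evR ζ 1 = 1 := by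
  have : ev ζ 1 = 1 := by rw [one_def, ev_mono hζ]; simp
  rw [evR_apply, OneMemClass.coe_one, this, Complex.one_re]

lemma evR_mul (a b : realPart) : evR ζ (a * b) = evR ζ a * evR ζ b := by
  have : (evR ζ (a * b) : ℂ) = ((evR ζ a * evR ζ b : ℝ) : ℂ) := by
    rw [ofReal_evR hζ, Complex.ofReal_mul, ofReal_evR hζ, ofReal_evR hζ, MulMemClass.coe_mul,
      ev_mul hζ]
  exact_mod_cast this

lemma hasFDerivAt_evR :
    HasFDerivAt evR (ContinuousLinearMap.compL ℝ realPart ℂ ℝ Complex.reCLM ∘L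
      ((ContinuousLinearMap.compL ℝ realPart BidiscAlgebra ℂ).flip
        (Subalgebra.toSubmodule realPart).subtypeL) ∘L
      ContinuousLinearMap.restrictScalarsL ℂ BidiscAlgebra ℂ ℝ ℝ ∘L fderiv ℝ ev ζ) ζ :=
  (ContinuousLinearMap.compL ℝ realPart ℂ ℝ Complex.reCLM ∘L
      ((ContinuousLinearMap.compL ℝ realPart BidiscAlgebra ℂ).flip
        (Subalgebra.toSubmodule realPart).subtypeL) ∘L
      ContinuousLinearMap.restrictScalarsL ℂ BidiscAlgebra ℂ ℝ ℝ).hasFDerivAt.comp ζ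
    (analyticOnNhd_ev ζ hζ).differentiableAt.hasFDerivAt

lemma analyticAt_evR : AnalyticAt ℝ evR ζ :=
  (ContinuousLinearMap.analyticAt (ContinuousLinearMap.compL ℝ realPart ℂ ℝ Complex.reCLM ∘L
      ((ContinuousLinearMap.compL ℝ realPart BidiscAlgebra ℂ).flip
        (Subalgebra.toSubmodule realPart).subtypeL) ∘L
      ContinuousLinearMap.restrictScalarsL ℂ BidiscAlgebra ℂ ℝ ℝ) _).comp (analyticOnNhd_ev ζ hζ)

lemma fderiv_evR (v : ℂ) (b : realPart) :
    fderiv ℝ evR ζ v b = (fderiv ℝ ev ζ v (b : BidiscAlgebra)).re := by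
  rw [(hasFDerivAt_evR hζ).fderiv]
  rfl

end evR

/-- The restriction of `diagReC` to real functions. -/
def diagRe : realPart →L[ℝ] realPart := restrictReal diagReC fun i => by
  simp [diagReC, conjL_smul, conjL_mono, map_ofNat, add_comm]

/-- The restriction of `diagImC` to real functions. -/
def diagIm : realPart →L[ℝ] realPart := restrictReal diagImC fun i => by
  simp [diagImC, conjL_smul, conjL_mono, map_ofNat, add_comm, smul_sub]

/-- The restriction of `primReC` to real functions. -/
def primRe : realPart →L[ℝ] realPart := restrictReal primReC fun i => by
  simp [primReC, conjL_smul, conjL_mono, map_ofNat, add_comm]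

/-- The restriction of `primImC` to real functions. -/
def primIm : realPart →L[ℝ] realPart := restrictReal primImC fun i => by
  simp [primImC, conjL_smul, conjL_mono, map_ofNat, add_comm, smul_sub]

/-- The restriction of `cauchyC` to real functions. -/
def cauchy : realPart →L[ℝ] realPart := restrictReal cauchyC fun i => by
  simp [cauchyC, conjL_smul, conjL_mono, map_ofNat, add_comm, smul_sub, mul_comm]
  abel

/-- The `x`-derivative of `cauchy`. -/
def cauchyX : realPart →L[ℝ] realPart := restrictReal (cauchyZ + cauchyW) fun i => by
  simp [cauchyZ, cauchyW, conjL_smul, conjL_mono, map_ofNat, add_comm]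

/-- The `y`-derivative of `cauchy`. -/
def cauchyY : realPart →L[ℝ] realPart :=
  restrictReal (Complex.I • (cauchyZ - cauchyW)) fun i => by
    simp [cauchyZ, cauchyW, conjL_smul, conjL_mono, map_ofNat, add_comm, ← smul_neg]

section identities

variable {ζ : ℂ} (hζ : ζ ∈ ball (0 : ℂ) 1) (b : realPart)
include hζ

lemma fderiv_primRe_one : fderiv ℝ evR ζ 1 (primRe b) = evR ζ (diagRe b) := by
  have : fderiv ℝ ev ζ 1 ∘L primReC = ev ζ ∘L diagReC := ext_mono fun i => by
    have := recip_mul (i.1 + i.2)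
    simp [primReC, diagReC, ev_mono hζ, fderiv_ev_mono hζ] at this ⊢
    linear_combination (ζ ^ (i.1 + i.2) + starRingEnd ℂ ζ ^ (i.1 + i.2)) / 2 * this
  rw [fderiv_evR hζ, evR_apply]
  exact congrArg (fun T => (T b).re) this

lemma fderiv_primRe_I : fderiv ℝ evR ζ Complex.I (primRe b) = -evR ζ (diagIm b) := by
  have : fderiv ℝ ev ζ Complex.I ∘L primReC = -(ev ζ ∘L diagImC) := ext_mono fun i => by
    have := recip_mul (i.1 + i.2)
    simp [primReC, diagImC, ev_mono hζ, fderiv_ev_mono hζ] at this ⊢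
    linear_combination
      Complex.I * (ζ ^ (i.1 + i.2) - starRingEnd ℂ ζ ^ (i.1 + i.2)) / 2 * this
  rw [fderiv_evR hζ, evR_apply, ← Complex.neg_re]
  exact congrArg (fun T => (T b).re) this

lemma fderiv_primIm_one : fderiv ℝ evR ζ 1 (primIm b) = evR ζ (diagIm b) := by
  have : fderiv ℝ ev ζ 1 ∘L primImC = ev ζ ∘L diagImC := ext_mono fun i => by
    have := recip_mul (i.1 + i.2)
    simp [primImC, diagImC, ev_mono hζ, fderiv_ev_mono hζ] at this ⊢
    linear_combination (ζ ^ (i.1 + i.2) - starRingEnd ℂ ζ ^ (i.1 + i.2)) * this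
  rw [fderiv_evR hζ, evR_apply]
  exact congrArg (fun T => (T b).re) this

lemma fderiv_primIm_I : fderiv ℝ evR ζ Complex.I (primIm b) = evR ζ (diagRe b) := by
  have : fderiv ℝ ev ζ Complex.I ∘L primImC = ev ζ ∘L diagReC := ext_mono fun i => by
    have := recip_mul (i.1 + i.2)
    simp [primImC, diagReC, ev_mono hζ, fderiv_ev_mono hζ] at this ⊢
    linear_combination (ζ ^ (i.1 + i.2) + starRingEnd ℂ ζ ^ (i.1 + i.2)) / 2 * this -
      (ζ ^ (i.1 + i.2) + starRingEnd ℂ ζ ^ (i.1 + i.2)) / 2 *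
        (recip (i.1 + i.2) * (i.1 + i.2 + 1)) * Complex.I_sq
  rw [fderiv_evR hζ, evR_apply]
  exact congrArg (fun T => (T b).re) this

lemma fderiv_diagRe_one :
    fderiv ℝ evR ζ 1 (diagRe b) = fderiv ℝ evR ζ Complex.I (diagIm b) := by
  have : fderiv ℝ ev ζ 1 ∘L diagReC = fderiv ℝ ev ζ Complex.I ∘L diagImC := ext_mono fun i => by
    simp [diagImC, diagReC, fderiv_ev_mono hζ]
    ring_nf
    simp
    ring
  rw [fderiv_evR hζ, fderiv_evR hζ]
  exact congrArg (fun T => (T b).re) this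

lemma fderiv_diagIm_one :
    fderiv ℝ evR ζ 1 (diagIm b) = -fderiv ℝ evR ζ Complex.I (diagRe b) := by
  have : fderiv ℝ ev ζ 1 ∘L diagImC = -(fderiv ℝ ev ζ Complex.I ∘L diagReC) :=
    ext_mono fun i => by
      simp [diagImC, diagReC, fderiv_ev_mono hζ]
      ring
  rw [fderiv_evR hζ, fderiv_evR hζ, ← Complex.neg_re]
  exact congrArg (fun T => (T b).re) this

lemma fderiv_cauchy_one : fderiv ℝ evR ζ 1 (cauchy b) = evR ζ (cauchyX b) := by
  have : fderiv ℝ ev ζ 1 ∘L cauchyC = ev ζ ∘L (cauchyZ + cauchyW) := ext_mono fun i => by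
    have h1 := recip_mul i.1
    have h2 := recip_mul i.2
    have h3 := recip_mul (i.1 + i.2 + 1)
    simp [cauchyC, cauchyZ, cauchyW, ev_mono hζ, fderiv_ev_mono hζ] at h1 h2 h3 ⊢
    set w := starRingEnd ℂ ζ
    linear_combination recip i.2 * ζ ^ i.1 * w ^ (i.2 + 1) / 4 * h1 +
      recip i.1 * ζ ^ (i.1 + 1) * w ^ i.2 / 4 * h2 -
      (recip i.2 * ζ ^ (i.1 + i.2 + 1) + recip i.1 * w ^ (i.1 + i.2 + 1)) / 4 * h3
  rw [fderiv_evR hζ, evR_apply]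
  exact congrArg (fun T => (T b).re) this

lemma fderiv_cauchy_I : fderiv ℝ evR ζ Complex.I (cauchy b) = evR ζ (cauchyY b) := by
  have : fderiv ℝ ev ζ Complex.I ∘L cauchyC = ev ζ ∘L (Complex.I • (cauchyZ - cauchyW)) :=
    ext_mono fun i => by
      have h1 := recip_mul i.1
      have h2 := recip_mul i.2
      have h3 := recip_mul (i.1 + i.2 + 1)
      simp [cauchyC, cauchyZ, cauchyW, ev_mono hζ, fderiv_ev_mono hζ] at h1 h2 h3 ⊢
      set w := starRingEnd ℂ ζ
      linear_combination Complex.I * recip i.2 * ζ ^ i.1 * w ^ (i.2 + 1) / 4 * h1 -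
        Complex.I * recip i.1 * ζ ^ (i.1 + 1) * w ^ i.2 / 4 * h2 -
        Complex.I * (recip i.2 * ζ ^ (i.1 + i.2 + 1) - recip i.1 * w ^ (i.1 + i.2 + 1)) / 4 * h3
  rw [fderiv_evR hζ, evR_apply]
  exact congrArg (fun T => (T b).re) this

lemma laplacian_cauchy :
    fderiv ℝ evR ζ 1 (cauchyX b) + fderiv ℝ evR ζ Complex.I (cauchyY b) = evR ζ b := by
  have : fderiv ℝ ev ζ 1 ∘L (cauchyZ + cauchyW) +
      fderiv ℝ ev ζ Complex.I ∘L (Complex.I • (cauchyZ - cauchyW)) = ev ζ := ext_mono fun i => by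
    have h1 := recip_mul i.1
    have h2 := recip_mul i.2
    simp [cauchyZ, cauchyW, ev_mono hζ, fderiv_ev_mono hζ] at h1 h2 ⊢
    set w := starRingEnd ℂ ζ
    ring_nf
    simp only [Complex.I_sq]
    linear_combination ζ ^ i.1 * w ^ i.2 / 2 * (h1 + h2)
  rw [fderiv_evR hζ, fderiv_evR hζ, evR_apply, ← Complex.add_re]
  exact congrArg (fun T => (T b).re) this

end identities

lemma recip_sub (j k : ℕ) : recip j * recip k =
    recip j * recip (j + k + 1) + recip k * recip (j + k + 1) := by
  have h3 := Nat.cast_add_one_ne_zero (R := ℂ) (j + k + 1)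
  have h1 := Nat.cast_add_one_ne_zero (R := ℂ) j
  have h2 := Nat.cast_add_one_ne_zero (R := ℂ) k
  simp only [recip]
  push_cast at *
  field_simp
  ring

section realAxis

variable {ζ : ℂ} (hζ : ζ ∈ ball (0 : ℂ) 1) (him : ζ.im = 0) (b : realPart)
include hζ him

lemma evR_diagRe : evR ζ (diagRe b) = evR ζ b := by
  have : ev ζ ∘L diagReC = ev ζ := ext_mono fun i => by
    simp [diagReC, ev_mono hζ, Complex.conj_eq_iff_im.2 him]
    ring
  exact congrArg (fun T => (T b).re) this

lemma evR_diagIm : evR ζ (diagIm b) = 0 := by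
  have : ev ζ ∘L diagImC = 0 := ext_mono fun i => by
    simp [diagImC, ev_mono hζ, Complex.conj_eq_iff_im.2 him]
  exact congrArg (fun T => (T b).re) this

lemma evR_primIm : evR ζ (primIm b) = 0 := by
  have : ev ζ ∘L primImC = 0 := ext_mono fun i => by
    simp [primImC, ev_mono hζ, Complex.conj_eq_iff_im.2 him]
  exact congrArg (fun T => (T b).re) this

lemma evR_cauchy : evR ζ (cauchy b) = 0 := by
  have : ev ζ ∘L cauchyC = 0 := ext_mono fun i => by
    have := recip_sub i.1 i.2
    simp [cauchyC, ev_mono hζ, Complex.conj_eq_iff_im.2 him]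
    linear_combination ζ ^ (i.1 + i.2 + 2) * this
  exact congrArg (fun T => (T b).re) this

lemma evR_cauchyX : evR ζ (cauchyX b) = 0 := by
  have : ev ζ ∘L (cauchyZ + cauchyW) = 0 := ext_mono fun i => by
    simp [cauchyZ, cauchyW, ev_mono hζ, Complex.conj_eq_iff_im.2 him]
    ring
  exact congrArg (fun T => (T b).re) this

lemma evR_cauchyY : evR ζ (cauchyY b) = 0 := by
  have : ev ζ ∘L (Complex.I • (cauchyZ - cauchyW)) = 0 := ext_mono fun i => by
    simp [cauchyZ, cauchyW, ev_mono hζ, Complex.conj_eq_iff_im.2 him]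
    ring
  exact congrArg (fun T => (T b).re) this

end realAxis

/-- The function `Re z ^ k`. -/
def rePow (k : ℕ) : realPart :=
  ⟨(2⁻¹ : ℂ) • (mono (k, 0) + mono (0, k)), by
    simp [mem_realPart, conjL_smul, conjL_mono, map_ofNat, add_comm]⟩

lemma norm_rePow_le (k : ℕ) : ‖rePow k‖ ≤ 1 := by
  change ‖(2⁻¹ : ℂ) • (mono (k, 0) + mono (0, k))‖ ≤ 1
  rw [norm_smul]
  have := norm_add_le (mono (k, 0)) (mono (0, k))
  rw [norm_mono, norm_mono] at this
  norm_num
  linarith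

lemma ofReal_evR_primRe_rePow {ζ : ℂ} (hζ : ζ ∈ ball (0 : ℂ) 1) (him : ζ.im = 0) (k : ℕ) :
    (evR ζ (primRe (rePow k)) : ℂ) = ζ ^ (k + 1) / (k + 1) := by
  rw [ofReal_evR hζ, primRe, coe_restrictReal]
  simp [rePow, primReC, ev_mono hζ, Complex.conj_eq_iff_im.2 him, recip]
  ring

end BidiscAlgebra

end BidiscAlgebra

section Cauchy

lemma exists_fixed_point {P X : Type*} [NormedAddCommGroup P] [NormedSpace ℝ P] [CompleteSpace P]
    [NormedAddCommGroup X] [NormedSpace ℝ X] [CompleteSpace X] {Ψ : P × X → X}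
    (hΨ : HasStrictFDerivAt Ψ (0 : P × X →L[ℝ] X) 0) (h0 : Ψ 0 = 0) {V : Set (P × X)}
    (hV : V ∈ 𝓝 0) : ∀ᶠ p in 𝓝 (0 : P), ∃ h, (p, h) ∈ V ∧ h = Ψ (p, h) := by
  have hS : HasStrictFDerivAt (fun z : P × X => (z.1, z.2 - Ψ z))
      (ContinuousLinearMap.id ℝ (P × X)) 0 := by
    have := hasStrictFDerivAt_fst.prodMk
      ((hasStrictFDerivAt_snd (𝕜 := ℝ) (p := (0 : P × X))).sub hΨ)
    rw [sub_zero, ContinuousLinearMap.fst_prod_snd] at this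
    exact this
  have hmap := hS.map_nhds_eq_of_surj (LinearMap.range_eq_top.2 Function.surjective_id)
  have h1 : (fun z : P × X => (z.1, z.2 - Ψ z)) '' V ∈ 𝓝 ((0 : P), (0 : X)) := by
    have := image_mem_map (m := fun z : P × X => (z.1, z.2 - Ψ z)) hV
    rw [hmap] at this
    simpa [h0] using this
  have h2 : Tendsto (fun p : P => (p, (0 : X))) (𝓝 0) (𝓝 (0, 0)) :=
    (Continuous.prodMk_left (0 : X)).tendsto 0
  filter_upwards [h2 h1] with p hp
  obtain ⟨⟨p', h⟩, hz, he⟩ := hp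
  obtain rfl : p' = p := congrArg Prod.fst he
  exact ⟨h, hz, sub_eq_zero.1 (congrArg Prod.snd he)⟩

/-- The right hand side of the second order equation satisfied by `J`-holomorphic maps. -/
def acsLaplacian (J : F → F →L[ℝ] F) (x p q : F) : F := fderiv ℝ J x q p - fderiv ℝ J x p q

lemma jHolOn_of_laplacian_eq [CompleteSpace F] {U : Set F} (hU : IsOpen U) {J : F → F →L[ℝ] F}
    (hJan : AnalyticOnNhd ℝ J U) (hJsq : ∀ x ∈ U, (J x).comp (J x) = -ContinuousLinearMap.id ℝ F)
    {γ p q : ℂ → F} (hγU : ∀ ζ ∈ ball (0 : ℂ) 1, γ ζ ∈ U) (hγ : AnalyticOnNhd ℝ γ (ball 0 1))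
    (hp : AnalyticOnNhd ℝ p (ball 0 1)) (hq : AnalyticOnNhd ℝ q (ball 0 1))
    (hγp : ∀ ζ ∈ ball (0 : ℂ) 1, fderiv ℝ γ ζ 1 = p ζ)
    (hγq : ∀ ζ ∈ ball (0 : ℂ) 1, fderiv ℝ γ ζ Complex.I = q ζ)
    (hpde : ∀ ζ ∈ ball (0 : ℂ) 1,
      fderiv ℝ p ζ 1 + fderiv ℝ q ζ Complex.I = acsLaplacian J (γ ζ) (p ζ) (q ζ))
    (h0 : ∀ ζ ∈ ball (0 : ℂ) 1, ζ.im = 0 → q ζ = J (γ ζ) (p ζ)) : JHolOn J (ball 0 1) γ := by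
  have hM : AnalyticOnNhd ℝ (fun ζ => J (γ ζ)) (ball 0 1) := fun ζ hζ =>
    AnalyticAt.comp (g := J) (hJan _ (hγU ζ hζ)) (hγ ζ hζ)
  have hdJ : AnalyticOnNhd ℝ (fun ζ => fderiv ℝ J (γ ζ)) (ball 0 1) := fun ζ hζ =>
    AnalyticAt.comp (g := fderiv ℝ J) (hJan _ (hγU ζ hζ)).fderiv (hγ ζ hζ)
  have hN : AnalyticOnNhd ℝ (fun ζ => fderiv ℝ J (γ ζ) (p ζ)) (ball 0 1) := fun ζ hζ =>
    analyticAt_clm_apply (hdJ ζ hζ) (hp ζ hζ)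
  have hu : AnalyticOnNhd ℝ (fun ζ => q ζ - J (γ ζ) (p ζ)) (ball 0 1) := fun ζ hζ =>
    (hq ζ hζ).sub (analyticAt_clm_apply (hM ζ hζ) (hp ζ hζ))
  have hJJ : ∀ x ∈ U, ∀ v, J x (J x v) = -v := fun x hx v => by
    simpa using congrArg (fun T => T v) (hJsq x hx)
  have hdJJ : ∀ x ∈ U, ∀ v w, fderiv ℝ J x v (J x w) = -J x (fderiv ℝ J x v w) := by
    intro x hx v w
    have hJd := (hJan x hx).differentiableAt.hasFDerivAt
    have h1 := hJd.clm_comp hJd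
    have h2 : (fun y => (J y).comp (J y)) =ᶠ[𝓝 x] fun _ => -ContinuousLinearMap.id ℝ F :=
      Set.EqOn.eventuallyEq_of_mem hJsq (hU.mem_nhds hx)
    have h3 := h1.unique ((hasFDerivAt_const _ x).congr_of_eventuallyEq h2)
    have h4 := congrArg (fun T => T v w) h3
    simp at h4
    exact eq_neg_of_add_eq_zero_right h4
  have hpq : ∀ ζ ∈ ball (0 : ℂ) 1, fderiv ℝ p ζ Complex.I = fderiv ℝ q ζ 1 := by
    intro ζ hζ
    have hsymm := (hγ ζ hζ).contDiffAt.isSymmSndFDerivAt (n := ⊤) (by simp) 1 Complex.I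
    have hd := (hγ ζ hζ).fderiv.differentiableAt
    have hp' : p =ᶠ[𝓝 ζ] fun z => fderiv ℝ γ z 1 :=
      Set.EqOn.eventuallyEq_of_mem (fun z hz => (hγp z hz).symm) (isOpen_ball.mem_nhds hζ)
    have hq' : q =ᶠ[𝓝 ζ] fun z => fderiv ℝ γ z Complex.I :=
      Set.EqOn.eventuallyEq_of_mem (fun z hz => (hγq z hz).symm) (isOpen_ball.mem_nhds hζ)
    rw [hp'.fderiv_eq, hq'.fderiv_eq, fderiv_clm_apply hd (by fun_prop),
      fderiv_clm_apply hd (by fun_prop)]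
    simpa using hsymm.symm
  have hzero : ∀ ζ ∈ ball (0 : ℂ) 1, q ζ - J (γ ζ) (p ζ) = 0 := by
    refine fun ζ hζ => eq_zero_of_cauchy hu hM.neg hN.neg (fun ζ hζ => ?_)
      (fun ζ hζ him => sub_eq_zero.2 (h0 ζ hζ him)) hζ
    have hγd := (hγ ζ hζ).differentiableAt
    have hJγ : HasFDerivAt (fun ζ => J (γ ζ)) (fderiv ℝ J (γ ζ) ∘L fderiv ℝ γ ζ) ζ :=
      (hJan _ (hγU ζ hζ)).differentiableAt.hasFDerivAt.comp ζ hγd.hasFDerivAt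
    have hd := ((hq ζ hζ).differentiableAt.hasFDerivAt.sub
      (hJγ.clm_apply (hp ζ hζ).differentiableAt.hasFDerivAt)).fderiv
    have e1 := hpde ζ hζ
    simp only [acsLaplacian] at e1
    have e2 := hdJJ _ (hγU ζ hζ) (p ζ) (p ζ)
    have e3 := hJJ _ (hγU ζ hζ) (fderiv ℝ p ζ 1)
    change fderiv ℝ (q - fun y => J (γ y) (p y)) ζ Complex.I =
      (-J (γ ζ)) (fderiv ℝ (q - fun y => J (γ y) (p y)) ζ 1) +
        (-fderiv ℝ J (γ ζ) (p ζ)) (q ζ - J (γ ζ) (p ζ))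
    rw [hd]
    simp [hγp ζ hζ, hγq ζ hζ, hpq ζ hζ, e2, e3]
    rw [← eq_sub_iff_add_eq'] at e1
    rw [e1]
    abel
  intro ζ hζ v
  have hq0 : q ζ = J (γ ζ) (p ζ) := sub_eq_zero.1 (hzero ζ hζ)
  have hv : v = (v.re : ℝ) • (1 : ℂ) + (v.im : ℝ) • Complex.I := by
    simp
  have hIv : Complex.I * v = (v.re : ℝ) • Complex.I - (v.im : ℝ) • (1 : ℂ) := by
    simp [Complex.ext_iff]
  rw [hIv]
  conv_rhs => rw [hv]
  simp only [map_add, map_sub, map_smul, hγp ζ hζ, hγq ζ hζ, hq0, hJJ _ (hγU ζ hζ)]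
  simp [sub_eq_add_neg]

lemma iteratedDeriv_eq_of_hasSum [CompleteSpace F] {f : ℝ → F} {x : ℕ → F}
    (hf : ∀ t : ℝ, |t| < 1 → HasSum (fun k => (t ^ k / (k.factorial : ℝ)) • x k) (f t)) (k : ℕ) :
    iteratedDeriv k f 0 = x k := by
  set p : FormalMultilinearSeries ℝ ℝ F := fun k =>
    ContinuousMultilinearMap.mkPiRing ℝ (Fin k) ((k.factorial : ℝ)⁻¹ • x k) with hp
  have hsum : ∀ t : ℝ, |t| < 1 → HasSum (fun k => p k fun _ => t) (f t) := fun t ht => by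
    simpa [hp, smul_smul, div_eq_mul_inv] using hf t ht
  have hball : HasFPowerSeriesOnBall f p 0 1 := by
    refine ⟨?_, one_pos, fun {t} ht => ?_⟩
    · refine ENNReal.le_of_forall_nnreal_lt fun r hr => ?_
      have hr' : (r : ℝ) < 1 := by exact_mod_cast hr
      refine p.le_radius_of_tendsto (l := 0) ?_
      have := (hsum r (by simpa using hr')).summable.tendsto_atTop_zero.norm
      simpa [hp, norm_smul, mul_comm, mul_assoc, mul_left_comm] using this
    · rw [zero_add]
      refine hsum t ?_
      have : ‖t‖ₑ < 1 := by simpa using ht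
      rw [← Real.norm_eq_abs]
      simpa [enorm_eq_nnnorm, ← NNReal.coe_lt_coe] using this
  have := hball.factorial_smul 1 k
  rw [← iteratedDeriv_eq_iteratedFDeriv] at this
  rw [← this]
  simp [hp, ← Nat.cast_smul_eq_nsmul ℝ, smul_smul, Nat.factorial_ne_zero]

end Cauchy

section Disc

open BidiscAlgebra

variable {ι : Type*} [Fintype ι] (L : F ≃L[ℝ] (ι → ℝ))

/-- The `F`-valued evaluation of a tuple of real functions. -/
def evalF (ζ : ℂ) : (ι → realPart) →L[ℝ] F :=
  (L.symm : (ι → ℝ) →L[ℝ] F) ∘L ContinuousLinearMap.piMap fun _ => evR ζ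

omit [Fintype ι] in
lemma evalF_apply (ζ : ℂ) (X : ι → realPart) : evalF L ζ X = L.symm fun i => evR ζ (X i) := rfl

lemma hasFDerivAt_evalF {ζ : ℂ} (hζ : ζ ∈ ball (0 : ℂ) 1) (X : ι → realPart) :
    HasFDerivAt (fun ζ => evalF L ζ X) ((L.symm : (ι → ℝ) →L[ℝ] F) ∘L
      ContinuousLinearMap.pi fun i => (fderiv ℝ evR ζ).flip (X i)) ζ := by
  refine (L.symm : (ι → ℝ) →L[ℝ] F).hasFDerivAt.comp ζ (hasFDerivAt_pi.2 fun i => ?_)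
  exact (ContinuousLinearMap.apply ℝ ℝ (X i)).hasFDerivAt.comp ζ
    (analyticAt_evR hζ).differentiableAt.hasFDerivAt

lemma fderiv_evalF {ζ : ℂ} (hζ : ζ ∈ ball (0 : ℂ) 1) (X : ι → realPart) (v : ℂ) :
    fderiv ℝ (fun ζ => evalF L ζ X) ζ v = L.symm fun i => fderiv ℝ evR ζ v (X i) := by
  rw [(hasFDerivAt_evalF L hζ X).fderiv]
  rfl

lemma analyticOnNhd_evalF (X : ι → realPart) :
    AnalyticOnNhd ℝ (fun ζ => evalF L ζ X) (ball 0 1) := fun ζ hζ => by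
  refine AnalyticAt.comp (g := (L.symm : (ι → ℝ) →L[ℝ] F)) (ContinuousLinearMap.analyticAt _ _)
    (AnalyticAt.pi fun i => ?_)
  exact AnalyticAt.comp (g := ContinuousLinearMap.apply ℝ ℝ (X i))
    (ContinuousLinearMap.analyticAt _ _) (analyticAt_evR hζ)

lemma eventually_evalF_mem {U : Set F} (hU : U ∈ 𝓝 0) :
    ∀ᶠ X in 𝓝 (0 : ι → realPart), ∀ ζ ∈ ball (0 : ℂ) 1, evalF L ζ X ∈ U := by
  have h : Tendsto (L.symm : (ι → ℝ) → F) (𝓝 0) (𝓝 0) := by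
    simpa using L.symm.continuous.tendsto 0
  obtain ⟨ε, hε, hεU⟩ := Metric.mem_nhds_iff.1 (h hU)
  filter_upwards [ball_mem_nhds (0 : ι → realPart) hε] with X hX ζ hζ
  refine hεU (mem_ball_zero_iff.2 (lt_of_le_of_lt ?_ (mem_ball_zero_iff.1 hX)))
  refine (pi_norm_le_iff_of_nonneg (norm_nonneg _)).2 fun i => ?_
  exact ((evR ζ).le_of_opNorm_le (norm_evR_le hζ) _).trans
    ((one_mul _).trans_le (norm_le_pi_norm X i))

omit [Fintype ι] in
lemma hasFDerivAt_zero_pi {E G : Type*} [NormedAddCommGroup E] [NormedSpace ℝ E]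
    [NormedAddCommGroup G] [NormedSpace ℝ G] {Φ : ι → E → G} {e : E}
    (h : ∀ i, HasFDerivAt (Φ i) (0 : E →L[ℝ] G) e) :
    HasFDerivAt (fun e i => Φ i e) (0 : E →L[ℝ] ι → G) e := by
  have := hasFDerivAt_pi.2 h
  exact this

lemma exists_evalF_extension {m : ℕ} {φ : (Fin m → F) → F} (hφ : AnalyticAt ℝ φ 0)
    (h0 : φ 0 = 0) :
    ∃ Φ : (Fin m → ι → realPart) → ι → realPart, AnalyticAt ℝ Φ 0 ∧ Φ 0 = 0 ∧
      (HasFDerivAt φ (0 : (Fin m → F) →L[ℝ] F) 0 →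
        HasFDerivAt Φ (0 : (Fin m → ι → realPart) →L[ℝ] ι → realPart) 0) ∧
      ∀ᶠ f in 𝓝 0, ∀ ζ ∈ ball (0 : ℂ) 1, evalF L ζ (Φ f) = φ fun j => evalF L ζ (f j) := by
  set D : (Fin m × ι → ℝ) →L[ℝ] (Fin m → F) := ContinuousLinearMap.pi fun j =>
    (L.symm : (ι → ℝ) →L[ℝ] F) ∘L
      ContinuousLinearMap.pi fun i => ContinuousLinearMap.proj (j, i) with hD
  set C : (Fin m → ι → realPart) →L[ℝ] (Fin m × ι → realPart) := ContinuousLinearMap.pi fun p =>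
    ContinuousLinearMap.proj p.2 ∘L
      ContinuousLinearMap.proj (φ := fun _ : Fin m => ι → realPart) p.1 with hC
  set P : ι → F →L[ℝ] ℝ := fun i => ContinuousLinearMap.proj i ∘L (L : F →L[ℝ] (ι → ℝ)) with hP
  have han : ∀ i, AnalyticAt ℝ (fun g => P i (φ (D g))) 0 := fun i =>
    ((P i).analyticAt _).comp (AnalyticAt.comp_of_eq hφ (D.analyticAt 0) (map_zero D))
  choose Φ hΦan hΦ0 hΦd hΦe using fun i => exists_algebra_extension (B := realPart) (han i)
  refine ⟨fun f i => Φ i (C f), AnalyticAt.pi fun i => ?_, funext fun i => ?_, fun hd => ?_, ?_⟩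
  · exact AnalyticAt.comp_of_eq (hΦan i) (C.analyticAt 0) (map_zero C)
  · simp [hΦ0, h0]
  · refine hasFDerivAt_zero_pi fun i => ?_
    have h1 : HasFDerivAt (fun g => P i (φ (D g))) (0 : (Fin m × ι → ℝ) →L[ℝ] ℝ) 0 := by
      have hd' : HasFDerivAt φ (0 : (Fin m → F) →L[ℝ] F) (D 0) := by rwa [map_zero]
      have := (P i).hasFDerivAt.comp (0 : Fin m × ι → ℝ) (hd'.comp 0 D.hasFDerivAt)
      rw [ContinuousLinearMap.zero_comp, ContinuousLinearMap.comp_zero] at this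
      exact this
    have h2 : HasFDerivAt (Φ i) (0 : (Fin m × ι → realPart) →L[ℝ] realPart) (C 0) := by
      rw [map_zero]; exact hΦd i h1
    have := h2.comp (0 : Fin m → ι → realPart) C.hasFDerivAt
    rw [ContinuousLinearMap.zero_comp] at this
    exact this
  · have hC0 : Tendsto C (𝓝 0) (𝓝 0) := by simpa using C.continuous.tendsto 0
    filter_upwards [hC0.eventually (eventually_all.2 hΦe)] with f hf ζ hζ
    rw [evalF_apply, L.symm_apply_eq]
    funext i
    rw [hf i (evR ζ) (norm_evR_le hζ) (evR_one hζ) (evR_mul hζ)]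
    rfl

end Disc

section Existence

open BidiscAlgebra

lemma fderiv_evR_smul_one {ζ : ℂ} (hζ : ζ ∈ ball (0 : ℂ) 1) (v : ℂ) (c : ℝ) :
    fderiv ℝ evR ζ v (c • (1 : realPart)) = 0 := by
  have h1 : HasFDerivAt (fun ζ => evR ζ 1) _ ζ :=
    (ContinuousLinearMap.apply ℝ ℝ (1 : realPart)).hasFDerivAt.comp ζ
      (analyticAt_evR hζ).differentiableAt.hasFDerivAt
  have h2 : (fun ζ => evR ζ 1) =ᶠ[𝓝 ζ] fun _ => (1 : ℝ) :=
    Set.EqOn.eventuallyEq_of_mem (fun z hz => evR_one hz) (isOpen_ball.mem_nhds hζ)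
  have h3 := h1.unique ((hasFDerivAt_const (1 : ℝ) ζ).congr_of_eventuallyEq h2)
  have h4 : fderiv ℝ evR ζ v 1 = 0 := congrArg (fun T => T v) h3
  rw [map_smul, h4, smul_zero]

lemma analyticAt_acsLaplacian [CompleteSpace F] {J : F → F →L[ℝ] F} (hJ : AnalyticAt ℝ J 0) :
    AnalyticAt ℝ (fun f : Fin 3 → F => acsLaplacian J (f 0) (f 1) (f 2)) 0 := by
  have hp : ∀ j : Fin 3, AnalyticAt ℝ (fun f : Fin 3 → F => f j) 0 := fun j =>
    (ContinuousLinearMap.proj (R := ℝ) (φ := fun _ : Fin 3 => F) j).analyticAt 0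
  have hd : AnalyticAt ℝ (fun f : Fin 3 → F => fderiv ℝ J (f 0)) 0 :=
    AnalyticAt.comp_of_eq (g := fderiv ℝ J) hJ.fderiv (hp 0) rfl
  exact (analyticAt_clm_apply (analyticAt_clm_apply hd (hp 2)) (hp 1)).sub
    (analyticAt_clm_apply (analyticAt_clm_apply hd (hp 1)) (hp 2))

lemma hasFDerivAt_acsLaplacian [CompleteSpace F] {J : F → F →L[ℝ] F} (hJ : AnalyticAt ℝ J 0) :
    HasFDerivAt (fun f : Fin 3 → F => acsLaplacian J (f 0) (f 1) (f 2))
      (0 : (Fin 3 → F) →L[ℝ] F) 0 := by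
  have hp : ∀ j : Fin 3, HasFDerivAt (fun f : Fin 3 → F => f j)
      (ContinuousLinearMap.proj (R := ℝ) (φ := fun _ : Fin 3 => F) j) 0 := fun j =>
    (ContinuousLinearMap.proj (R := ℝ) (φ := fun _ : Fin 3 => F) j).hasFDerivAt
  have hd : HasFDerivAt (fun f : Fin 3 → F => fderiv ℝ J (f 0)) _ 0 :=
    HasFDerivAt.comp (g := fderiv ℝ J) (0 : Fin 3 → F)
      (AnalyticAt.fderiv (f := J) hJ).differentiableAt.hasFDerivAt (hp 0)
  have := ((hd.clm_apply (hp 2)).clm_apply (hp 1)).sub ((hd.clm_apply (hp 1)).clm_apply (hp 2))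
  have h0 := this.congr_fderiv (g' := 0) (by ext; simp)
  exact h0

/-- Tuples of real functions. -/
abbrev RealTuple (ι : Type*) := ι → realPart

variable {ι : Type*} [Fintype ι] (L : F ≃L[ℝ] (ι → ℝ))

lemma eventually_exists_jHolOn [CompleteSpace F] {U : Set F} (hU : IsOpen U) (h0U : (0 : F) ∈ U)
    {J : F → F →L[ℝ] F} (hJan : AnalyticOnNhd ℝ J U)
    (hJsq : ∀ x ∈ U, (J x).comp (J x) = -ContinuousLinearMap.id ℝ F) :
    ∀ᶠ p in 𝓝 (0 : RealTuple ι × RealTuple ι),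
      (∀ i, ∃ c : ℝ, p.1 i = c • (1 : realPart)) →
      ∃ γ : ℂ → F, AnalyticOnNhd ℝ γ (ball 0 1) ∧ (∀ ζ ∈ ball (0 : ℂ) 1, γ ζ ∈ U) ∧
        JHolOn J (ball 0 1) γ ∧ ∀ ζ ∈ ball (0 : ℂ) 1, ζ.im = 0 →
          γ ζ = evalF L ζ fun i => p.1 i + primRe (p.2 i) := by
  have hJ := hJan 0 h0U
  have hp : ∀ j : Fin 2, AnalyticAt ℝ (fun f : Fin 2 → F => f j) 0 := fun j =>
    (ContinuousLinearMap.proj (R := ℝ) (φ := fun _ : Fin 2 => F) j).analyticAt 0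
  obtain ⟨jB, hjan, hj0, -, hje⟩ := exists_evalF_extension L
    (φ := fun f : Fin 2 → F => J (f 0) (f 1))
    (analyticAt_clm_apply (AnalyticAt.comp_of_eq (g := J) hJ (hp 0) rfl) (hp 1)) (by simp)
  obtain ⟨ΦB, hΦan, hΦ0, hΦd, hΦe⟩ := exists_evalF_extension L (analyticAt_acsLaplacian hJ)
    (by simp [acsLaplacian])
  let T : (realPart →L[ℝ] realPart) → RealTuple ι →L[ℝ] RealTuple ι := fun S =>
    ContinuousLinearMap.piMap fun _ => S
  let I₂ : RealTuple ι × RealTuple ι →L[ℝ] (Fin 2 → RealTuple ι) :=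
    ContinuousLinearMap.pi ![.fst ℝ (RealTuple ι) (RealTuple ι) +
      T primRe ∘L .snd ℝ (RealTuple ι) (RealTuple ι), .snd ℝ (RealTuple ι) (RealTuple ι)]
  let pa : (RealTuple ι × RealTuple ι) × RealTuple ι →L[ℝ] RealTuple ι :=
    .fst ℝ (RealTuple ι) (RealTuple ι) ∘L .fst ℝ (RealTuple ι × RealTuple ι) (RealTuple ι)
  let pG : (RealTuple ι × RealTuple ι) × RealTuple ι →L[ℝ] RealTuple ι :=
    .snd ℝ (RealTuple ι) (RealTuple ι) ∘L .fst ℝ (RealTuple ι × RealTuple ι) (RealTuple ι)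
  let ph : (RealTuple ι × RealTuple ι) × RealTuple ι →L[ℝ] RealTuple ι :=
    .snd ℝ (RealTuple ι × RealTuple ι) (RealTuple ι)
  let A : (RealTuple ι × RealTuple ι) × RealTuple ι →L[ℝ] (Fin 3 → RealTuple ι) :=
    ContinuousLinearMap.pi ![pa + T primRe ∘L pG + T cauchy ∘L ph,
      T diagRe ∘L pG + T cauchyX ∘L ph, -(T diagIm ∘L pG) + T cauchyY ∘L ph]
  let B : RealTuple ι →L[ℝ] (Fin 3 → RealTuple ι) := ContinuousLinearMap.pi ![T primIm, T diagIm, T diagRe]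
  let j : (RealTuple ι × RealTuple ι) × RealTuple ι → RealTuple ι := fun z => jB (I₂ z.1)
  let Z : (RealTuple ι × RealTuple ι) × RealTuple ι → Fin 3 → RealTuple ι := fun z => A z + B (j z)
  have hI : AnalyticAt ℝ (fun z : (RealTuple ι × RealTuple ι) × RealTuple ι => I₂ z.1) 0 :=
    (I₂ ∘L .fst ℝ (RealTuple ι × RealTuple ι) (RealTuple ι)).analyticAt 0
  have hj : AnalyticAt ℝ j 0 := AnalyticAt.comp_of_eq hjan hI (map_zero I₂)
  have hZ : AnalyticAt ℝ Z 0 := (A.analyticAt 0).add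
    (AnalyticAt.comp (g := B) (B.analyticAt _) hj)
  have hj0' : j 0 = 0 := by
    change jB (I₂ 0) = 0
    rw [map_zero, hj0]
  have hZ0 : Z 0 = 0 := by
    change A 0 + B (j 0) = 0
    rw [hj0', map_zero, map_zero, add_zero]
  have hΨ : HasStrictFDerivAt (fun z => ΦB (Z z))
      (0 : (RealTuple ι × RealTuple ι) × RealTuple ι →L[ℝ] RealTuple ι) 0 := by
    have h1 : HasStrictFDerivAt ΦB (0 : (Fin 3 → RealTuple ι) →L[ℝ] RealTuple ι) (Z 0) := by
      rw [hZ0, ← (hΦd (hasFDerivAt_acsLaplacian hJ)).fderiv]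
      exact hΦan.hasStrictFDerivAt
    have := h1.comp 0 hZ.hasStrictFDerivAt
    rw [ContinuousLinearMap.zero_comp] at this
    exact this
  have tI : Tendsto (fun z : (RealTuple ι × RealTuple ι) × RealTuple ι => I₂ z.1) (𝓝 0) (𝓝 0) := by
    simpa using hI.continuousAt.tendsto
  have tZ : Tendsto Z (𝓝 0) (𝓝 0) := by
    simpa [hZ0] using hZ.continuousAt.tendsto
  have tZ0 : Tendsto (fun z => Z z 0) (𝓝 0) (𝓝 0) :=
    ((continuous_apply (0 : Fin 3)).tendsto (0 : Fin 3 → RealTuple ι)).comp tZ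
  have hV := (tI.eventually hje).and ((tZ.eventually hΦe).and
    (tZ0.eventually (eventually_evalF_mem L (hU.mem_nhds h0U))))
  filter_upwards [exists_fixed_point hΨ (by rw [hZ0, hΦ0]) hV]
  rintro ⟨a, G⟩ ⟨h, ⟨hV1, hV2, hV3⟩, hfix⟩ ha
  set z : (RealTuple ι × RealTuple ι) × RealTuple ι := ((a, G), h)
  have hZ0i : ∀ i, Z z 0 i = a i + primRe (G i) + cauchy (h i) + primIm (j z i) := fun i => rfl
  have hZ1i : ∀ i, Z z 1 i = diagRe (G i) + cauchyX (h i) + diagIm (j z i) := fun i => rfl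
  have hZ2i : ∀ i, Z z 2 i = -diagIm (G i) + cauchyY (h i) + diagRe (j z i) := fun i => rfl
  have haxis : ∀ ζ ∈ ball (0 : ℂ) 1, ζ.im = 0 →
      evalF L ζ (Z z 0) = evalF L ζ fun i => a i + primRe (G i) := by
    intro ζ hζ him
    simp only [evalF_apply]
    congr 1
    funext i
    simp [hZ0i, evR_cauchy hζ him, evR_primIm hζ him]
  refine ⟨fun ζ => evalF L ζ (Z z 0), analyticOnNhd_evalF L _, hV3, ?_, haxis⟩
  refine jHolOn_of_laplacian_eq hU hJan hJsq hV3 (analyticOnNhd_evalF L _)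
    (analyticOnNhd_evalF L (Z z 1)) (analyticOnNhd_evalF L (Z z 2)) (fun ζ hζ => ?_)
    (fun ζ hζ => ?_) (fun ζ hζ => ?_) (fun ζ hζ him => ?_)
  · rw [fderiv_evalF L hζ, evalF_apply]
    congr 1
    funext i
    obtain ⟨c, hc⟩ := ha i
    rw [hZ0i, hZ1i, show a i = c • (1 : realPart) from hc]
    simp only [map_add, fderiv_evR_smul_one hζ, fderiv_primRe_one hζ, fderiv_cauchy_one hζ,
      fderiv_primIm_one hζ, zero_add]
  · rw [fderiv_evalF L hζ, evalF_apply]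
    congr 1
    funext i
    obtain ⟨c, hc⟩ := ha i
    rw [hZ0i, hZ2i, show a i = c • (1 : realPart) from hc]
    simp only [map_add, map_neg, fderiv_evR_smul_one hζ, fderiv_primRe_I hζ, fderiv_cauchy_I hζ,
      fderiv_primIm_I hζ, zero_add]
  · rw [fderiv_evalF L hζ, fderiv_evalF L hζ, ← map_add]
    refine Eq.trans ?_ (hV2 ζ hζ)
    rw [← hfix, evalF_apply]
    congr 1
    funext i
    simp only [Pi.add_apply, hZ1i, hZ2i, map_add, map_neg, ← laplacian_cauchy hζ (h i),
      fderiv_diagRe_one hζ, fderiv_diagIm_one hζ]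
    ring
  · rw [haxis ζ hζ him]
    have h1 : evalF L ζ (Z z 2) = evalF L ζ (j z) := by
      simp only [evalF_apply]
      congr 1
      funext i
      simp [hZ2i, evR_diagIm hζ him, evR_cauchyY hζ him, evR_diagRe hζ him]
    have h2 : evalF L ζ (Z z 1) = evalF L ζ G := by
      simp only [evalF_apply]
      congr 1
      funext i
      simp [hZ1i, evR_diagIm hζ him, evR_cauchyX hζ him, evR_diagRe hζ him]
    rw [h1, h2]
    exact hV1 ζ hζ

end Existence

section Prescribed

open BidiscAlgebra

lemma inv_factorial_le (k : ℕ) :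
    ((k.factorial : ℝ))⁻¹ ≤ (((k + 1 : ℕ) : ℝ) + 1) / ((k + 1).factorial : ℝ) := by
  have : (0 : ℝ) < k.factorial := by exact_mod_cast k.factorial_pos
  rw [Nat.factorial_succ, le_div_iff₀ (by positivity)]
  push_cast
  field_simp
  linarith

lemma norm_realPart_one_le : ‖(1 : realPart)‖ ≤ 1 := by
  change ‖(1 : BidiscAlgebra)‖ ≤ 1
  rw [one_def, norm_mono]

lemma exists_taylor_data {ι : Type*} [Fintype ι] (L : F ≃L[ℝ] (ι → ℝ)) {x : ℕ → F}
    (hx : Summable fun k : ℕ => ((k + 1 : ℝ) / (Nat.factorial k : ℝ)) * ‖x k‖) :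
    ∃ a G : RealTuple ι, (∀ i, ∃ c : ℝ, a i = c • (1 : realPart)) ∧
      ‖(a, G)‖ ≤ ‖(L : F →L[ℝ] (ι → ℝ))‖ *
        ∑' k : ℕ, ((k + 1 : ℝ) / (Nat.factorial k : ℝ)) * ‖x k‖ ∧
      ∀ t : ℝ, |t| < 1 → HasSum (fun k => (t ^ k / (k.factorial : ℝ)) • x k)
        (evalF L t fun i => a i + primRe (G i)) := by
  set C : ℝ := ‖(L : F →L[ℝ] (ι → ℝ))‖
  have hC : 0 ≤ C := norm_nonneg _
  have hLC : ∀ v i, |L v i| ≤ C * ‖v‖ := fun v i =>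
    (norm_le_pi_norm (L v) i).trans ((L : F →L[ℝ] (ι → ℝ)).le_opNorm v)
  set w : ℕ → ℝ := fun k => ((k + 1 : ℝ) / (Nat.factorial k : ℝ)) * ‖x k‖ with hw
  have hw0 : ∀ k, 0 ≤ w k := fun k => by positivity
  have hx' : Summable fun k => w (k + 1) := (summable_nat_add_iff 1).2 hx
  have htail : ∑' k, w (k + 1) ≤ ∑' k, w k := by
    rw [hx.tsum_eq_zero_add]
    exact le_add_of_nonneg_left (hw0 0)
  obtain ⟨T, hTdef⟩ : ∃ T : ι → ℕ → realPart,
    ∀ i k, T i k = (L (x (k + 1)) i / (k.factorial : ℝ)) • rePow k := ⟨_, fun _ _ => rfl⟩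
  have hT : ∀ i k, ‖T i k‖ ≤ C * w (k + 1) := fun i k => by
    calc ‖T i k‖ = |L (x (k + 1)) i| * (k.factorial : ℝ)⁻¹ * ‖rePow k‖ := by
          rw [hTdef, norm_smul, Real.norm_eq_abs, abs_div, Nat.abs_cast, div_eq_mul_inv]
      _ ≤ C * ‖x (k + 1)‖ * ((((k + 1 : ℕ) : ℝ) + 1) / ((k + 1).factorial : ℝ)) * 1 := by
          gcongr
          · exact hLC _ i
          · exact inv_factorial_le k
          · exact norm_rePow_le k
      _ = C * w (k + 1) := by simp only [hw]; ring
  have hTs : ∀ i, Summable (T i) := fun i => (hx'.mul_left C).of_norm_bounded (hT i)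
  refine ⟨fun i => L (x 0) i • 1, fun i => ∑' k, T i k, fun i => ⟨_, rfl⟩,
    max_le ?_ ?_, fun t ht => ?_⟩
  · refine (pi_norm_le_iff_of_nonneg (mul_nonneg hC (tsum_nonneg hw0))).2 fun i => ?_
    have h0 : ‖x 0‖ ≤ ∑' k, w k := by
      simpa [hw] using hx.le_tsum 0 fun k _ => hw0 k
    calc ‖L (x 0) i • (1 : realPart)‖ = |L (x 0) i| * ‖(1 : realPart)‖ := norm_smul _ _
      _ ≤ C * ‖x 0‖ * 1 := by
          gcongr
          · exact hLC _ i
          · exact norm_realPart_one_le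
      _ ≤ C * ∑' k, w k := by
          rw [mul_one]
          gcongr
  · refine (pi_norm_le_iff_of_nonneg (mul_nonneg hC (tsum_nonneg hw0))).2 fun i => ?_
    refine (tsum_of_norm_bounded (hx'.hasSum.mul_left C) (hT i)).trans ?_
    exact mul_le_mul_of_nonneg_left htail hC
  have hζ : (t : ℂ) ∈ ball (0 : ℂ) 1 := by simpa using ht
  have him : (t : ℂ).im = 0 := Complex.ofReal_im t
  have hsum : HasSum (fun k i => t ^ k / (k.factorial : ℝ) * L (x k) i)
      fun i => evR t (L (x 0) i • 1 + primRe (∑' k, T i k)) := by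
    refine Pi.hasSum.2 fun i => ?_
    have h1 : HasSum (fun k => (evR t ∘L primRe) (T i k)) (evR t (primRe (∑' k, T i k))) :=
      (hTs i).hasSum.mapL (evR t ∘L primRe)
    have h2 : ∀ k, (evR t ∘L primRe) (T i k) =
        t ^ (k + 1) / ((k + 1).factorial : ℝ) * L (x (k + 1)) i := fun k => by
      have h3 : evR t (primRe (rePow k)) = t ^ (k + 1) / (k + 1) := by
        exact_mod_cast ofReal_evR_primRe_rePow hζ him k
      rw [hTdef, ContinuousLinearMap.comp_apply, map_smul, map_smul, h3, smul_eq_mul,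
        Nat.factorial_succ]
      have : (k.factorial : ℝ) ≠ 0 := by exact_mod_cast k.factorial_ne_zero
      have : (k + 1 : ℝ) ≠ 0 := by exact_mod_cast k.succ_ne_zero
      push_cast
      field_simp
    rw [funext h2] at h1
    have h4 := (hasSum_nat_add_iff (f := fun k => t ^ k / (k.factorial : ℝ) * L (x k) i) 1).1 h1
    have h5 : evR t (L (x 0) i • 1 + primRe (∑' k, T i k)) =
        evR t (primRe (∑' k, T i k)) + L (x 0) i := by
      rw [map_add, map_smul, evR_one hζ, smul_eq_mul, mul_one, add_comm]
    rw [h5]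
    simpa using h4
  rw [evalF_apply]
  have hx_eq : ∀ k, (t ^ k / (k.factorial : ℝ)) • x k =
      L.symm fun i => t ^ k / (k.factorial : ℝ) * L (x k) i := fun k =>
    L.injective (funext fun i => by simp)
  rw [funext hx_eq]
  exact hsum.mapL (L.symm : (ι → ℝ) →L[ℝ] F)

lemma exists_jHolOn_iteratedDeriv [FiniteDimensional ℝ F] {U : Set F} (hU : IsOpen U)
    (h0U : (0 : F) ∈ U) {J : F → F →L[ℝ] F} (hJan : AnalyticOnNhd ℝ J U)
    (hJsq : ∀ x ∈ U, (J x).comp (J x) = -ContinuousLinearMap.id ℝ F) :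
    ∃ r > (0 : ℝ), ∀ x : ℕ → F,
      Summable (fun k : ℕ => ((k + 1 : ℝ) / (Nat.factorial k : ℝ)) * ‖x k‖) →
      (∑' k : ℕ, ((k + 1 : ℝ) / (Nat.factorial k : ℝ)) * ‖x k‖) ≤ r →
      ∃ γ : ℂ → F, AnalyticOnNhd ℝ γ (ball 0 1) ∧ (∀ ζ ∈ ball (0 : ℂ) 1, γ ζ ∈ U) ∧
        JHolOn J (ball 0 1) γ ∧ ∀ k : ℕ, iteratedDeriv k (fun t : ℝ => γ t) 0 = x k := by
  have : CompleteSpace F := FiniteDimensional.complete ℝ F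
  let L := (Module.finBasis ℝ F).equivFunL
  obtain ⟨ε, hε, hεN⟩ := Metric.mem_nhds_iff.1 (eventually_exists_jHolOn L hU h0U hJan hJsq)
  have hC : 0 < ‖(L : F →L[ℝ] (Fin (Module.finrank ℝ F) → ℝ))‖ + 1 := by positivity
  refine ⟨ε / (2 * (‖(L : F →L[ℝ] (Fin (Module.finrank ℝ F) → ℝ))‖ + 1)), by positivity, fun x hx hxr => ?_⟩
  obtain ⟨a, G, ha, hnorm, hsum⟩ := exists_taylor_data L hx
  have hlt : ‖(a, G)‖ < ε := by
    refine hnorm.trans_lt ((mul_le_mul (le_add_of_nonneg_right zero_le_one) hxr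
      (tsum_nonneg fun k => by positivity) hC.le).trans_lt ?_)
    field_simp
    linarith
  have hmem : (a, G) ∈ ball (0 : RealTuple _ × RealTuple _) ε := mem_ball_zero_iff.2 hlt
  obtain ⟨γ, hγ, hγU, hγJ, hγx⟩ := hεN hmem ha
  refine ⟨γ, hγ, hγU, hγJ, iteratedDeriv_eq_of_hasSum fun t ht => ?_⟩
  rw [hγx t (by simpa using ht) (Complex.ofReal_im t)]
  exact hsum t ht

end Prescribed

/-- Theorem 3.1, `jhpd`: existence of `J`-holomorphic discs with prescribed
derivatives of all orders. -/
theorem stmt0 (n : ℕ) (U : Set (Ecx n)) (hU : IsOpen U) (h0U : (0 : Ecx n) ∈ U)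
    (J : Ecx n → Ecx n →L[ℝ] Ecx n) (hJan : AnalyticOnNhd ℝ J U)
    (hJsq : ∀ x ∈ U, (J x).comp (J x) = -ContinuousLinearMap.id ℝ (Ecx n))
    (hJ0 : J 0 = J0 n) :
    ∃ r > (0 : ℝ), ∀ x : ℕ → Ecx n,
      Summable (fun k : ℕ => ((k + 1 : ℝ) / (Nat.factorial k : ℝ)) * ‖x k‖) →
      (∑' k : ℕ, ((k + 1 : ℝ) / (Nat.factorial k : ℝ)) * ‖x k‖) ≤ r →
      ∃ γ : ℂ → Ecx n,
        AnalyticOnNhd ℝ γ (ball 0 1) ∧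
        (∀ ζ ∈ ball (0 : ℂ) 1, γ ζ ∈ U) ∧
        JHolOn J (ball 0 1) γ ∧
        ∀ k : ℕ, iteratedDeriv k (fun t : ℝ => γ t) 0 = x k :=
  exists_jHolOn_iteratedDeriv hU h0U hJan hJsq
end
end

section
/- Let J be a real analytic almost complex structure on a neighborhood of 0 in ℝ^{2n} with J(0) = J₀, let M = {φ = 0} with 0 ∈ M, and let X be a real analytic vector field in a neighborhood of 0 lying in T^JM such that every vector field obtained from X by finitely many applications of J and of Lie brackets again lies in T^JM (i.e. the complex Lie algebra ℒ(X) generated by X and JX is contained in T^JM). Then there is a neighborhood V of 0 such that for every p ∈ M ∩ V there exist ρ > 0 and a real analytic J-holomorphic map γ : {ζ ∈ ℂ : |ζ| < ρ} → ℝ^{2n} with γ(0) = p, γ({|ζ| < ρ}) ⊆ M, and ∂^kγ/∂x^k(0) = D_X^{k−1,0}X(p) for every k ≥ 1. -/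
noncomputable section

open Metric

variable {F : Type*} [NormedAddCommGroup F] [NormedSpace ℝ F]

/-- Lie bracket of vector fields: `[X,Y](p) = dY(p)(X(p)) − dX(p)(Y(p))`. -/
def lieVF (X Y : F → F) : F → F :=
  fun p => fderiv ℝ Y p (X p) - fderiv ℝ X p (Y p)

/-- The vector field `JX : x ↦ J(x) X(x)`. -/
def Jvf (J : F → F →L[ℝ] F) (X : F → F) : F → F := fun p => J p (X p)

/-- The flat covariant derivative `X · Y : p ↦ dY(p)(X(p))`. -/
def derVF (X Y : F → F) : F → F := fun p => fderiv ℝ Y p (X p)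

/-- `DX X Y k = D_X^{k,0} Y = X·(X·(⋯(X·Y)))` (`k` times). -/
def DX (X Y : F → F) : ℕ → (F → F)
  | 0 => Y
  | k + 1 => derVF X (DX X Y k)

/-- `applyVF [X₁,…,X_k] Z = X₁·(X₂·(⋯(X_k·Z)))`. -/
def applyVF : List (F → F) → (F → F) → (F → F)
  | [], Z => Z
  | Y :: rest, Z => derVF Y (applyVF rest Z)

/-- `nestedLie [X₁,…,X_k] Z = [X₁,[X₂,[…,[X_k, Z]…]]]`. -/
def nestedLie : List (F → F) → (F → F) → (F → F)
  | [], Z => Z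
  | Y :: rest, Z => lieVF Y (nestedLie rest Z)

/-- Selector for elements of `{X, JX}`: `pickVF X JX true = X`, `pickVF X JX false = JX`. -/
def pickVF (X Y : F → F) (b : Bool) : F → F := if b then X else Y

/-- `X` commutes at order `k` at `p`: all iterated Lie brackets of length `l` with
`2 ≤ l ≤ k` of elements of `{X, JX}` vanish at `p`. -/
def CommutesAtOrder (J : F → F →L[ℝ] F) (X : F → F) (k : ℕ) (p : F) : Prop :=
  ∀ m : ℕ, 1 ≤ m → m + 1 ≤ k → ∀ b : Fin m → Bool, ∀ c : Bool,
    nestedLie (List.ofFn fun i => pickVF X (Jvf J X) (b i))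
      (pickVF X (Jvf J X) c) p = 0


/-- A vector field lies in `T^J M` (with `M = {φ = 0}` inside `U`). -/
def InTJM (J : F → F →L[ℝ] F) (φ : F → ℝ) (U : Set F) (X : F → F) : Prop :=
  ∀ q ∈ U, φ q = 0 → fderiv ℝ φ q (X q) = 0 ∧ fderiv ℝ φ q (J q (X q)) = 0

/-- The complex Lie algebra `ℒ(X)` generated by `X`: the vector fields obtained from `X`
by finitely many applications of `J` and of Lie brackets. -/
inductive LieGen (J : F → F →L[ℝ] F) (X : F → F) : (F → F) → Prop
  | base : LieGen J X X
  | jmul {Y : F → F} : LieGen J X Y → LieGen J X (Jvf J Y)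
  | bracket {Y Z : F → F} : LieGen J X Y → LieGen J X Z → LieGen J X (lieVF Y Z)

section Analytic

set_option maxSynthPendingDepth 3

variable {E G H : Type*} [NormedAddCommGroup E] [NormedSpace ℝ E] [NormedAddCommGroup G]
  [NormedSpace ℝ G] [NormedAddCommGroup H] [NormedSpace ℝ H]

/-- The `m`-th Taylor coefficient of `(1 - L s)⁻ᵉ`. -/
def geomCoeff (L : ℝ) (e m : ℕ) : ℝ :=
  PowerSeries.coeff m ((PowerSeries.mk fun n => L ^ n) ^ e)

lemma geomCoeff_one (L : ℝ) (m : ℕ) : geomCoeff L 1 m = L ^ m := by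
  simp [geomCoeff]

lemma geomCoeff_add (L : ℝ) (e e' m : ℕ) :
    geomCoeff L (e + e') m =
      ∑ i ∈ Finset.range (m + 1), geomCoeff L e i * geomCoeff L e' (m - i) := by
  rw [geomCoeff, pow_add, PowerSeries.coeff_mul, Finset.Nat.sum_antidiagonal_eq_sum_range_succ_mk]
  rfl

lemma geomCoeff_nonneg {L : ℝ} (hL : 0 ≤ L) (e m : ℕ) : 0 ≤ geomCoeff L e m := by
  induction e generalizing m with
  | zero => simp only [geomCoeff, pow_zero, PowerSeries.coeff_one]; split_ifs <;> norm_num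
  | succ e ih =>
    rw [geomCoeff_add]
    exact Finset.sum_nonneg fun i _ => mul_nonneg (ih i) (by rw [geomCoeff_one]; positivity)

lemma geomCoeff_mono {L L' : ℝ} (hL : 0 ≤ L) (h : L ≤ L') (e m : ℕ) :
    geomCoeff L e m ≤ geomCoeff L' e m := by
  induction e generalizing m with
  | zero => simp [geomCoeff]
  | succ e ih =>
    rw [geomCoeff_add, geomCoeff_add]
    refine Finset.sum_le_sum fun i _ => ?_
    rw [geomCoeff_one, geomCoeff_one]
    exact mul_le_mul (ih i) (by gcongr) (by positivity) (geomCoeff_nonneg (hL.trans h) _ _)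

lemma geomCoeff_le {L : ℝ} (hL : 0 ≤ L) (e m : ℕ) : geomCoeff L e m ≤ 2 ^ e * (2 * L) ^ m := by
  induction e generalizing m with
  | zero =>
    simp only [geomCoeff, pow_zero, PowerSeries.coeff_one]
    split_ifs with h
    · simp [h]
    · positivity
  | succ e ih =>
    rw [geomCoeff_add]
    calc _ ≤ ∑ i ∈ Finset.range (m + 1), 2 ^ e * L ^ m * 2 ^ i := by
          refine Finset.sum_le_sum fun i hi => ?_
          have hi' : i + (m - i) = m := by have := Finset.mem_range.1 hi; omega
          rw [geomCoeff_one]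
          calc _ ≤ (2 ^ e * (2 * L) ^ i) * L ^ (m - i) := by gcongr; exact ih i
            _ = 2 ^ e * (L ^ (i + (m - i))) * 2 ^ i := by rw [mul_pow, pow_add]; ring
            _ = _ := by rw [hi']
      _ = 2 ^ e * L ^ m * (2 ^ (m + 1) - 1) := by
          rw [← Finset.mul_sum, geom_sum_eq (by norm_num)]; norm_num
      _ ≤ 2 ^ e * L ^ m * 2 ^ (m + 1) := by gcongr; linarith
      _ = _ := by rw [mul_pow]; ring

lemma geomCoeff_succ (L : ℝ) (e m : ℕ) :
    (m + 1) * geomCoeff L e (m + 1) = e * L * geomCoeff L (e + 1) m := by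
  have hP : PowerSeries.derivative ℝ (PowerSeries.mk fun n => L ^ n) =
      PowerSeries.C L * (PowerSeries.mk fun n => L ^ n) ^ 2 := by
    ext n
    rw [PowerSeries.coeff_derivative, PowerSeries.coeff_C_mul, PowerSeries.coeff_mk]
    have := geomCoeff_add L 1 1 n
    simp only [geomCoeff_one] at this
    change geomCoeff L 2 n = _ at this
    change _ = L * geomCoeff L 2 n
    rw [this, Finset.sum_congr rfl (g := fun _ => L ^ n)]
    · simp; ring
    · intro i hi
      rw [← pow_add]
      congr 1
      have := Finset.mem_range.1 hi; omega
  rcases e with _ | e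
  · simp [geomCoeff, PowerSeries.coeff_one]
  · have h2 : PowerSeries.derivative ℝ ((PowerSeries.mk fun n => L ^ n) ^ (e + 1)) =
        PowerSeries.C (((e + 1 : ℕ) : ℝ) * L) * (PowerSeries.mk fun n => L ^ n) ^ (e + 1 + 1) := by
      rw [Derivation.leibniz_pow, hP]
      simp only [smul_eq_mul, nsmul_eq_mul, map_mul, map_natCast, Nat.add_sub_cancel]
      ring
    have h3 := congrArg (PowerSeries.coeff m) h2
    rw [PowerSeries.coeff_derivative, PowerSeries.coeff_C_mul] at h3
    rw [mul_comm]
    exact h3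

/-- The Taylor coefficients of `f` at the points of `B` are bounded by those of
`c (1 - L s)⁻ᵉ`. -/
def Majorized (L : ℝ) (B : Set E) (c : ℝ) (e : ℕ) (f : E → G) : Prop :=
  ∀ q ∈ B, ∀ m : ℕ, ‖iteratedFDeriv ℝ m f q‖ ≤ m.factorial * (c * geomCoeff L e m)

namespace Majorized

variable {L L' c c' : ℝ} {B : Set E} {e e' : ℕ}

lemma mono {f : E → G} (hf : Majorized L B c e f) (hc : c ≤ c') (hL : 0 ≤ L) :
    Majorized L B c' e f := fun q hq m => (hf q hq m).trans (by
  have := geomCoeff_nonneg hL e m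
  gcongr)

lemma mono_rate {f : E → G} (hf : Majorized L B c e f) (hc : 0 ≤ c) (hL : 0 ≤ L) (h : L ≤ L') :
    Majorized L' B c e f := fun q hq m => (hf q hq m).trans (by
  have := geomCoeff_mono hL h e m
  gcongr)

lemma mono_set {B' : Set E} {f : E → G} (hf : Majorized L B c e f) (h : B' ⊆ B) :
    Majorized L B' c e f := fun q hq m => hf q (h hq) m

lemma clm_apply (hB : IsOpen B) {f : E → G →L[ℝ] H} {g : E → G}
    (hfa : AnalyticOnNhd ℝ f B) (hga : AnalyticOnNhd ℝ g B)
    (hf : Majorized L B c e f) (hg : Majorized L B c' e' g) :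
    Majorized L B (c * c') (e + e') (fun q => f q (g q)) := by
  intro q hq m
  have key := norm_iteratedFDerivWithin_clm_apply (n := m) (N := (m : ℕ∞))
    (f := f) (g := g) (s := B) (x := q)
    (hfa.analyticOn.contDiffOn hB.uniqueDiffOn) (hga.analyticOn.contDiffOn hB.uniqueDiffOn)
    hB.uniqueDiffOn hq le_rfl
  simp only [iteratedFDerivWithin_of_isOpen _ hB hq] at key
  refine key.trans ?_
  rw [geomCoeff_add, Finset.mul_sum, Finset.mul_sum]
  refine Finset.sum_le_sum fun i hi => ?_
  have hi' : i ≤ m := by have := Finset.mem_range.1 hi; omega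
  have h1 := hf q hq i
  have h2 := hg q hq (m - i)
  calc _ ≤ (m.choose i : ℝ) * (i.factorial * (c * geomCoeff L e i)) *
        ((m - i).factorial * (c' * geomCoeff L e' (m - i))) := by
        gcongr
        exact mul_nonneg (by positivity) ((norm_nonneg _).trans h1)
    _ = (m.choose i * i.factorial * (m - i).factorial : ℕ) *
        (c * c' * (geomCoeff L e i * geomCoeff L e' (m - i))) := by push_cast; ring
    _ = _ := by rw [Nat.choose_mul_factorial_mul_factorial hi']

lemma fderiv {f : E → G} (hf : Majorized L B c e f) :
    Majorized L B (c * (e * L)) (e + 1) (fderiv ℝ f) := by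
  intro q hq m
  rw [norm_iteratedFDeriv_fderiv]
  refine (hf q hq (m + 1)).trans (le_of_eq ?_)
  have := geomCoeff_succ L e m
  rw [Nat.factorial_succ]
  push_cast
  linear_combination (m.factorial : ℝ) * c * this

lemma sum [CompleteSpace G] {ι : Type*} {s : Finset ι} {f : ι → E → G} {C : ι → ℝ}
    (hfa : ∀ i ∈ s, AnalyticOnNhd ℝ (f i) B) (hf : ∀ i ∈ s, Majorized L B (C i) e (f i)) :
    Majorized L B (∑ i ∈ s, C i) e (fun q => ∑ i ∈ s, f i q) := by
  intro q hq m
  rw [iteratedFDeriv_fun_sum_apply fun i hi => (hfa i hi q hq).contDiffAt]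
  refine (norm_sum_le _ _).trans ?_
  rw [Finset.sum_mul, Finset.mul_sum]
  exact Finset.sum_le_sum fun i hi => hf i hi q hq m

lemma const_smul [CompleteSpace G] {f : E → G} (hfa : AnalyticOnNhd ℝ f B)
    (hf : Majorized L B c e f) (a : ℝ) :
    Majorized L B (|a| * c) e (fun q => a • f q) := by
  intro q hq m
  rw [iteratedFDeriv_const_smul_apply' (hfa q hq).contDiffAt, norm_smul, Real.norm_eq_abs]
  calc _ ≤ |a| * (m.factorial * (c * geomCoeff L e m)) := by gcongr; exact hf q hq m
    _ = _ := by ring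

lemma norm_le {f : E → G} (hf : Majorized L B c e f) (hL : 0 ≤ L) (hc : 0 ≤ c) {q : E}
    (hq : q ∈ B) (m : ℕ) :
    ‖iteratedFDeriv ℝ m f q‖ ≤ m.factorial * (c * 2 ^ e * (2 * L) ^ m) := by
  refine (hf q hq m).trans ?_
  rw [mul_assoc c]
  gcongr
  exact geomCoeff_le hL e m

end Majorized

open scoped NNReal ENNReal in
/-- Uniform Cauchy estimates for a real analytic function. -/
lemma AnalyticAt.exists_majorized [CompleteSpace G] {f : E → G} {p : E}
    (hf : AnalyticAt ℝ f p) :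
    ∃ r > 0, ∃ L > 0, ∃ C > 0, AnalyticOnNhd ℝ f (ball p r) ∧ Majorized L (ball p r) C 1 f := by
  obtain ⟨P, R, hP⟩ := hf
  obtain ⟨ρ, hρ0, hρ⟩ : ∃ ρ : ℝ≥0, 0 < ρ ∧ (ρ + ρ : ℝ≥0∞) < R := by
    obtain ⟨x, hx0, hx⟩ := ENNReal.lt_iff_exists_nnreal_btwn.1 hP.r_pos
    refine ⟨x / 2, ?_, ?_⟩
    · have : 0 < x := by exact_mod_cast hx0
      positivity
    · rw [← ENNReal.coe_add, add_halves]; exact hx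
  have hsum := P.changeOriginSeries_summable_aux₁ (hρ.trans_le hP.r_le)
  set A := ∑' s : Σ k l : ℕ, { s : Finset (Fin (k + l)) // s.card = l },
      ‖P (s.1 + s.2.1)‖₊ * ρ ^ s.2.1 * ρ ^ s.1 with hA
  have hbound : ∀ y : E, ‖y‖₊ < ρ → ∀ k, ‖P.changeOrigin y k‖₊ * ρ ^ k ≤ A := by
    intro y hy k
    have hyr : (‖y‖₊ : ℝ≥0∞) < P.radius :=
      lt_of_lt_of_le (lt_of_lt_of_le (by exact_mod_cast hy) le_self_add) (hρ.le.trans hP.r_le)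
    calc _ ≤ (∑' s : Σ l : ℕ, { s : Finset (Fin (k + l)) // s.card = l },
            ‖P (k + s.1)‖₊ * ‖y‖₊ ^ s.1) * ρ ^ k := by
          gcongr; exact P.nnnorm_changeOrigin_le k hyr
      _ = ∑' s : Σ l : ℕ, { s : Finset (Fin (k + l)) // s.card = l },
            ‖P (k + s.1)‖₊ * ‖y‖₊ ^ s.1 * ρ ^ k := by rw [NNReal.tsum_mul_right]
      _ ≤ ∑' s : Σ l : ℕ, { s : Finset (Fin (k + l)) // s.card = l },
            ‖P (k + s.1)‖₊ * ρ ^ s.1 * ρ ^ k := by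
          have h1 := (NNReal.summable_sigma.1 hsum).1 k
          refine Summable.tsum_le_tsum (fun s => by gcongr)
            (NNReal.summable_of_le (fun s => by gcongr) h1) h1
      _ ≤ A := by
          have h2 := (NNReal.summable_sigma.1 hsum).2
          rw [hA, hsum.tsum_sigma' (NNReal.summable_sigma.1 hsum).1]
          exact h2.le_tsum k (fun _ _ => bot_le)
  refine ⟨ρ, by exact_mod_cast hρ0, (ρ : ℝ)⁻¹, by positivity, A + 1, by positivity, ?_, ?_⟩
  · intro q hq
    refine hP.analyticAt_of_mem ?_
    have h1 : edist q p < ρ := by rw [edist_lt_coe]; exact_mod_cast mem_ball.1 hq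
    exact lt_of_lt_of_le h1 (le_self_add.trans hρ.le)
  · intro q hq m
    have hqρ : ‖q - p‖₊ < ρ := by
      rw [mem_ball, dist_eq_norm] at hq; exact_mod_cast hq
    have h1 := hP.changeOrigin (y := q - p)
      (lt_of_lt_of_le (lt_of_lt_of_le (by exact_mod_cast hqρ) le_self_add) hρ.le)
    rw [add_sub_cancel] at h1
    rw [geomCoeff_one]
    have h3 : ‖P.changeOrigin (q - p) m‖ ≤ (A + 1) * (ρ : ℝ)⁻¹ ^ m := by
      have h4 : ‖P.changeOrigin (q - p) m‖ * (ρ : ℝ) ^ m ≤ A := by exact_mod_cast hbound _ hqρ m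
      rw [inv_pow, ← div_eq_mul_inv, le_div_iff₀ (by positivity)]
      linarith
    refine ContinuousMultilinearMap.opNorm_le_bound (by positivity) fun v => ?_
    rw [h1.iteratedFDeriv_eq_sum_of_completeSpace]
    refine (norm_sum_le _ _).trans ?_
    calc _ ≤ ∑ σ : Equiv.Perm (Fin m), ((A + 1) * (ρ : ℝ)⁻¹ ^ m) * ∏ i, ‖v i‖ := by
          refine Finset.sum_le_sum fun σ _ => ?_
          refine (ContinuousMultilinearMap.le_opNorm _ _).trans ?_
          rw [Equiv.prod_comp σ (fun i => ‖v i‖)]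
          gcongr
      _ = _ := by
          rw [Finset.sum_const, Finset.card_univ, Fintype.card_perm, Fintype.card_fin,
            nsmul_eq_mul]
          ring

open scoped NNReal ENNReal in
/-- An analytic function on a ball whose Taylor coefficients at the centre satisfy Cauchy
estimates is the sum of its Taylor series on the whole ball. -/
lemma AnalyticOnNhd.hasSum_taylor [CompleteSpace G] {f : E → G} {q : E} {r R c : ℝ}
    (hr : 0 < r) (hrR : r * R ≤ 1) (hf : AnalyticOnNhd ℝ f (ball q r))
    (hb : ∀ m : ℕ, ‖iteratedFDeriv ℝ m f q‖ ≤ m.factorial * (c * R ^ m)) (hR : 0 ≤ R) (hc : 0 ≤ c)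
    {y : E} (hy : y ∈ ball 0 r) :
    HasSum (fun m : ℕ => (m.factorial : ℝ)⁻¹ • iteratedFDeriv ℝ m f q fun _ => y) (f (q + y)) := by
  set p : FormalMultilinearSeries ℝ E G :=
    fun m => (m.factorial : ℝ)⁻¹ • iteratedFDeriv ℝ m f q with hp
  have hp_le : ∀ m, ‖p m‖ ≤ c * R ^ m := by
    intro m
    rw [hp]
    simp only [norm_smul, norm_inv, Real.norm_natCast]
    rw [inv_mul_le_iff₀ (by positivity)]
    exact hb m
  have hrad : ENNReal.ofReal r ≤ p.radius := by
    refine p.le_radius_of_bound c (r := r.toNNReal) fun n => ?_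
    rw [Real.coe_toNNReal _ hr.le]
    calc _ ≤ c * R ^ n * r ^ n := by gcongr; exact hp_le n
      _ = c * (r * R) ^ n := by rw [mul_pow]; ring
      _ ≤ c * 1 := by gcongr; exact pow_le_one₀ (by positivity) hrR
      _ = c := mul_one c
  have hr' : 0 < ENNReal.ofReal r := ENNReal.ofReal_pos.2 hr
  have hps := (p.hasFPowerSeriesOnBall (hr'.trans_le hrad)).mono hr' hrad
  have hps' := hps.comp_sub q
  rw [zero_add] at hps'
  have hga := hps'.analyticOnNhd
  rw [eball_ofReal] at hga
  have hev : f =ᶠ[nhds q] fun z => p.sum (z - q) := by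
    obtain ⟨P, ρ, hP⟩ := hf q (mem_ball_self hr)
    have : ∀ᶠ z in nhds q, z ∈ eball q ρ := eball_mem_nhds _ hP.r_pos
    filter_upwards [this] with z hz
    have h1 := hP.hasSum_iteratedFDeriv (y := z - q) (by
      simpa [edist_eq_enorm_sub] using hz)
    rw [add_sub_cancel] at h1
    exact h1.tsum_eq.symm
  have heq := hf.eqOn_of_preconnected_of_eventuallyEq hga
    (convex_ball q r).isPreconnected (mem_ball_self hr) hev
  have h2 := heq (x := q + y) (by simpa using hy)
  rw [h2]
  beta_reduce
  rw [add_sub_cancel_left]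
  have h3 := hps.hasSum (y := y) (by rw [eball_ofReal]; exact hy)
  rw [zero_add] at h3
  exact h3

/-- Exchange of the order of summation in an absolutely convergent double series. -/
lemma hasSum_tsum_comm {G : Type*} [NormedAddCommGroup G] [CompleteSpace G] {F : ℕ → ℕ → G}
    {A g : ℕ → G}
    (hF : Summable fun x : ℕ × ℕ => F x.1 x.2) (hA : ∀ m, HasSum (fun k => F k m) (A m))
    (hg : ∀ k, HasSum (fun m => F k m) (g k)) : HasSum A (∑' k, g k) := by
  have h1 : ∑' x : ℕ × ℕ, F x.1 x.2 = ∑' k, g k := by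
    rw [hF.tsum_prod]
    exact tsum_congr fun k => (hg k).tsum_eq
  have h2 : HasSum (fun x : ℕ × ℕ => F x.2 x.1) (∑' k, g k) := by
    rw [← h1]
    exact (Equiv.prodComm ℕ ℕ).hasSum_iff.2 hF.hasSum
  exact h2.prod_fiberwise hA

open scoped NNReal ENNReal in
/-- A series of analytic functions with summable uniform Cauchy estimates on a ball converges to
an analytic function, and can be differentiated term by term. -/
lemma analyticOnNhd_tsum [CompleteSpace G] {f : ℕ → E → G} {p : E} {r R : ℝ} {c : ℕ → ℝ}
    (hfa : ∀ k, AnalyticOnNhd ℝ (f k) (ball p r)) (hc : Summable c) (hc0 : ∀ k, 0 ≤ c k)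
    (hR : 0 < R)
    (hb : ∀ k, ∀ q ∈ ball p r, ∀ m : ℕ,
      ‖iteratedFDeriv ℝ m (f k) q‖ ≤ m.factorial * (c k * R ^ m)) :
    AnalyticOnNhd ℝ (fun q => ∑' k, f k q) (ball p r) ∧
    ∀ q ∈ ball p r, HasFDerivAt (fun q => ∑' k, f k q) (∑' k, fderiv ℝ (f k) q) q := by
  have hb0 : ∀ k, ∀ q ∈ ball p r, ‖f k q‖ ≤ c k := fun k q hq => by simpa using hb k q hq 0
  have hb1 : ∀ k, ∀ q ∈ ball p r, ‖fderiv ℝ (f k) q‖ ≤ c k * R := fun k q hq => by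
    rw [← norm_iteratedFDeriv_one]; simpa using hb k q hq 1
  constructor
  · intro q hq
    obtain ⟨δ, hδ0, hδ⟩ := Metric.isOpen_iff.1 isOpen_ball q hq
    set s : ℝ := min δ (1 / (2 * R)) with hs
    have hs0 : 0 < s := lt_min hδ0 (by positivity)
    have hsR : s * R ≤ 1 / 2 := by
      calc s * R ≤ 1 / (2 * R) * R := by gcongr; exact min_le_right _ _
        _ = 1 / 2 := by field_simp
    have hsub : ball q s ⊆ ball p r := (ball_subset_ball (min_le_left _ _)).trans hδ
    set a : ℕ → FormalMultilinearSeries ℝ E G :=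
      fun k m => (m.factorial : ℝ)⁻¹ • iteratedFDeriv ℝ m (f k) q with ha
    have ha_le : ∀ k m, ‖a k m‖ ≤ c k * R ^ m := by
      intro k m
      simp only [ha, norm_smul, norm_inv, Real.norm_natCast]
      rw [inv_mul_le_iff₀ (by positivity)]
      exact hb k q hq m
    have ha_sum : ∀ m, Summable fun k => a k m := fun m =>
      .of_norm_bounded (hc.mul_right _) fun k => ha_le k m
    refine ⟨fun m => ∑' k, a k m, ENNReal.ofReal s, ?_, ENNReal.ofReal_pos.2 hs0, ?_⟩
    · refine FormalMultilinearSeries.le_radius_of_bound _ (∑' k, c k) (r := s.toNNReal) fun n => ?_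
      rw [Real.coe_toNNReal _ hs0.le]
      calc _ ≤ (∑' k, c k * R ^ n) * s ^ n := by
            gcongr
            exact tsum_of_norm_bounded (hc.mul_right _).hasSum fun k => ha_le k n
        _ = (∑' k, c k) * (s * R) ^ n := by rw [tsum_mul_right, mul_pow]; ring
        _ ≤ (∑' k, c k) * 1 := by
            gcongr
            · exact tsum_nonneg hc0
            · exact pow_le_one₀ (by positivity) (by linarith)
        _ = _ := mul_one _
    · intro y hy
      rw [eball_ofReal] at hy
      have hys : ‖y‖ < s := by simpa using hy
      have hT : ∀ k, HasSum (fun m : ℕ => a k m fun _ => y) (f k (q + y)) := fun k =>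
        AnalyticOnNhd.hasSum_taylor hs0 (by linarith) ((hfa k).mono hsub)
          (hb k q hq) hR.le (hc0 k) hy
      refine hasSum_tsum_comm (F := fun k m => a k m fun _ => y) ?_
        (fun m => ContinuousMultilinearMap.hasSum_eval (ha_sum m).hasSum _) hT
      refine .of_norm_bounded (g := fun x : ℕ × ℕ => c x.1 * (1 / 2) ^ x.2)
        (hc.mul_of_nonneg (summable_geometric_two) hc0 (fun _ => by positivity)) ?_
      rintro ⟨k, m⟩
      refine ((a k m).le_opNorm _).trans ?_
      rw [Finset.prod_const, Finset.card_univ, Fintype.card_fin]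
      calc _ ≤ c k * R ^ m * s ^ m := by
            gcongr
            · exact mul_nonneg (hc0 k) (by positivity)
            · exact ha_le k m
        _ = c k * (s * R) ^ m := by rw [mul_pow]; ring
        _ ≤ _ := by gcongr; exact hc0 k
  · intro q hq
    exact hasFDerivAt_tsum_of_isPreconnected (hc.mul_right R) isOpen_ball
      (convex_ball p r).isPreconnected
      (fun k x hx => (hfa k x hx).differentiableAt.hasFDerivAt) hb1 hq
      (.of_norm_bounded hc fun k => hb0 k q hq) hq

/-- Applying an analytic family of continuous linear maps to an analytic map is analytic. -/
lemma AnalyticAt.clm_eval {f : E → G →L[ℝ] H} {g : E → G} {q : E}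
    (hf : AnalyticAt ℝ f q) (hg : AnalyticAt ℝ g q) : AnalyticAt ℝ (fun x => f x (g x)) q :=
  ((ContinuousLinearMap.id ℝ (G →L[ℝ] H)).analyticAt_bilinear (f q, g q)).fun_comp
    (f := fun x => (f x, g x)) (hf.prod hg)

/-- Taylor coefficients in time of the solution of the quadratic evolution equation
`∂ₜ u = T(q)(u, D u)`, `u(0) = u₀`. -/
def evolCoeff (T : E → G →L[ℝ] (E →L[ℝ] G) →L[ℝ] G) (u₀ : E → G) : ℕ → E → G
  | 0 => u₀
  | k + 1 => fun q => ((k : ℝ) + 1)⁻¹ • ∑ i : Fin (k + 1),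
      T q (evolCoeff T u₀ i q) (fderiv ℝ (evolCoeff T u₀ (k - i)) q)
  termination_by k => k

lemma evolCoeff_zero (T : E → G →L[ℝ] (E →L[ℝ] G) →L[ℝ] G) (u₀ : E → G) :
    evolCoeff T u₀ 0 = u₀ := by
  rw [evolCoeff]

lemma evolCoeff_succ (T : E → G →L[ℝ] (E →L[ℝ] G) →L[ℝ] G) (u₀ : E → G) (k : ℕ) :
    evolCoeff T u₀ (k + 1) = fun q => ((k : ℝ) + 1)⁻¹ • ∑ x ∈ Finset.HasAntidiagonal.antidiagonal k,
      T q (evolCoeff T u₀ x.1 q) (fderiv ℝ (evolCoeff T u₀ x.2) q) := by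
  rw [evolCoeff]
  funext q
  rw [Finset.Nat.sum_antidiagonal_eq_sum_range_succ_mk,
    ← Fin.sum_univ_eq_sum_range (fun i =>
      T q (evolCoeff T u₀ i q) (fderiv ℝ (evolCoeff T u₀ (k - i)) q))]

lemma analyticOnNhd_evolCoeff [CompleteSpace G] {T : E → G →L[ℝ] (E →L[ℝ] G) →L[ℝ] G}
    {u₀ : E → G} {B : Set E} (hT : AnalyticOnNhd ℝ T B) (hu : AnalyticOnNhd ℝ u₀ B) (k : ℕ) :
    AnalyticOnNhd ℝ (evolCoeff T u₀ k) B := by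
  induction k using Nat.strong_induction_on with
  | _ k ih =>
    rcases k with _ | k
    · rwa [evolCoeff_zero]
    · rw [evolCoeff_succ]
      intro q hq
      refine analyticAt_const.smul (Finset.analyticAt_fun_sum _ fun x hx => ?_)
      have := Finset.HasAntidiagonal.mem_antidiagonal.1 hx
      exact ((hT q hq).clm_eval (ih x.1 (by omega) q hq)).clm_eval
        (ih x.2 (by omega) q hq).fderiv

lemma majorized_evolCoeff [CompleteSpace G] {T : E → G →L[ℝ] (E →L[ℝ] G) →L[ℝ] G}
    {u₀ : E → G} {B : Set E} (hB : IsOpen B) (hT : AnalyticOnNhd ℝ T B)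
    (hu : AnalyticOnNhd ℝ u₀ B) {L C : ℝ} (hL : 0 ≤ L) (hC : 0 ≤ C)
    (hTm : Majorized L B C 1 T) (hum : Majorized L B C 1 u₀) (k : ℕ) :
    Majorized L B (C * (3 * C ^ 2 * L) ^ k * catalan k) (3 * k + 1) (evolCoeff T u₀ k) := by
  induction k using Nat.strong_induction_on with
  | _ k ih =>
    rcases k with _ | k
    · simpa [evolCoeff_zero] using hum
    · rw [evolCoeff_succ]
      have ha := fun k => analyticOnNhd_evolCoeff hT hu k
      set D : ℝ := 3 * C ^ 2 * L with hD
      have hterm : ∀ x ∈ Finset.HasAntidiagonal.antidiagonal k, Majorized L B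
          ((k + 1) * (C * D ^ (k + 1) * (catalan x.1 * catalan x.2))) (3 * (k + 1) + 1)
          (fun q => T q (evolCoeff T u₀ x.1 q) (fderiv ℝ (evolCoeff T u₀ x.2) q)) := by
        rintro ⟨i, j⟩ hx
        have hij : i + j = k := Finset.HasAntidiagonal.mem_antidiagonal.1 hx
        have h1 := (hTm.clm_apply hB hT (ha i) (ih i (by omega))).clm_apply hB
          (fun q hq => (hT q hq).clm_eval (ha i q hq)) (ha j).fderiv (ih j (by omega)).fderiv
        have he : 1 + (3 * i + 1) + (3 * j + 1 + 1) = 3 * (k + 1) + 1 := by omega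
        rw [he] at h1
        refine h1.mono ?_ hL
        have hj : ((3 * j + 1 : ℕ) : ℝ) ≤ 3 * (k + 1) := by
          have : 3 * j + 1 ≤ 3 * (k + 1) := by omega
          exact_mod_cast this
        have hD0 : 0 ≤ D := by positivity
        calc _ = C ^ 3 * L * D ^ (i + j) * (catalan i * catalan j) * ((3 * j + 1 : ℕ) : ℝ) := by
              rw [pow_add]; ring
          _ ≤ C ^ 3 * L * D ^ (i + j) * (catalan i * catalan j) * (3 * (k + 1)) := by
              gcongr
          _ = _ := by rw [hij, pow_succ, hD]; ring
      have hterm_an : ∀ x ∈ Finset.HasAntidiagonal.antidiagonal k, AnalyticOnNhd ℝ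
          (fun q => T q (evolCoeff T u₀ x.1 q) (fderiv ℝ (evolCoeff T u₀ x.2) q)) B :=
        fun x _ q hq => AnalyticAt.clm_eval (AnalyticAt.clm_eval (hT q hq) (ha x.1 q hq))
          (ha x.2 q hq).fderiv
      have h2 := (Majorized.sum hterm_an hterm).const_smul (fun q hq =>
          Finset.analyticAt_fun_sum _ fun x hx => hterm_an x hx q hq) (((k : ℝ) + 1)⁻¹)
      refine h2.mono (le_of_eq ?_) hL
      rw [← Finset.mul_sum, ← Finset.mul_sum, abs_of_nonneg (by positivity), catalan_succ']
      push_cast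
      field_simp

lemma catalan_le_four_pow (k : ℕ) : catalan k ≤ 4 ^ k := by
  rw [catalan_eq_centralBinom_div]
  refine (Nat.div_le_self _ _).trans ?_
  rw [Nat.centralBinom]
  refine (Nat.choose_le_two_pow _ _).trans ?_
  rw [pow_mul]
  norm_num

namespace Majorized

variable {L c : ℝ} {e : ℕ}

lemma comp_fst {B : Set E} (hB : IsOpen B) {f : E → G} (hfa : AnalyticOnNhd ℝ f B)
    (hf : Majorized L B c e f) (s : Set H) :
    Majorized L (B ×ˢ s) c e (fun z : E × H => f z.1) := by
  rintro ⟨q, t⟩ ⟨hq, -⟩ m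
  have hB' : IsOpen (ContinuousLinearMap.fst ℝ E H ⁻¹' B) := hB.preimage (by fun_prop)
  have h1 := (ContinuousLinearMap.fst ℝ E H).iteratedFDerivWithin_comp_right (n := (m : ℕ∞))
    (f := f) (s := B) (hfa.analyticOn.contDiffOn hB.uniqueDiffOn) hB.uniqueDiffOn
    hB'.uniqueDiffOn (x := (q, t)) hq (i := m) le_rfl
  rw [iteratedFDerivWithin_of_isOpen _ hB' (by exact hq),
    iteratedFDerivWithin_of_isOpen _ hB (by exact hq)] at h1
  change ‖iteratedFDeriv ℝ m (f ∘ ContinuousLinearMap.fst ℝ E H) (q, t)‖ ≤ _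
  rw [h1]
  refine (ContinuousMultilinearMap.norm_compContinuousLinearMap_le _ _).trans ?_
  rw [Finset.prod_const]
  refine le_trans ?_ (hf q hq m)
  exact mul_le_of_le_one_right (norm_nonneg _)
    (pow_le_one₀ (norm_nonneg _) (ContinuousLinearMap.norm_fst_le ℝ E H))

lemma snd_smul_id {τ : ℝ} (hτ : 0 ≤ τ) (hL : 0 ≤ L) (hτL : 1 ≤ τ * L) (s : Set E) :
    Majorized L (s ×ˢ ball (0 : ℝ) τ) τ 1
      (fun z : E × ℝ => z.2 • ContinuousLinearMap.id ℝ G) := by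
  rintro ⟨q, t⟩ ⟨-, ht⟩ m
  set h : E × ℝ →L[ℝ] G →L[ℝ] G :=
    (ContinuousLinearMap.snd ℝ E ℝ).smulRight (ContinuousLinearMap.id ℝ G) with hh
  change ‖iteratedFDeriv ℝ m h (q, t)‖ ≤ _
  have hid : ‖ContinuousLinearMap.id ℝ G‖ ≤ 1 := ContinuousLinearMap.norm_id_le
  have ht' : |t| < τ := by simpa using ht
  rw [geomCoeff_one]
  rcases m with _ | _ | m
  · simp only [norm_iteratedFDeriv_zero, Nat.factorial_zero, Nat.cast_one, pow_zero, mul_one,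
      one_mul]
    change ‖t • ContinuousLinearMap.id ℝ G‖ ≤ τ
    rw [norm_smul, Real.norm_eq_abs]
    calc _ ≤ τ * 1 := by gcongr
      _ = τ := mul_one _
  · rw [zero_add, norm_iteratedFDeriv_one]
    simp only [Nat.factorial_one, Nat.cast_one, pow_one, one_mul]
    rw [h.fderiv, hh, ContinuousLinearMap.norm_smulRight_apply]
    calc _ ≤ (1 : ℝ) * 1 := by
          gcongr; exact ContinuousLinearMap.norm_snd_le ℝ E ℝ
      _ ≤ _ := by linarith
  · rw [← norm_iteratedFDeriv_fderiv]
    have : _root_.fderiv ℝ (h : E × ℝ → G →L[ℝ] G) = fun _ => h := by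
      funext z; exact h.fderiv
    rw [this, iteratedFDeriv_succ_const]
    simp only [Pi.zero_apply, norm_zero]
    positivity

lemma pow_smul [CompleteSpace G] {τ : ℝ} (hτ : 0 ≤ τ) (hL : 0 ≤ L) (hτL : 1 ≤ τ * L) {B : Set E}
    (hB : IsOpen B) {f : E → G} (hfa : AnalyticOnNhd ℝ f B) (hf : Majorized L B c e f) (k : ℕ) :
    Majorized L (B ×ˢ ball (0 : ℝ) τ) (τ ^ k * c) (e + k) (fun z : E × ℝ => z.2 ^ k • f z.1) := by
  induction k with
  | zero => simpa using hf.comp_fst hB hfa (ball (0 : ℝ) τ)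
  | succ k ih =>
    have h1 := (snd_smul_id (G := G) hτ hL hτL B).clm_apply (hB.prod isOpen_ball)
      (g := fun z : E × ℝ => z.2 ^ k • f z.1) (fun z _ => analyticAt_snd.smul analyticAt_const)
      (fun z hz => (analyticAt_snd.pow k).smul ((hfa z.1 hz.1).fun_comp analyticAt_fst)) ih
    have he : 1 + (e + k) = e + (k + 1) := by ring
    rw [he] at h1
    have h2 := h1.mono (c' := τ ^ (k + 1) * c) (le_of_eq (by ring)) hL
    convert h2 using 1
    funext z
    simp [smul_smul, pow_succ', mul_comm]

end Majorized

/-- Cauchy product of two absolutely convergent series for a continuous bilinear map. -/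
lemma ContinuousLinearMap.hasSum_antidiagonal {K : Type*} [NormedAddCommGroup K] [NormedSpace ℝ K]
    [CompleteSpace G] [CompleteSpace H] [CompleteSpace K] (B : G →L[ℝ] H →L[ℝ] K)
    {x : ℕ → G} {y : ℕ → H} (hx : Summable fun k => ‖x k‖) (hy : Summable fun k => ‖y k‖) :
    HasSum (fun k => ∑ z ∈ Finset.HasAntidiagonal.antidiagonal k, B (x z.1) (y z.2))
      (B (∑' k, x k) (∑' k, y k)) := by
  have hs : Summable fun z : ℕ × ℕ => B (x z.1) (y z.2) := by
    refine .of_norm_bounded (g := fun z : ℕ × ℕ => ‖B‖ * (‖x z.1‖ * ‖y z.2‖))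
      ((hx.mul_of_nonneg hy (fun _ => norm_nonneg _) fun _ => norm_nonneg _).mul_left _) ?_
    intro z
    rw [← mul_assoc]
    exact B.le_opNorm₂ _ _
  have h1 : HasSum (fun z : ℕ × ℕ => B (x z.1) (y z.2)) (B (∑' k, x k) (∑' k, y k)) := by
    have h2 : HasSum (fun i => B (x i) (∑' k, y k)) (B (∑' k, x k) (∑' k, y k)) :=
      (B.flip (∑' k, y k)).hasSum hx.of_norm.hasSum
    have h3 := hs.hasSum.prod_fiberwise fun i => (B (x i)).hasSum hy.of_norm.hasSum
    rw [h2.unique h3]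
    exact hs.hasSum
  refine (Finset.HasAntidiagonal.sigmaAntidiagonalEquivProd.hasSum_iff.2 h1).sigma fun k => ?_
  rw [← Finset.sum_coe_sort]
  exact hasSum_fintype _

/-- Local analytic solution of the quadratic evolution equation `∂ₜ u = T(q)(u, D u)` with
analytic initial value (a case of the Cauchy–Kovalevskaya theorem). -/
theorem exists_analytic_evolution [CompleteSpace G] {T : E → G →L[ℝ] (E →L[ℝ] G) →L[ℝ] G}
    {u₀ : E → G} {p : E} (hT : AnalyticAt ℝ T p) (hu : AnalyticAt ℝ u₀ p) :
    ∃ r > 0, ∃ S : E × ℝ → G, AnalyticOnNhd ℝ S (ball (p, 0) r) ∧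
      (∀ z ∈ ball (p, (0 : ℝ)) r, HasSum (fun k => z.2 ^ k • evolCoeff T u₀ k z.1) (S z)) ∧
      ∀ z ∈ ball (p, (0 : ℝ)) r,
        fderiv ℝ S z (0, 1) = T z.1 (S z) ((fderiv ℝ S z).comp (.inl ℝ E ℝ)) := by
  obtain ⟨r₁, hr₁, L₁, hL₁, C₁, hC₁, hTa, hTm⟩ := hT.exists_majorized
  obtain ⟨r₂, hr₂, L₂, hL₂, C₂, hC₂, hua, hum⟩ := hu.exists_majorized
  obtain ⟨r₀, hr₀, L, hL, C, hC, hTa, hTm, hua, hum⟩ : ∃ r > 0, ∃ L > 0, ∃ C > 0,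
      AnalyticOnNhd ℝ T (ball p r) ∧ Majorized L (ball p r) C 1 T ∧
      AnalyticOnNhd ℝ u₀ (ball p r) ∧ Majorized L (ball p r) C 1 u₀ := by
    have s₁ : ball p (min r₁ r₂) ⊆ ball p r₁ := ball_subset_ball (min_le_left _ _)
    have s₂ : ball p (min r₁ r₂) ⊆ ball p r₂ := ball_subset_ball (min_le_right _ _)
    exact ⟨min r₁ r₂, lt_min hr₁ hr₂, max L₁ L₂, lt_max_of_lt_left hL₁, max C₁ C₂,
      lt_max_of_lt_left hC₁, hTa.mono s₁,
      ((hTm.mono_set s₁).mono_rate hC₁.le hL₁.le (le_max_left _ _)).mono (le_max_left _ _)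
        (by positivity), hua.mono s₂,
      ((hum.mono_set s₂).mono_rate hC₂.le hL₂.le (le_max_right _ _)).mono (le_max_right _ _)
        (by positivity)⟩
  set D : ℝ := 3 * C ^ 2 * L with hD
  have hD0 : 0 < D := by positivity
  clear_value D
  set τ : ℝ := (128 * D)⁻¹ with hτ
  have hτ0 : 0 < τ := by positivity
  set L' : ℝ := L + τ⁻¹ with hL'
  have hL'0 : 0 < L' := by positivity
  have hLL' : L ≤ L' := by rw [hL']; linarith [inv_pos.2 hτ0]
  have hτL' : 1 ≤ τ * L' := by
    rw [hL', mul_add, mul_inv_cancel₀ hτ0.ne']; linarith [mul_pos hτ0 hL]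
  have ha := analyticOnNhd_evolCoeff hTa hua
  set f : ℕ → E × ℝ → G := fun k z => z.2 ^ k • evolCoeff T u₀ k z.1 with hf
  set r := min r₀ τ with hr
  have hr0 : 0 < r := lt_min hr₀ hτ0
  have hsub : ball (p, (0 : ℝ)) r ⊆ ball p r₀ ×ˢ ball (0 : ℝ) τ := by
    rw [← ball_prod_same]
    exact Set.prod_mono (ball_subset_ball (min_le_left _ _)) (ball_subset_ball (min_le_right _ _))
  have hfa : ∀ k, AnalyticOnNhd ℝ (f k) (ball (p, 0) r) := fun k z hz =>
    (analyticAt_snd.pow k).smul ((ha k z.1 (hsub hz).1).fun_comp analyticAt_fst)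
  set c : ℕ → ℝ := fun k => 2 * C * (1 / 2) ^ k with hc
  have hcs : Summable c := summable_geometric_two.mul_left _
  have hc0 : ∀ k, 0 ≤ c k := fun k => by positivity
  have hb : ∀ k, ∀ z ∈ ball (p, (0 : ℝ)) r, ∀ m : ℕ,
      ‖iteratedFDeriv ℝ m (f k) z‖ ≤ m.factorial * (c k * (2 * L') ^ m) := by
    intro k z hz m
    have h1 := ((majorized_evolCoeff isOpen_ball hTa hua hL.le hC.le hTm hum k).mono_rate
      (by positivity) hL.le hLL').pow_smul hτ0.le hL'0.le hτL' isOpen_ball (ha k) k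
    refine (h1.norm_le hL'0.le (by positivity) (hsub hz) m).trans ?_
    gcongr
    have hcat : (catalan k : ℝ) ≤ 4 ^ k := by exact_mod_cast catalan_le_four_pow k
    calc τ ^ k * (C * (3 * C ^ 2 * L) ^ k * catalan k) * 2 ^ (3 * k + 1 + k)
        ≤ τ ^ k * (C * D ^ k * 4 ^ k) * 2 ^ (3 * k + 1 + k) := by rw [← hD]; gcongr
      _ = 2 * C * (τ * D * 4 * 16) ^ k := by
          rw [show 3 * k + 1 + k = 4 * k + 1 by ring, pow_succ, pow_mul, mul_pow, mul_pow, mul_pow,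
            show (2 : ℝ) ^ 4 = 16 by norm_num]
          ring
      _ = c k := by
          rw [hc, hτ]
          congr 2
          field_simp
          norm_num
  obtain ⟨hSa, hSd⟩ := analyticOnNhd_tsum hfa hcs hc0 (by positivity : 0 < 2 * L') hb
  have hb0 : ∀ z ∈ ball (p, (0 : ℝ)) r, ∀ k, ‖f k z‖ ≤ c k := fun z hz k => by
    simpa using hb k z hz 0
  have hb1 : ∀ z ∈ ball (p, (0 : ℝ)) r, ∀ k, ‖fderiv ℝ (f k) z‖ ≤ c k * (2 * L') :=
    fun z hz k => by
      rw [← norm_iteratedFDeriv_one]; simpa using hb k z hz 1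
  refine ⟨r, hr0, fun z => ∑' k, f k z, hSa, fun z hz =>
    (Summable.of_norm_bounded hcs (hb0 z hz)).hasSum, ?_⟩
  rintro ⟨q, t⟩ hz
  have hq := (hsub hz).1
  rw [(hSd _ hz).fderiv]
  have hx : Summable fun k => ‖f k (q, t)‖ :=
    .of_nonneg_of_le (fun _ => norm_nonneg _) (hb0 _ hz) hcs
  have hy : Summable fun k => ‖fderiv ℝ (f k) (q, t)‖ :=
    .of_nonneg_of_le (fun _ => norm_nonneg _) (hb1 _ hz) (hcs.mul_right _)
  have hfd : ∀ k, HasFDerivAt (f k) (t ^ k • (fderiv ℝ (evolCoeff T u₀ k) q).comp (.fst ℝ E ℝ) +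
      ((k * t ^ (k - 1)) • ContinuousLinearMap.snd ℝ E ℝ).smulRight (evolCoeff T u₀ k q))
      (q, t) := by
    intro k
    have h1 : HasFDerivAt (fun z : E × ℝ => z.2 ^ k)
        ((k * t ^ (k - 1)) • ContinuousLinearMap.snd ℝ E ℝ) (q, t) :=
      (hasDerivAt_pow k t).comp_hasFDerivAt (q, t) hasFDerivAt_snd
    have h2 : HasFDerivAt (fun z : E × ℝ => evolCoeff T u₀ k z.1)
        ((fderiv ℝ (evolCoeff T u₀ k) q).comp (.fst ℝ E ℝ)) (q, t) :=
      HasFDerivAt.comp (q, t) (ha k q hq).differentiableAt.hasFDerivAt hasFDerivAt_fst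
    exact h1.smul h2
  set incl := (ContinuousLinearMap.compL ℝ E (E × ℝ) G).flip (.inl ℝ E ℝ) with hincl
  have hA : ∀ k, incl (fderiv ℝ (f k) (q, t)) = t ^ k • fderiv ℝ (evolCoeff T u₀ k) q := by
    intro k
    rw [(hfd k).fderiv]
    ext v
    simp [hincl]
  have hyi : Summable fun k => ‖incl (fderiv ℝ (f k) (q, t))‖ :=
    .of_nonneg_of_le (fun _ => norm_nonneg _) (fun k => incl.le_opNorm _) (hy.mul_left _)
  have hprod := (T q).hasSum_antidiagonal hx hyi
  have hR : ∑' k, incl (fderiv ℝ (f k) (q, t)) =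
      (∑' k, fderiv ℝ (f k) (q, t)).comp (.inl ℝ E ℝ) :=
    (incl.map_tsum hy.of_norm).symm
  rw [hR] at hprod
  have hev := (ContinuousLinearMap.apply ℝ G ((0 : E), (1 : ℝ))).hasSum hy.of_norm.hasSum
  have hshift := (hasSum_nat_add_iff' 1).2 hev
  have h0 : ContinuousLinearMap.apply ℝ G ((0 : E), (1 : ℝ)) (fderiv ℝ (f 0) (q, t)) = 0 := by
    rw [(hfd 0).fderiv]
    simp
  rw [Finset.sum_range_one, h0, sub_zero] at hshift
  refine hshift.unique ?_
  convert hprod using 1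
  funext k
  rw [(hfd (k + 1)).fderiv, evolCoeff_succ]
  have hk : (k : ℝ) + 1 ≠ 0 := by positivity
  simp only [ContinuousLinearMap.apply_apply, add_apply, smul_apply, Nat.cast_add, Nat.cast_one,
    ContinuousLinearMap.comp_apply, ContinuousLinearMap.smulRight_apply, add_tsub_cancel_right,
    ContinuousLinearMap.coe_fst', ContinuousLinearMap.coe_snd', map_zero, smul_zero, zero_add,
    smul_eq_mul, mul_one, smul_smul]
  rw [mul_right_comm, mul_inv_cancel₀ hk, one_mul, Finset.smul_sum]
  refine Finset.sum_congr rfl fun x hx => ?_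
  rw [hA, ← Finset.HasAntidiagonal.mem_antidiagonal.1 hx, pow_add]
  simp only [hf, map_smul, smul_apply, smul_smul]
  rw [mul_comm]

lemma mem_ball_prod_zero {E : Type*} [NormedAddCommGroup E] {p : E} {r : ℝ} {z : E × ℝ} :
    z ∈ ball (p, (0 : ℝ)) r ↔ z.1 ∈ ball p r ∧ z.2 ∈ ball (0 : ℝ) r := by
  rw [← ball_prod_same]; rfl

lemma HasFDerivAt.hasDerivAt_snd {u : E × ℝ → G} {u' : E × ℝ →L[ℝ] G} {q : E} {t : ℝ}
    (h : HasFDerivAt u u' (q, t)) : HasDerivAt (fun s => u (q, s)) (u' (0, 1)) t :=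
  h.comp_hasDerivAt t ((hasDerivAt_const t q).prodMk (hasDerivAt_id t))

/-- The transport equation `∂ₜ u = D u · Z` has an analytic solution with `u(q, 0) = q`. -/
lemma exists_analytic_transport [CompleteSpace E] {Z : E → E} {p : E} (hZ : AnalyticAt ℝ Z p) :
    ∃ r > 0, ∃ u : E × ℝ → E, AnalyticOnNhd ℝ u (ball (p, 0) r) ∧
      (∀ q ∈ ball p r, u (q, 0) = q) ∧
      ∀ z ∈ ball (p, (0 : ℝ)) r, fderiv ℝ u z (0, 1) = fderiv ℝ u z (Z z.1, 0) := by
  set P : E × E →L[ℝ] E × E := (ContinuousLinearMap.inl ℝ E E).comp (.fst ℝ E E) with hP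
  set B : E × E →L[ℝ] (E →L[ℝ] E × E) →L[ℝ] E × E :=
    ((ContinuousLinearMap.compL ℝ (E →L[ℝ] E × E) (E × E) (E × E)) P).comp
      ((ContinuousLinearMap.apply ℝ (E × E)).comp (.snd ℝ E E)) with hB
  have hBa : ∀ u A, B u A = ((A u.2).1, 0) := fun u A => by simp [hB, hP]
  obtain ⟨r, hr, S, hS, hsum, hpde⟩ := exists_analytic_evolution (T := fun _ => B)
    (u₀ := fun q => (q, Z q)) (p := p) analyticAt_const (analyticAt_id.prod hZ)
  have hS2 : ∀ z ∈ ball (p, (0 : ℝ)) r, (S z).2 = Z z.1 := by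
    intro z hz
    have h1 := (ContinuousLinearMap.snd ℝ E E).hasSum (hsum z hz)
    refine h1.unique ?_
    convert hasSum_ite_eq (0 : ℕ) (Z z.1) using 1
    funext k
    rcases k with _ | k
    · simp [evolCoeff_zero]
    · simp [evolCoeff_succ, hBa]
  refine ⟨r, hr, fun z => (S z).1, fun z hz => analyticAt_fst.comp (hS z hz), ?_, ?_⟩
  · intro q hq
    have hz : (q, (0 : ℝ)) ∈ ball (p, (0 : ℝ)) r :=
      mem_ball_prod_zero.2 ⟨hq, mem_ball_self hr⟩
    have h1 := (ContinuousLinearMap.fst ℝ E E).hasSum (hsum _ hz)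
    refine h1.unique ?_
    convert hasSum_ite_eq (0 : ℕ) q using 1
    funext k
    rcases k with _ | k
    · simp [evolCoeff_zero]
    · simp
  · intro z hz
    have h1 : HasFDerivAt (fun z => (S z).1)
        ((ContinuousLinearMap.fst ℝ E E).comp (fderiv ℝ S z)) z :=
      hasFDerivAt_fst.comp z (hS z hz).differentiableAt.hasFDerivAt
    rw [h1.fderiv, ← hS2 z hz]
    simp [hpde z hz, hBa]

/-- A solution of the transport equation follows the integral curves of the vector field. -/
lemma hasDerivAt_of_transport [CompleteSpace E] {Z : E → E} {p q : E} {r : ℝ} {u : E × ℝ → E}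
    (hq : q ∈ ball p r) (hZ : AnalyticAt ℝ Z q)
    (hu : AnalyticOnNhd ℝ u (ball (p, 0) r)) (hu0 : ∀ q ∈ ball p r, u (q, 0) = q)
    (htr : ∀ z ∈ ball (p, (0 : ℝ)) r, fderiv ℝ u z (0, 1) = fderiv ℝ u z (Z z.1, 0)) :
    ∀ᶠ t in nhds (0 : ℝ), fderiv ℝ u (q, t) (0, 1) = Z (u (q, t)) := by
  have hr : 0 < r := pos_of_mem_ball hq
  obtain ⟨α, hα0, ε, hε, hα⟩ :=
    hZ.contDiffAt.exists_forall_mem_closedBall_exists_eq_forall_mem_Ioo_hasDerivAt₀ (0 : ℝ)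
  simp only [zero_sub, zero_add] at hα
  have hαc : ContinuousAt α 0 := (hα 0 ⟨by linarith, hε⟩).continuousAt
  have h1 : ∀ᶠ s in nhds (0 : ℝ), α s ∈ ball p r :=
    hαc.eventually_mem (isOpen_ball.mem_nhds (by rwa [hα0]))
  obtain ⟨δ, hδ, h1⟩ := Metric.eventually_nhds_iff_ball.1 h1
  set η := min (r / 2) (min ε δ) with hη
  have hη0 : 0 < η := by positivity
  have hηr : η ≤ r / 2 := min_le_left _ _
  have hηε : η ≤ ε := (min_le_right _ _).trans (min_le_left _ _)
  have hηδ : η ≤ δ := (min_le_right _ _).trans (min_le_right _ _)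
  have hflow : ∀ t ∈ ball (0 : ℝ) η, u (q, t) = α t := by
    intro t ht
    have ht' : |t| < η := by simpa using ht
    have hmem : ∀ s ∈ ball (0 : ℝ) η, (α s, t - s) ∈ ball (p, (0 : ℝ)) r := by
      intro s hs
      refine mem_ball_prod_zero.2 ⟨h1 s (ball_subset_ball hηδ hs), ?_⟩
      have hs' : |s| < η := by simpa using hs
      have := abs_sub t s
      simp only [mem_ball, dist_zero_right, Real.norm_eq_abs]
      linarith
    have hd : ∀ s ∈ ball (0 : ℝ) η, HasDerivAt (fun s => u (α s, t - s)) 0 s := by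
      intro s hs
      have hs' := abs_lt.1 (show |s| < η by simpa using hs)
      have h2 : HasDerivAt (fun s => (α s, t - s)) (Z (α s), (-1 : ℝ)) s :=
        (hα s ⟨by linarith, by linarith⟩).prodMk ((hasDerivAt_id s).const_sub t)
      have h3 := ((hu _ (hmem s hs)).differentiableAt.hasFDerivAt.comp_hasDerivAt s h2)
      have h4 := htr _ (hmem s hs)
      have h5 : (Z (α s), (-1 : ℝ)) = (Z (α s), 0) - ((0 : E), (1 : ℝ)) := by simp
      rw [h5, map_sub, h4, sub_self] at h3
      exact h3
    have h6 := isOpen_ball.is_const_of_deriv_eq_zero (convex_ball (0 : ℝ) η).isPreconnected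
      (fun s hs => (hd s hs).differentiableAt.differentiableWithinAt)
      (fun s hs => (hd s hs).deriv) ht (mem_ball_self hη0)
    simp only [sub_self, sub_zero, hα0] at h6
    rw [← h6, hu0 _ (h1 t (ball_subset_ball hηδ ht))]
  filter_upwards [ball_mem_nhds (0 : ℝ) hη0] with t ht
  have ht' := abs_lt.1 (show |t| < η by simpa using ht)
  have h2 : HasDerivAt (fun s => u (q, s)) (fderiv ℝ u (q, t) (0, 1)) t := by
    refine ((hu (q, t) (mem_ball_prod_zero.2 ⟨hq, ?_⟩)).differentiableAt.hasFDerivAt).hasDerivAt_snd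
    exact ball_subset_ball (by linarith) ht
  have h3 : (fun s => u (q, s)) =ᶠ[nhds t] α := by
    filter_upwards [isOpen_ball.mem_nhds ht] with s hs using hflow s hs
  rw [hflow t ht]
  exact h2.unique ((hα t ⟨by linarith, by linarith⟩).congr_of_eventuallyEq h3)

/-- An analytic vector field has an analytic local flow. -/
theorem exists_analytic_flow [CompleteSpace E] {Z : E → E} {p : E} (hZ : AnalyticAt ℝ Z p) :
    ∃ r > 0, ∃ u : E × ℝ → E, AnalyticOnNhd ℝ u (ball (p, 0) r) ∧
      (∀ q ∈ ball p r, u (q, 0) = q) ∧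
      ∀ z ∈ ball (p, (0 : ℝ)) r, AnalyticAt ℝ Z (u z) ∧ fderiv ℝ u z (0, 1) = Z (u z) := by
  obtain ⟨r₁, hr₁, u, hu, hu0, htr⟩ := exists_analytic_transport hZ
  have h1 : ∀ᶠ z in nhds (p, (0 : ℝ)), AnalyticAt ℝ Z (u z) := by
    have hc := (hu (p, 0) (mem_ball_self hr₁)).continuousAt
    refine hc.eventually ?_
    rw [hu0 p (mem_ball_self hr₁)]
    exact hZ.eventually_analyticAt
  obtain ⟨r₂, hr₂, h1⟩ := Metric.eventually_nhds_iff_ball.1 h1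
  have hs₁ : ball (p, (0 : ℝ)) (min r₁ r₂) ⊆ ball (p, 0) r₁ := ball_subset_ball (min_le_left _ _)
  have hs₂ : ball (p, (0 : ℝ)) (min r₁ r₂) ⊆ ball (p, 0) r₂ := ball_subset_ball (min_le_right _ _)
  set r := min r₁ r₂ with hr
  have hr0 : 0 < r := lt_min hr₁ hr₂
  refine ⟨r, hr0, u, hu.mono hs₁, fun q hq => hu0 q (ball_subset_ball (min_le_left _ _) hq),
    fun z hz => ⟨h1 z (hs₂ hz), ?_⟩⟩
  obtain ⟨q, t⟩ := z
  obtain ⟨hq, ht⟩ := mem_ball_prod_zero.1 hz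
  have hmem : ∀ s ∈ ball (0 : ℝ) r, (q, s) ∈ ball (p, (0 : ℝ)) r := fun s hs =>
    mem_ball_prod_zero.2 ⟨hq, hs⟩
  have hmk : ∀ s : ℝ, AnalyticAt ℝ (fun s : ℝ => (q, s)) s := fun s =>
    analyticAt_const.prod analyticAt_id
  have ha : AnalyticOnNhd ℝ (fun s => fderiv ℝ u (q, s) ((0 : E), (1 : ℝ))) (ball 0 r) :=
    fun s hs => ((hu _ (hs₁ (hmem s hs))).fderiv.fun_comp (hmk s)).clm_eval analyticAt_const
  have hb : AnalyticOnNhd ℝ (fun s => Z (u (q, s))) (ball 0 r) := fun s hs =>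
    (h1 _ (hs₂ (hmem s hs))).fun_comp (f := fun s => u (q, s))
      ((hu _ (hs₁ (hmem s hs))).fun_comp (hmk s))
  refine ha.eqOn_of_preconnected_of_eventuallyEq hb (convex_ball (0 : ℝ) r).isPreconnected
    (mem_ball_self hr0) ?_ ht
  refine hasDerivAt_of_transport hq ?_ (hu.mono hs₁)
    (fun q hq => hu0 q (ball_subset_ball (min_le_left _ _) hq)) fun z hz => htr z (hs₁ hz)
  have := h1 _ (hs₂ (hmem 0 (mem_ball_self hr0)))
  rwa [hu0 q (ball_subset_ball (min_le_left _ _) hq)] at this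

/-- Iterated directional derivatives `Z · (Z · (⋯ (Z · g)))`. -/
def iterLieDeriv (Z : E → E) (g : E → G) : ℕ → E → G
  | 0 => g
  | k + 1 => fun q => fderiv ℝ (iterLieDeriv Z g k) q (Z q)

lemma analyticOnNhd_iterLieDeriv [CompleteSpace G] {Z : E → E} {g : E → G} {W : Set E}
    (hZ : AnalyticOnNhd ℝ Z W) (hg : AnalyticOnNhd ℝ g W) (k : ℕ) :
    AnalyticOnNhd ℝ (iterLieDeriv Z g k) W := by
  induction k with
  | zero => exact hg
  | succ k ih => exact fun q hq => (ih q hq).fderiv.clm_eval (hZ q hq)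

/-- Along an integral curve of `Z`, time derivatives are directional derivatives along `Z`. -/
lemma iteratedDeriv_comp_integralCurve [CompleteSpace G] {Z : E → E} {g : E → G} {W : Set E}
    (hZ : AnalyticOnNhd ℝ Z W) (hg : AnalyticOnNhd ℝ g W) {σ : ℝ → E} {I : Set ℝ} (hI : IsOpen I)
    (hσ : ∀ t ∈ I, HasDerivAt σ (Z (σ t)) t) (hσW : ∀ t ∈ I, σ t ∈ W) (k : ℕ) :
    ∀ t ∈ I, iteratedDeriv k (fun s => g (σ s)) t = iterLieDeriv Z g k (σ t) := by
  induction k with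
  | zero => intro t _; simp [iterLieDeriv]
  | succ k ih =>
    intro t ht
    rw [iteratedDeriv_succ]
    have h1 : iteratedDeriv k (fun s => g (σ s)) =ᶠ[nhds t] fun s => iterLieDeriv Z g k (σ s) :=
      Filter.eventuallyEq_of_mem (hI.mem_nhds ht) ih
    rw [h1.deriv_eq]
    exact ((analyticOnNhd_iterLieDeriv hZ hg k _ (hσW t ht)).differentiableAt.hasFDerivAt
      |>.comp_hasDerivAt t (hσ t ht)).deriv

/-- If `g` vanishes on the regular hypersurface `{φ = 0}`, its differential vanishes on vectors
tangent to the hypersurface. -/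
lemma fderiv_apply_eq_zero_of_tangent [CompleteSpace E] {φ g : E → ℝ} {q v : E}
    (hφ : AnalyticAt ℝ φ q) (hg : AnalyticAt ℝ g q) (hφq : φ q = 0)
    (hdφ : fderiv ℝ φ q ≠ 0) (hv : fderiv ℝ φ q v = 0)
    (hvan : ∀ᶠ x in nhds q, φ x = 0 → g x = 0) : fderiv ℝ g q v = 0 := by
  have hext : IsLocalExtrOn g {x | φ x = φ q} q := by
    refine Or.inl ?_
    filter_upwards [mem_nhdsWithin_of_mem_nhds hvan, self_mem_nhdsWithin] with x hx hxq
    rw [hx (by rw [← hφq]; exact hxq), hvan.self_of_nhds hφq]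
  obtain ⟨a, b, hab, h⟩ := hext.exists_multipliers_of_hasStrictFDerivAt_1d
    hφ.hasStrictFDerivAt hg.hasStrictFDerivAt
  have hb : b ≠ 0 := by
    rintro rfl
    have ha : a ≠ 0 := fun ha => hab (by simp [ha])
    rw [zero_smul, add_zero] at h
    exact hdφ ((smul_eq_zero.1 h).resolve_left ha)
  have h2 := DFunLike.congr_fun h v
  simpa [hv, hb] using h2

/-- Integral curves of an analytic vector field tangent to a regular analytic hypersurface and
starting on the hypersurface stay in it. -/
lemma integralCurve_mem_hypersurface [CompleteSpace E] {φ : E → ℝ} {Z : E → E} {W : Set E}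
    (hW : IsOpen W) (hφ : AnalyticOnNhd ℝ φ W) (hZ : AnalyticOnNhd ℝ Z W)
    (hdφ : ∀ q ∈ W, φ q = 0 → fderiv ℝ φ q ≠ 0)
    (htan : ∀ q ∈ W, φ q = 0 → fderiv ℝ φ q (Z q) = 0) {σ : ℝ → E} {r : ℝ} (hr : 0 < r)
    (hσa : AnalyticOnNhd ℝ σ (ball 0 r)) (hσ : ∀ t ∈ ball (0 : ℝ) r, HasDerivAt σ (Z (σ t)) t)
    (hσW : ∀ t ∈ ball (0 : ℝ) r, σ t ∈ W) (hσ0 : φ (σ 0) = 0) :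
    ∀ t ∈ ball (0 : ℝ) r, φ (σ t) = 0 := by
  have hvan : ∀ k, ∀ q ∈ W, φ q = 0 → iterLieDeriv Z φ k q = 0 := by
    intro k
    induction k with
    | zero => exact fun q _ h => h
    | succ k ih =>
      intro q hq hφq
      exact fderiv_apply_eq_zero_of_tangent (hφ q hq) (analyticOnNhd_iterLieDeriv hZ hφ k q hq) hφq
        (hdφ q hq hφq) (htan q hq hφq) (by
          filter_upwards [hW.mem_nhds hq] with x hx using ih x hx)
  have h0 : (0 : ℝ) ∈ ball (0 : ℝ) r := mem_ball_self hr
  have ha : AnalyticOnNhd ℝ (fun t => φ (σ t)) (ball 0 r) := fun t ht =>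
    (hφ _ (hσW t ht)).fun_comp (hσa t ht)
  have htop : analyticOrderAt (fun t => φ (σ t)) 0 = ⊤ := by
    refine ENat.eq_top_iff_forall_ge.2 fun n => ?_
    refine (natCast_le_analyticOrderAt_iff_iteratedDeriv_eq_zero (ha 0 h0)).2 fun i _ => ?_
    rw [iteratedDeriv_comp_integralCurve hZ hφ isOpen_ball hσ hσW i 0 h0]
    exact hvan i _ (hσW 0 h0) hσ0
  exact ha.eqOn_zero_of_preconnected_of_eventuallyEq_zero (convex_ball (0 : ℝ) r).isPreconnected
    h0 (analyticOrderAt_eq_top.1 htop)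

section LieSpan

variable {J : F → F →L[ℝ] F} {X : F → F} {U : Set F}

lemma lieVF_congr (hU : IsOpen U) {f f' g g' : F → F} (hf : Set.EqOn f f' U)
    (hg : Set.EqOn g g' U) : Set.EqOn (lieVF f g) (lieVF f' g') U := by
  intro q hq
  have h1 : f =ᶠ[nhds q] f' := Filter.eventuallyEq_of_mem (hU.mem_nhds hq) hf
  have h2 : g =ᶠ[nhds q] g' := Filter.eventuallyEq_of_mem (hU.mem_nhds hq) hg
  simp only [lieVF, h1.fderiv_eq, h2.fderiv_eq, hf hq, hg hq]

lemma LieGen.analyticOnNhd [CompleteSpace F] (hJ : AnalyticOnNhd ℝ J U)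
    (hX : AnalyticOnNhd ℝ X U) {W : F → F} (hW : LieGen J X W) : AnalyticOnNhd ℝ W U := by
  induction hW with
  | base => exact hX
  | jmul _ ih => exact fun q hq => (hJ q hq).clm_eval (ih q hq)
  | bracket _ _ ih₁ ih₂ =>
    exact fun q hq => ((ih₂ q hq).fderiv.clm_eval (ih₁ q hq)).sub
      ((ih₁ q hq).fderiv.clm_eval (ih₂ q hq))

/-- The real span of the vector fields generated by `X` under `J` and Lie brackets. -/
def lieSpan (J : F → F →L[ℝ] F) (X : F → F) : Submodule ℝ (F → F) :=
  Submodule.span ℝ {W | LieGen J X W}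

lemma analyticOnNhd_of_mem_lieSpan [CompleteSpace F] (hJ : AnalyticOnNhd ℝ J U)
    (hX : AnalyticOnNhd ℝ X U) {f : F → F} (hf : f ∈ lieSpan J X) : AnalyticOnNhd ℝ f U := by
  induction hf using Submodule.span_induction with
  | mem W hW => exact LieGen.analyticOnNhd hJ hX hW
  | zero => exact fun q _ => analyticAt_const
  | add f g _ _ hf hg => exact hf.add hg
  | smul a f _ hf => exact fun q hq => analyticAt_const.smul (hf q hq)

lemma Jvf_mem_lieSpan {f : F → F} (hf : f ∈ lieSpan J X) : Jvf J f ∈ lieSpan J X := by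
  induction hf using Submodule.span_induction with
  | mem W hW => exact Submodule.subset_span hW.jmul
  | zero =>
    convert (lieSpan J X).zero_mem using 1
    funext q; simp [Jvf]
  | add f g _ _ hf hg =>
    convert (lieSpan J X).add_mem hf hg using 1
    funext q; simp [Jvf]
  | smul a f _ hf =>
    convert (lieSpan J X).smul_mem a hf using 1
    funext q; simp [Jvf]

lemma exists_lieVF_eqOn [CompleteSpace F] (hJ : AnalyticOnNhd ℝ J U) (hX : AnalyticOnNhd ℝ X U)
    {f g : F → F} (hf : f ∈ lieSpan J X) (hg : g ∈ lieSpan J X) :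
    ∃ h ∈ lieSpan J X, Set.EqOn (lieVF f g) h U := by
  have hd : ∀ {f}, f ∈ lieSpan J X → ∀ q ∈ U, DifferentiableAt ℝ f q := fun hf q hq =>
    (analyticOnNhd_of_mem_lieSpan hJ hX hf q hq).differentiableAt
  induction hf, hg using Submodule.span_induction₂ with
  | mem_mem V W hV hW => exact ⟨_, Submodule.subset_span (hV.bracket hW), fun _ _ => rfl⟩
  | zero_left g _ =>
    refine ⟨0, zero_mem _, fun q _ => ?_⟩
    simp [lieVF]
  | zero_right f _ =>
    refine ⟨0, zero_mem _, fun q _ => ?_⟩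
    simp [lieVF]
  | add_left f₁ f₂ g hf₁ hf₂ hg h₁ h₂ =>
    obtain ⟨k₁, hk₁, e₁⟩ := h₁
    obtain ⟨k₂, hk₂, e₂⟩ := h₂
    refine ⟨k₁ + k₂, add_mem hk₁ hk₂, fun q hq => ?_⟩
    rw [Pi.add_apply, ← e₁ hq, ← e₂ hq]
    simp only [lieVF, fderiv_add (hd hf₁ q hq) (hd hf₂ q hq), Pi.add_apply, map_add, add_apply]
    abel
  | add_right f g₁ g₂ hf hg₁ hg₂ h₁ h₂ =>
    obtain ⟨k₁, hk₁, e₁⟩ := h₁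
    obtain ⟨k₂, hk₂, e₂⟩ := h₂
    refine ⟨k₁ + k₂, add_mem hk₁ hk₂, fun q hq => ?_⟩
    rw [Pi.add_apply, ← e₁ hq, ← e₂ hq]
    simp only [lieVF, fderiv_add (hd hg₁ q hq) (hd hg₂ q hq), Pi.add_apply, map_add, add_apply]
    abel
  | smul_left a f g hf hg h =>
    obtain ⟨k, hk, e⟩ := h
    refine ⟨a • k, Submodule.smul_mem _ _ hk, fun q hq => ?_⟩
    rw [Pi.smul_apply, ← e hq]
    simp only [lieVF, fderiv_const_smul (hd hf q hq), Pi.smul_apply, map_smul, smul_apply, smul_sub]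
  | smul_right a f g hf hg h =>
    obtain ⟨k, hk, e⟩ := h
    refine ⟨a • k, Submodule.smul_mem _ _ hk, fun q hq => ?_⟩
    rw [Pi.smul_apply, ← e hq]
    simp only [lieVF, fderiv_const_smul (hd hg q hq), Pi.smul_apply, map_smul, smul_apply, smul_sub]

lemma apply_eq_zero_of_mem_lieSpan {f : F → F} (hf : f ∈ lieSpan J X) {q : F} {ℓ : F →L[ℝ] ℝ}
    (hℓ : ∀ W, LieGen J X W → ℓ (W q) = 0) : ℓ (f q) = 0 := by
  induction hf using Submodule.span_induction with
  | mem W hW => exact hℓ W hW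
  | zero => simp
  | add f g _ _ hf hg => simp [hf, hg]
  | smul a f _ hf => simp [hf]

/-- The bilinear operator `((x, y), (A, B)) ↦ (B x - A y, J(q) (B x - A y))`. -/
def bracketOp (J : F → F →L[ℝ] F) (q : F) : F × F →L[ℝ] (F →L[ℝ] F × F) →L[ℝ] F × F :=
  (ContinuousLinearMap.compL ℝ (F →L[ℝ] F × F) F (F × F)
    (.inl ℝ F F + (ContinuousLinearMap.inr ℝ F F).comp (J q))).comp
  ((ContinuousLinearMap.compL ℝ (F →L[ℝ] F × F) (F × F) F (.snd ℝ F F)).comp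
      ((ContinuousLinearMap.apply ℝ (F × F)).comp (.fst ℝ F F)) -
    (ContinuousLinearMap.compL ℝ (F →L[ℝ] F × F) (F × F) F (.fst ℝ F F)).comp
      ((ContinuousLinearMap.apply ℝ (F × F)).comp (.snd ℝ F F)))

lemma bracketOp_apply (J : F → F →L[ℝ] F) (q : F) (x : F × F) (A : F →L[ℝ] F × F) :
    bracketOp J q x A = ((A x.1).2 - (A x.2).1, J q ((A x.1).2 - (A x.2).1)) := by
  simp [bracketOp]

lemma AnalyticAt.bracketOp {q : F} (hJ : AnalyticAt ℝ J q) : AnalyticAt ℝ (bracketOp J) q := by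
  have h1 : AnalyticAt ℝ
      (fun q => ContinuousLinearMap.inl ℝ F F + (ContinuousLinearMap.inr ℝ F F).comp (J q)) q :=
    analyticAt_const.add ((ContinuousLinearMap.compL ℝ F F (F × F)
      (ContinuousLinearMap.inr ℝ F F)).analyticAt _ |>.fun_comp hJ)
  have h2 := (ContinuousLinearMap.compL ℝ (F →L[ℝ] F × F) F (F × F)).analyticAt _ |>.fun_comp h1
  exact ((ContinuousLinearMap.compL ℝ (F × F) ((F →L[ℝ] F × F) →L[ℝ] F)
    ((F →L[ℝ] F × F) →L[ℝ] F × F)).analyticAt _ |>.fun_comp h2).clm_eval analyticAt_const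

lemma snd_evolCoeff_bracketOp (k : ℕ) (q : F) :
    (evolCoeff (bracketOp J) (fun q => (X q, J q (X q))) k q).2 =
      J q (evolCoeff (bracketOp J) (fun q => (X q, J q (X q))) k q).1 := by
  rcases k with _ | k
  · simp [evolCoeff_zero]
  · simp [evolCoeff_succ, bracketOp_apply, Prod.fst_sum, Prod.snd_sum]

lemma exists_fst_evolCoeff_eqOn [CompleteSpace F] (hU : IsOpen U) (hJ : AnalyticOnNhd ℝ J U)
    (hX : AnalyticOnNhd ℝ X U) (k : ℕ) : ∃ h ∈ lieSpan J X,
      Set.EqOn (fun q => (evolCoeff (bracketOp J) (fun q => (X q, J q (X q))) k q).1) h U := by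
  set a := evolCoeff (bracketOp J) (fun q => (X q, J q (X q))) with ha
  have haa : ∀ k, AnalyticOnNhd ℝ (a k) U := fun k =>
    analyticOnNhd_evolCoeff (fun q hq => (hJ q hq).bracketOp)
      (fun q hq => (hX q hq).prod ((hJ q hq).clm_eval (hX q hq))) k
  induction k using Nat.strong_induction_on with
  | _ k ih =>
    rcases k with _ | k
    · exact ⟨X, Submodule.subset_span .base, fun q _ => by simp [ha, evolCoeff_zero]⟩
    · have hterm : ∀ x : ℕ × ℕ, ∃ h ∈ lieSpan J X, x ∈ Finset.HasAntidiagonal.antidiagonal k →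
          Set.EqOn (lieVF (fun q => (a x.1 q).1) (fun q => (a x.2 q).2)) h U := by
        intro x
        by_cases hx : x ∈ Finset.HasAntidiagonal.antidiagonal k
        · have hx' := Finset.HasAntidiagonal.mem_antidiagonal.1 hx
          obtain ⟨f, hf, e₁⟩ := ih x.1 (by omega)
          obtain ⟨g, hg, e₂⟩ := ih x.2 (by omega)
          obtain ⟨h, hh, e₃⟩ := exists_lieVF_eqOn hJ hX hf (Jvf_mem_lieSpan hg)
          refine ⟨h, hh, fun _ => (lieVF_congr hU e₁ fun q hq => ?_).trans e₃⟩
          have := e₂ hq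
          simp only at this
          rw [ha, snd_evolCoeff_bracketOp, ← ha, this]
          rfl
        · exact ⟨0, zero_mem _, fun h => absurd h hx⟩
      choose h hh e using hterm
      refine ⟨((k : ℝ) + 1)⁻¹ • ∑ x ∈ Finset.HasAntidiagonal.antidiagonal k, h x,
        Submodule.smul_mem _ _ (Submodule.sum_mem _ fun x _ => hh x), fun q hq => ?_⟩
      have hfst : ∀ j, fderiv ℝ (fun q => (a j q).1) q =
          (ContinuousLinearMap.fst ℝ F F).comp (fderiv ℝ (a j) q) := fun j =>
        (hasFDerivAt_fst.comp q (haa j q hq).differentiableAt.hasFDerivAt).fderiv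
      have hsnd : ∀ j, fderiv ℝ (fun q => (a j q).2) q =
          (ContinuousLinearMap.snd ℝ F F).comp (fderiv ℝ (a j) q) := fun j =>
        (hasFDerivAt_snd.comp q (haa j q hq).differentiableAt.hasFDerivAt).fderiv
      have h1 : ∑ x ∈ Finset.HasAntidiagonal.antidiagonal k, h x q =
          ∑ x ∈ Finset.HasAntidiagonal.antidiagonal k,
            ((fderiv ℝ (a x.2) q (a x.1 q).1).2 - (fderiv ℝ (a x.1) q (a x.2 q).2).1) := by
        refine Finset.sum_congr rfl fun x hx => ?_
        rw [← e x hx hq]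
        simp [lieVF, hfst, hsnd]
      have h2 : ∑ x ∈ Finset.HasAntidiagonal.antidiagonal k,
            (fderiv ℝ (a x.1) q (a x.2 q).2).1 = ∑ x ∈ Finset.HasAntidiagonal.antidiagonal k,
            (fderiv ℝ (a x.2) q (a x.1 q).2).1 :=
        Finset.Nat.sum_antidiagonal_swap (f := fun x => (fderiv ℝ (a x.2) q (a x.1 q).2).1)
      rw [Finset.sum_sub_distrib, h2] at h1
      simp only [Pi.smul_apply, Finset.sum_apply, h1]
      simp [ha, evolCoeff_succ, bracketOp_apply, Prod.fst_sum]

/-- A vector field `X` extends to an analytic family `Ξ(⋅, t)` such that `(Ξ, 0)` commutes with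
`(J Ξ, 1)`, and `J Ξ` stays in the span of the Lie algebra generated by `X`. -/
theorem exists_commuting_extension [CompleteSpace F] (hU : IsOpen U) (hJ : AnalyticOnNhd ℝ J U)
    (hX : AnalyticOnNhd ℝ X U) {p : F} (hp : p ∈ U) :
    ∃ r > 0, ball p r ⊆ U ∧ ∃ Ξ Y : F × ℝ → F,
      AnalyticOnNhd ℝ Ξ (ball (p, 0) r) ∧ AnalyticOnNhd ℝ Y (ball (p, 0) r) ∧
      (∀ z ∈ ball (p, (0 : ℝ)) r, Y z = J z.1 (Ξ z)) ∧
      (∀ q ∈ ball p r, Ξ (q, 0) = X q) ∧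
      (∀ z ∈ ball (p, (0 : ℝ)) r,
        fderiv ℝ Ξ z (0, 1) = fderiv ℝ Y z (Ξ z, 0) - fderiv ℝ Ξ z (Y z, 0)) ∧
      ∀ z ∈ ball (p, (0 : ℝ)) r, ∀ ℓ : F →L[ℝ] ℝ, (∀ W, LieGen J X W → ℓ (W z.1) = 0) →
        ℓ (Y z) = 0 := by
  obtain ⟨r₁, hr₁, S, hS, hsum, hpde⟩ := exists_analytic_evolution (T := bracketOp J)
    (u₀ := fun q => (X q, J q (X q))) (hJ p hp).bracketOp
    ((hX p hp).prod ((hJ p hp).clm_eval (hX p hp)))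
  obtain ⟨r₂, hr₂, hrU⟩ := Metric.isOpen_iff.1 hU p hp
  set r := min r₁ r₂ with hr
  have hsub : ball (p, (0 : ℝ)) r ⊆ ball (p, 0) r₁ := ball_subset_ball (min_le_left _ _)
  have hsubU : ball p r ⊆ U := (ball_subset_ball (min_le_right _ _)).trans hrU
  have hr0 : 0 < r := lt_min hr₁ hr₂
  have hd1 : ∀ z ∈ ball (p, (0 : ℝ)) r, fderiv ℝ (fun z => (S z).1) z =
      (ContinuousLinearMap.fst ℝ F F).comp (fderiv ℝ S z) := fun z hz =>
    (hasFDerivAt_fst.comp z (hS z (hsub hz)).differentiableAt.hasFDerivAt).fderiv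
  have hd2 : ∀ z ∈ ball (p, (0 : ℝ)) r, fderiv ℝ (fun z => (S z).2) z =
      (ContinuousLinearMap.snd ℝ F F).comp (fderiv ℝ S z) := fun z hz =>
    (hasFDerivAt_snd.comp z (hS z (hsub hz)).differentiableAt.hasFDerivAt).fderiv
  refine ⟨r, hr0, hsubU, fun z => (S z).1, fun z => (S z).2,
    fun z hz => analyticAt_fst.comp (hS z (hsub hz)),
    fun z hz => analyticAt_snd.comp (hS z (hsub hz)), fun z hz => ?_, fun q hq => ?_,
    fun z hz => ?_, fun z hz ℓ hℓ => ?_⟩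
  · have h1 := (ContinuousLinearMap.snd ℝ F F).hasSum (hsum z (hsub hz))
    have h2 := ((J z.1).comp (ContinuousLinearMap.fst ℝ F F)).hasSum (hsum z (hsub hz))
    refine h1.unique ?_
    convert h2 using 1
    · funext k
      simp [snd_evolCoeff_bracketOp]
    · rfl
  · have h1 := (ContinuousLinearMap.fst ℝ F F).hasSum
      (hsum (q, 0) (hsub (mem_ball_prod_zero.2 ⟨hq, mem_ball_self hr0⟩)))
    refine h1.unique ?_
    convert hasSum_ite_eq (0 : ℕ) (X q) using 1
    funext k
    rcases k with _ | k
    · simp [evolCoeff_zero]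
    · simp
  · rw [hd1 z hz, hd2 z hz]
    simp [hpde z (hsub hz), bracketOp_apply]
  · have h1 := (ℓ.comp (ContinuousLinearMap.snd ℝ F F)).hasSum (hsum z (hsub hz))
    refine h1.unique ?_
    convert hasSum_zero using 1
    funext k
    obtain ⟨h, hh, e⟩ := exists_fst_evolCoeff_eqOn hU hJ hX k
    have h2 := e (hsubU (mem_ball_prod_zero.1 hz).1)
    simp only at h2
    have h3 := apply_eq_zero_of_mem_lieSpan (Jvf_mem_lieSpan hh) hℓ
    simp only [Jvf] at h3
    simp [snd_evolCoeff_bracketOp, h2, h3]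

end LieSpan

/-- Flowing out an integral curve of `Z₁` along a vector field `Z₂` that commutes with `Z₁` gives
a surface whose coordinate vector fields are `Z₁` and `Z₂`. -/
theorem exists_analytic_integralSurface [CompleteSpace E] {Z₁ Z₂ : E → E} {z₀ : E}
    (hZ₁ : AnalyticAt ℝ Z₁ z₀) (hZ₂ : AnalyticAt ℝ Z₂ z₀)
    (hcomm : ∀ᶠ z in nhds z₀, fderiv ℝ Z₂ z (Z₁ z) = fderiv ℝ Z₁ z (Z₂ z)) {σ : ℝ → E}
    (hσa : AnalyticAt ℝ σ 0) (hσ₀ : σ 0 = z₀)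
    (hσ : ∀ᶠ t in nhds 0, HasDerivAt σ (Z₁ (σ t)) t) :
    ∃ ρ > 0, ∃ Γ : ℝ × ℝ → E, AnalyticOnNhd ℝ Γ (ball 0 ρ) ∧
      (∀ x ∈ ball (0 : ℝ) ρ, Γ (x, 0) = σ x) ∧
      ∀ w ∈ ball (0 : ℝ × ℝ) ρ,
        fderiv ℝ Γ w (1, 0) = Z₁ (Γ w) ∧ fderiv ℝ Γ w (0, 1) = Z₂ (Γ w) := by
  obtain ⟨r, hr, u, hu, hu₀, hflow⟩ := exists_analytic_flow hZ₂
  set Γ : ℝ × ℝ → E := fun w => u (σ w.1, w.2) with hΓ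
  have hιa : AnalyticAt ℝ (fun w : ℝ × ℝ => (σ w.1, w.2)) 0 :=
    (AnalyticAt.fun_comp (f := fun w : ℝ × ℝ => w.1) hσa analyticAt_fst).prod analyticAt_snd
  have hι₀ : (σ (0 : ℝ × ℝ).1, (0 : ℝ × ℝ).2) = (z₀, (0 : ℝ)) := by simp [hσ₀]
  have hΓa : AnalyticAt ℝ Γ 0 :=
    AnalyticAt.fun_comp (f := fun w : ℝ × ℝ => (σ w.1, w.2))
      (by rw [hι₀]; exact hu _ (mem_ball_self hr)) hιa
  have hΓ₀ : Γ 0 = z₀ := by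
    simp only [hΓ, hι₀]
    exact hu₀ _ (mem_ball_self hr)
  have hΓt : Filter.Tendsto Γ (nhds 0) (nhds z₀) := by
    simpa [hΓ₀] using hΓa.continuousAt.tendsto
  have hιt : ∀ᶠ w : ℝ × ℝ in nhds 0, (σ w.1, w.2) ∈ ball (z₀, (0 : ℝ)) r :=
    hιa.continuousAt.tendsto.eventually (by
      rw [hι₀]
      exact ball_mem_nhds _ hr)
  have hσt : ∀ᶠ w : ℝ × ℝ in nhds 0, HasDerivAt σ (Z₁ (σ w.1)) w.1 :=
    (continuous_fst.tendsto (0 : ℝ × ℝ)).eventually hσ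
  have hev := hΓa.eventually_analyticAt.and <|
    (hΓt.eventually (hZ₁.eventually_analyticAt.and (hZ₂.eventually_analyticAt.and (hcomm.and
      (hZ₂.fderiv.continuousAt.norm.eventually (gt_mem_nhds (lt_add_one _))))))).and <|
    hιt.and hσt
  obtain ⟨ρ, hρ, H⟩ := Metric.eventually_nhds_iff_ball.1 hev
  have hmk : ∀ {x y : ℝ}, (x, y) ∈ ball (0 : ℝ × ℝ) ρ ↔ x ∈ ball (0 : ℝ) ρ ∧ y ∈ ball (0 : ℝ) ρ :=
    fun {x y} => mem_ball_prod_zero (p := (0 : ℝ)) (z := (x, y))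
  have hcurve : ∀ x ∈ ball (0 : ℝ) ρ, Γ (x, 0) = σ x := fun x hx =>
    hu₀ _ (mem_ball_prod_zero.1 (H _ (hmk.2 ⟨hx, mem_ball_self hρ⟩)).2.2.1).1
  have hdy : ∀ w ∈ ball (0 : ℝ × ℝ) ρ, fderiv ℝ Γ w (0, 1) = Z₂ (Γ w) := by
    rintro ⟨x, y⟩ hw
    have h1 := (H _ hw).1.differentiableAt.hasFDerivAt.hasDerivAt_snd
    have hm := (H _ hw).2.2.1
    have h2 := (hu _ hm).differentiableAt.hasFDerivAt.hasDerivAt_snd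
    exact (h1.unique h2).trans (hflow _ hm).2
  refine ⟨ρ, hρ, Γ, fun w hw => (H w hw).1, hcurve, fun w hw => ⟨?_, hdy w hw⟩⟩
  obtain ⟨x, y⟩ := w
  obtain ⟨hx, hy⟩ := hmk.1 hw
  have hder : ∀ t ∈ ball (0 : ℝ) ρ,
      HasDerivAt (fun t => fderiv ℝ Γ (x, t) (1, 0) - Z₁ (Γ (x, t)))
        (fderiv ℝ Z₂ (Γ (x, t)) (fderiv ℝ Γ (x, t) (1, 0) - Z₁ (Γ (x, t)))) t := by
    intro t ht
    have hw := hmk.2 ⟨hx, ht⟩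
    obtain ⟨hΓw, ⟨hZ₁w, hZ₂w, hc, -⟩, -⟩ := H _ hw
    have hd := hΓw.differentiableAt.hasFDerivAt
    have hd2 := hΓw.fderiv.differentiableAt.hasFDerivAt
    have h1 := ((hd2.clm_apply (hasFDerivAt_const ((1 : ℝ), (0 : ℝ)) (x, t))).sub
      (hZ₁w.differentiableAt.hasFDerivAt.comp (x, t) hd)).hasDerivAt_snd
    have h2 : HasFDerivAt (fun w => fderiv ℝ Γ w ((0 : ℝ), (1 : ℝ)))
        ((fderiv ℝ Z₂ (Γ (x, t))).comp (fderiv ℝ Γ (x, t))) (x, t) :=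
      (hZ₂w.differentiableAt.hasFDerivAt.comp (x, t) hd).congr_of_eventuallyEq <|
        Filter.eventuallyEq_of_mem (isOpen_ball.mem_nhds hw) hdy
    have h3 := h2.unique (hd2.clm_apply (hasFDerivAt_const ((0 : ℝ), (1 : ℝ)) (x, t)))
    have h4 : fderiv ℝ Z₂ (Γ (x, t)) (fderiv ℝ Γ (x, t) (1, 0)) =
        fderiv ℝ Γ (x, t) 0 + fderiv ℝ (fderiv ℝ Γ) (x, t) (1, 0) (0, 1) :=
      DFunLike.congr_fun h3 ((1 : ℝ), (0 : ℝ))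
    have h5 := (hΓw.contDiffAt (n := 2)).isSymmSndFDerivAt (by simp) (0, 1) (1, 0)
    refine HasDerivAt.congr_deriv (f' := _) h1 (Eq.symm ?_)
    change _ = fderiv ℝ Γ (x, t) 0 + fderiv ℝ (fderiv ℝ Γ) (x, t) (0, 1) (1, 0) -
      fderiv ℝ Z₁ (Γ (x, t)) (fderiv ℝ Γ (x, t) (0, 1))
    rw [h5, ← h4, hdy _ hw, map_sub, hc]
  have h0 : fderiv ℝ Γ (x, 0) (1, 0) - Z₁ (Γ (x, 0)) = 0 := by
    have hw := hmk.2 ⟨hx, mem_ball_self hρ⟩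
    obtain ⟨hΓw, -, -, hσx⟩ := H _ hw
    have h1 : HasDerivAt (fun s => Γ (s, 0)) (fderiv ℝ Γ (x, 0) (1, 0)) x :=
      hΓw.differentiableAt.hasFDerivAt.comp_hasDerivAt (f := fun s : ℝ => (s, (0 : ℝ))) x
        ((hasDerivAt_id x).prodMk (hasDerivAt_const x (0 : ℝ)))
    have h2 := h1.congr_of_eventuallyEq (f₁ := σ) <|
      Filter.eventuallyEq_of_mem (isOpen_ball.mem_nhds hx) fun s hs => (hcurve s hs).symm
    rw [hcurve x hx, h2.unique hσx, sub_self]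
  have huniq := ODE_solution_unique_of_mem_Ioo (E := E)
    (v := fun t m => fderiv ℝ Z₂ (Γ (x, t)) m) (s := fun _ => Set.univ)
    (K := ‖fderiv ℝ Z₂ z₀‖₊ + 1) (a := -ρ) (b := ρ) (t₀ := 0)
    (f := fun t => fderiv ℝ Γ (x, t) (1, 0) - Z₁ (Γ (x, t))) (g := fun _ => 0)
    (fun t ht => ((fderiv ℝ Z₂ (Γ (x, t))).lipschitz.weaken ?_).lipschitzOnWith)
    ⟨by linarith, hρ⟩ (fun t ht => ⟨hder t ?_, trivial⟩)
    (fun t ht => ⟨by simpa using hasDerivAt_const t (0 : E), trivial⟩) h0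
  · exact sub_eq_zero.1 (huniq (show y ∈ Set.Ioo (-ρ) ρ by simpa [Real.ball_eq_Ioo] using hy))
  · have := (H _ (hmk.2 ⟨hx, show t ∈ ball 0 ρ by simpa [Real.ball_eq_Ioo] using ht⟩)).2.1.2.2.2
    exact_mod_cast this.le
  · simpa [Real.ball_eq_Ioo] using ht

lemma iterLieDeriv_eq_DX (X Y : F → F) (k : ℕ) : iterLieDeriv X Y k = DX X Y k := by
  induction k with
  | zero => rfl
  | succ k ih =>
    simp only [iterLieDeriv, DX, ih]
    rfl

/-- A surface in `F` whose coordinate fields are `ξ` and `J ξ` is a `J`-holomorphic disc. -/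
lemma jHolOn_of_coordinateFields {J : F → F →L[ℝ] F} {Γ : ℝ × ℝ → F} {ξ : ℝ × ℝ → F} {D : Set ℂ}
    (hΓ : ∀ ζ ∈ D, DifferentiableAt ℝ Γ (ζ.re, ζ.im))
    (hJ : ∀ ζ ∈ D, (J (Γ (ζ.re, ζ.im))).comp (J (Γ (ζ.re, ζ.im))) = -ContinuousLinearMap.id ℝ F)
    (hx : ∀ ζ ∈ D, fderiv ℝ Γ (ζ.re, ζ.im) (1, 0) = ξ (ζ.re, ζ.im))
    (hy : ∀ ζ ∈ D, fderiv ℝ Γ (ζ.re, ζ.im) (0, 1) = J (Γ (ζ.re, ζ.im)) (ξ (ζ.re, ζ.im))) :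
    JHolOn J D fun ζ => Γ (ζ.re, ζ.im) := by
  intro ζ hζ v
  have hd : ∀ v : ℂ, fderiv ℝ (fun ζ : ℂ => Γ (ζ.re, ζ.im)) ζ v =
      v.re • ξ (ζ.re, ζ.im) + v.im • J (Γ (ζ.re, ζ.im)) (ξ (ζ.re, ζ.im)) := by
    intro v
    have h := HasFDerivAt.comp (f := fun ζ : ℂ => (ζ.re, ζ.im)) ζ (hΓ ζ hζ).hasFDerivAt
      (Complex.reCLM.hasFDerivAt.prodMk Complex.imCLM.hasFDerivAt)
    have hv : ((v.re, v.im) : ℝ × ℝ) = v.re • (1, 0) + v.im • (0, 1) := by simp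
    refine (DFunLike.congr_fun h.fderiv v).trans ?_
    change fderiv ℝ Γ (ζ.re, ζ.im) (v.re, v.im) = _
    rw [hv, map_add, map_smul, map_smul, hx ζ hζ, hy ζ hζ]
  have hJJ : J (Γ (ζ.re, ζ.im)) (J (Γ (ζ.re, ζ.im)) (ξ (ζ.re, ζ.im))) = -ξ (ζ.re, ζ.im) :=
    DFunLike.congr_fun (hJ ζ hζ) (ξ (ζ.re, ζ.im))
  rw [hd, hd, map_add, map_smul, map_smul, hJJ]
  simp
  abel

/-- Through every point of `{φ = 0}` there is an analytic `J`-holomorphic disc in `{φ = 0}` that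
restricts to the integral curve of `X` on the real axis. -/
theorem exists_jHolomorphic_disc [CompleteSpace F] {U : Set F} (hU : IsOpen U)
    {J : F → F →L[ℝ] F} (hJ : AnalyticOnNhd ℝ J U)
    (hJsq : ∀ x ∈ U, (J x).comp (J x) = -ContinuousLinearMap.id ℝ F)
    {φ : F → ℝ} (hφ : AnalyticOnNhd ℝ φ U) (hdφ : ∀ q ∈ U, φ q = 0 → fderiv ℝ φ q ≠ 0)
    {X : F → F} (hX : AnalyticOnNhd ℝ X U) (hLie : ∀ Y, LieGen J X Y → InTJM J φ U Y)
    {p : F} (hp : p ∈ U) (hφp : φ p = 0) :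
    ∃ ρ > (0 : ℝ), ∃ γ : ℂ → F, AnalyticOnNhd ℝ γ (ball 0 ρ) ∧ JHolOn J (ball 0 ρ) γ ∧ γ 0 = p ∧
      (∀ ζ ∈ ball (0 : ℂ) ρ, γ ζ ∈ U ∧ φ (γ ζ) = 0) ∧
      ∀ t ∈ ball (0 : ℝ) ρ, HasDerivAt (fun t : ℝ => γ t) (X (γ t)) t := by
  obtain ⟨r, hr, hrU, Ξ, Y, hΞ, hY, hYΞ, hΞX, hcomm, hYtan⟩ :=
    exists_commuting_extension hU hJ hX hp
  obtain ⟨s, hs, u, hu, hu₀, huX⟩ := exists_analytic_flow (hX p hp)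
  set σ : ℝ → F × ℝ := fun x => (u (p, x), 0) with hσ_def
  have hσ₀ : σ 0 = (p, 0) := by simp [hσ_def, hu₀ p (mem_ball_self hs)]
  have hus : ∀ {x : ℝ}, x ∈ ball (0 : ℝ) s → (p, x) ∈ ball (p, (0 : ℝ)) s := fun hx =>
    mem_ball_prod_zero.2 ⟨mem_ball_self hs, hx⟩
  have hua : AnalyticOnNhd ℝ (fun x => u (p, x)) (ball 0 s) := fun x hx =>
    AnalyticAt.fun_comp (f := fun x : ℝ => (p, x)) (hu _ (hus hx))
      (analyticAt_const.prod analyticAt_id)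
  have hu' : ∀ x ∈ ball (0 : ℝ) s, HasDerivAt (fun x => u (p, x)) (X (u (p, x))) x := fun x hx => by
    rw [← (huX _ (hus hx)).2]
    exact (hu _ (hus hx)).differentiableAt.hasFDerivAt.hasDerivAt_snd
  have hσa : AnalyticAt ℝ σ 0 := (hua 0 (mem_ball_self hs)).prod analyticAt_const
  have hσr : ∀ᶠ x in nhds 0, σ x ∈ ball (p, (0 : ℝ)) r :=
    hσa.continuousAt.tendsto.eventually (by
      rw [hσ₀]
      exact ball_mem_nhds _ hr)
  have hσ : ∀ᶠ x in nhds 0, HasDerivAt σ (Ξ (σ x), 0) x := by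
    filter_upwards [hσr, ball_mem_nhds 0 hs] with x hx hxs
    rw [hΞX _ (mem_ball_prod_zero.1 hx).1]
    exact (hu' x hxs).prodMk (hasDerivAt_const x 0)
  have hpr : (p, (0 : ℝ)) ∈ ball (p, (0 : ℝ)) r := mem_ball_self hr
  have hZ₁ : AnalyticOnNhd ℝ (fun z => (Ξ z, (0 : ℝ))) (ball (p, 0) r) := fun z hz =>
    (hΞ z hz).prod analyticAt_const
  have hZ₂ : AnalyticOnNhd ℝ (fun z => (Y z, (1 : ℝ))) (ball (p, 0) r) := fun z hz =>
    (hY z hz).prod analyticAt_const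
  obtain ⟨ρ₁, hρ₁, Γ, hΓ, hΓσ, hΓ'⟩ := exists_analytic_integralSurface (hZ₁ _ hpr) (hZ₂ _ hpr) (by
    filter_upwards [ball_mem_nhds _ hr] with z hz
    have h1 := ((hY z hz).differentiableAt.hasFDerivAt.prodMk (hasFDerivAt_const (1 : ℝ) z)).fderiv
    have h2 := ((hΞ z hz).differentiableAt.hasFDerivAt.prodMk (hasFDerivAt_const (0 : ℝ) z)).fderiv
    rw [h1, h2]
    have h3 : (Y z, (1 : ℝ)) = (Y z, 0) + (0, 1) := by simp
    change (fderiv ℝ Y z (Ξ z, 0), (0 : ℝ)) = (fderiv ℝ Ξ z (Y z, 1), (0 : ℝ))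
    rw [h3, map_add, hcomm z hz]
    simp) hσa hσ₀ hσ
  have hΓ₀ : Γ 0 = (p, 0) := (hΓσ 0 (mem_ball_self hρ₁)).trans hσ₀
  have hΓr : ∀ᶠ w in nhds 0, Γ w ∈ ball (p, (0 : ℝ)) r :=
    (hΓ 0 (mem_ball_self hρ₁)).continuousAt.tendsto.eventually (by
      rw [hΓ₀]
      exact ball_mem_nhds _ hr)
  obtain ⟨ρ₂, hρ₂, hball⟩ := Metric.eventually_nhds_iff_ball.1 hΓr
  set ρ := min (min ρ₁ ρ₂) s with hρ_def
  have hρ : 0 < ρ := lt_min (lt_min hρ₁ hρ₂) hs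
  have hmk : ∀ {x y : ℝ}, x ∈ ball (0 : ℝ) ρ → y ∈ ball (0 : ℝ) ρ → (x, y) ∈ ball (0 : ℝ × ℝ) ρ :=
    fun hx hy => mem_ball_prod_zero.2 ⟨hx, hy⟩
  replace hΓ : AnalyticOnNhd ℝ Γ (ball 0 ρ) :=
    hΓ.mono (ball_subset_ball ((min_le_left _ _).trans (min_le_left _ _)))
  replace hΓ' : ∀ w ∈ ball (0 : ℝ × ℝ) ρ, _ := fun w hw =>
    hΓ' w (ball_subset_ball ((min_le_left _ _).trans (min_le_left _ _)) hw)
  replace hΓσ : ∀ x ∈ ball (0 : ℝ) ρ, Γ (x, 0) = σ x := fun x hx =>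
    hΓσ x (ball_subset_ball ((min_le_left _ _).trans (min_le_left _ _)) hx)
  replace hball : ∀ w ∈ ball (0 : ℝ × ℝ) ρ, Γ w ∈ ball (p, (0 : ℝ)) r := fun w hw =>
    hball w (ball_subset_ball ((min_le_left _ _).trans (min_le_right _ _)) hw)
  have hρs : ball (0 : ℝ) ρ ⊆ ball 0 s := ball_subset_ball (min_le_right _ _)
  have hΓU : ∀ w ∈ ball (0 : ℝ × ℝ) ρ, (Γ w).1 ∈ U := fun w hw =>
    hrU (mem_ball_prod_zero.1 (hball w hw)).1
  have hreim : ∀ ζ ∈ ball (0 : ℂ) ρ, ζ.re ∈ ball (0 : ℝ) ρ ∧ ζ.im ∈ ball (0 : ℝ) ρ := by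
    intro ζ hζ
    simp only [mem_ball, dist_zero_right, Real.norm_eq_abs] at hζ ⊢
    exact ⟨(Complex.abs_re_le_norm ζ).trans_lt hζ, (Complex.abs_im_le_norm ζ).trans_lt hζ⟩
  have hmem : ∀ ζ ∈ ball (0 : ℂ) ρ, (ζ.re, ζ.im) ∈ ball (0 : ℝ × ℝ) ρ := fun ζ hζ =>
    hmk (hreim ζ hζ).1 (hreim ζ hζ).2
  have hfst : ∀ w ∈ ball (0 : ℝ × ℝ) ρ, ∀ v, fderiv ℝ (fun w => (Γ w).1) w v =
      (fderiv ℝ Γ w v).1 := fun w hw v =>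
    DFunLike.congr_fun (hΓ w hw).differentiableAt.hasFDerivAt.fst.fderiv v
  have hreal : ∀ x ∈ ball (0 : ℝ) ρ, φ (Γ (x, 0)).1 = 0 := by
    have h := integralCurve_mem_hypersurface hU hφ hX hdφ (fun q hq h0 => (hLie X .base q hq h0).1)
      hρ (hua.mono hρs) (fun x hx => hu' x (hρs hx)) (fun x hx => ?_)
      (by rw [hu₀ p (mem_ball_self hs)]; exact hφp)
    · intro x hx
      rw [hΓσ x hx]
      exact h x hx
    · have := hΓU _ (hmk hx (mem_ball_self hρ))
      rwa [hΓσ x hx] at this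
  have hvan : ∀ x ∈ ball (0 : ℝ) ρ, ∀ y ∈ ball (0 : ℝ) ρ, φ (Γ (x, y)).1 = 0 := by
    intro x hx
    have hUr : ∀ z ∈ ball (p, (0 : ℝ)) r, z.1 ∈ U := fun z hz => hrU (mem_ball_prod_zero.1 hz).1
    have hd : ∀ z ∈ ball (p, (0 : ℝ)) r, ∀ v, fderiv ℝ (fun z : F × ℝ => φ z.1) z v =
        fderiv ℝ φ z.1 v.1 := fun z hz v =>
      DFunLike.congr_fun ((hφ _ (hUr z hz)).differentiableAt.hasFDerivAt.comp z
        hasFDerivAt_fst).fderiv v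
    refine integralCurve_mem_hypersurface (φ := fun z : F × ℝ => φ z.1) isOpen_ball
      (fun z hz => (hφ _ (hUr z hz)).fun_comp (f := fun z : F × ℝ => z.1) analyticAt_fst) hZ₂
      (fun z hz h0 h => hdφ _ (hUr z hz) h0 ?_) (fun z hz h0 => ?_) hρ
      (σ := fun y => Γ (x, y)) (fun y hy => ?_) (fun y hy => ?_) (fun y hy => hball _ (hmk hx hy))
      (hreal x hx)
    · ext v
      rw [← hd z hz (v, 0), h]
      rfl
    · rw [hd z hz]
      exact hYtan z hz _ fun W hW => (hLie W hW _ (hUr z hz) h0).1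
    · exact AnalyticAt.fun_comp (f := fun y : ℝ => (x, y)) (hΓ _ (hmk hx hy))
        (analyticAt_const.prod analyticAt_id)
    · rw [← (hΓ' _ (hmk hx hy)).2]
      exact (hΓ _ (hmk hx hy)).differentiableAt.hasFDerivAt.hasDerivAt_snd
  refine ⟨ρ, hρ, fun ζ => (Γ (ζ.re, ζ.im)).1, fun ζ hζ => ?_, ?_, ?_, fun ζ hζ =>
    ⟨hΓU _ (hmem ζ hζ), hvan _ (hreim ζ hζ).1 _ (hreim ζ hζ).2⟩, fun t ht => ?_⟩
  · exact analyticAt_fst.comp (AnalyticAt.fun_comp (f := fun ζ : ℂ => (ζ.re, ζ.im))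
      (hΓ _ (hmem ζ hζ)) ((Complex.reCLM.analyticAt ζ).prod (Complex.imCLM.analyticAt ζ)))
  · refine jHolOn_of_coordinateFields (Γ := fun w => (Γ w).1) (ξ := fun w => Ξ (Γ w))
      (fun ζ hζ => (hΓ _ (hmem ζ hζ)).differentiableAt.fst) (fun ζ hζ => hJsq _ (hΓU _ (hmem ζ hζ)))
      (fun ζ hζ => ?_) (fun ζ hζ => ?_)
    · rw [hfst _ (hmem ζ hζ), (hΓ' _ (hmem ζ hζ)).1]
    · rw [hfst _ (hmem ζ hζ), (hΓ' _ (hmem ζ hζ)).2]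
      exact hYΞ _ (hball _ (hmem ζ hζ))
  · exact congrArg Prod.fst hΓ₀
  · have hγ : ∀ x ∈ ball (0 : ℝ) ρ, (Γ ((x : ℂ).re, (x : ℂ).im)).1 = u (p, x) := by
      intro x hx
      simp only [Complex.ofReal_re, Complex.ofReal_im, hΓσ x hx, hσ_def]
    simp only [hγ t ht]
    exact (hu' t (hρs ht)).congr_of_eventuallyEq
      (Filter.eventuallyEq_of_mem (isOpen_ball.mem_nhds ht) hγ)

end Analytic

/-- Theorem 1.2, `alg-lie`. -/
theorem stmt2 (n : ℕ) (U : Set (Ecx n)) (hU : IsOpen U) (h0U : (0 : Ecx n) ∈ U)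
    (J : Ecx n → Ecx n →L[ℝ] Ecx n) (hJan : AnalyticOnNhd ℝ J U)
    (hJsq : ∀ x ∈ U, (J x).comp (J x) = -ContinuousLinearMap.id ℝ (Ecx n))
    (hJ0 : J 0 = J0 n)
    (φ : Ecx n → ℝ) (hφan : AnalyticOnNhd ℝ φ U) (hφ0 : φ 0 = 0)
    (hdφ : ∀ q ∈ U, φ q = 0 → fderiv ℝ φ q ≠ 0)
    (X : Ecx n → Ecx n) (hXan : AnalyticOnNhd ℝ X U)
    (hLie : ∀ Y, LieGen J X Y → InTJM J φ U Y) :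
    ∃ V ∈ nhds (0 : Ecx n), ∀ p ∈ V, φ p = 0 →
      ∃ ρ > (0 : ℝ), ∃ γ : ℂ → Ecx n,
        AnalyticOnNhd ℝ γ (ball 0 ρ) ∧
        JHolOn J (ball 0 ρ) γ ∧
        γ 0 = p ∧
        (∀ ζ ∈ ball (0 : ℂ) ρ, γ ζ ∈ U ∧ φ (γ ζ) = 0) ∧
        ∀ k : ℕ, 1 ≤ k → iteratedDeriv k (fun t : ℝ => γ t) 0 = DX X X (k - 1) p := by
  refine ⟨U, hU.mem_nhds h0U, fun p hp hφp => ?_⟩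
  obtain ⟨ρ, hρ, γ, hγ, hhol, hγ₀, hγU, hγX⟩ :=
    exists_jHolomorphic_disc hU hJan hJsq hφan hdφ hXan hLie hp hφp
  refine ⟨ρ, hρ, γ, hγ, hhol, hγ₀, hγU, fun k hk => ?_⟩
  obtain ⟨k, rfl⟩ := Nat.exists_eq_add_of_le' hk
  have hmem : ∀ t ∈ ball (0 : ℝ) ρ, (t : ℂ) ∈ ball (0 : ℂ) ρ := fun t ht => by simpa using ht
  have hderiv : deriv (fun t : ℝ => γ t) =ᶠ[nhds 0] fun t : ℝ => X (γ t) :=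
    Filter.eventuallyEq_of_mem (ball_mem_nhds 0 hρ) fun t ht => (hγX t ht).deriv
  rw [iteratedDeriv_succ', hderiv.iteratedDeriv_eq,
    iteratedDeriv_comp_integralCurve hXan hXan isOpen_ball hγX (fun t ht => (hγU _ (hmem t ht)).1) k
      0 (mem_ball_self hρ), iterLieDeriv_eq_DX]
  simp [hγ₀]
end
end
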